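/- Conventions. For a C*-algebra $A$, $QA=A\star A$ is the free product with inclusions $\iota,\bar\iota:A\to QA$, $qA$ is the kernel of the homomorphism $QA\to A$ identifying the two copies, and $qx=\iota(x)-\bar\iota(x)$. A linear map $\theta:A\to B$ between C*-algebras is nuclear if there is $K\ge 0$ such that for every C*-algebra $D$ the map $\theta\otimes\mathrm{id}:A\otimes_{\mathrm{alg}}D\to B\otimes_{\max}D$ is bounded by $K$, where $A\otimes_{\mathrm{alg}}D$ carries the minimal C*-norm. A *-homomorphism $\varphi:qA\to B$ is $q$-nuclear if $x\mapsto\varphi(qx)$ is nuclear. $\mathcal M(\cdot)$ denotes the multiplier algebra. If $\varphi:qA\to Y$ is a *-homomorphism, $Y_0=\overline{\varphi(qA)\,Y\,\varphi(qA)}$ is the hereditary C*-subalgebra generated by its image and $\varphi_0:qA\to Y_0$ the corestriction, then $\varphi_0^\circ:QA\to\mathcal M(Y_0)$ denotes the unique *-homomorphism extending $\varphi_0$. Let $A,B,C$ be C*-algebras and let $\rho:qA\to B$ and $\psi:qB\to C$ be *-homomorphisms. (For the product in $KK$ the algebras $B$ and $C$ are stable, i.e. $B\cong\mathcal K\otimes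 B$ and $C\cong\mathcal K\otimes C$, with $\mathcal K$ the compact operators; this is not needed here.) Let $B_0\subseteq B$ be the hereditary subalgebra generated by $\rho(qA)$, let $\psi|_{qB_0}:qB_0\to C$ be the composition of $\psi$ with the map $qB_0\to qB$ induced by the inclusion, let $C_0\subseteq C$ be the hereditary subalgebra generated by $\psi|_{qB_0}(qB_0)$, and let $\rho_0:qA\to B_0$, $\psi_0:qB_0\to C_0$ be the corestrictions of $\rho$, $\psi|_{qB_0}$. Put $\varepsilon=\rho_0^\circ\iota,\ \bar\varepsilon=\rho_0^\circ\bar\iota:A\to\mathcal M(B_0)$ and $\eta=\psi_0^\circ\iota,\ \bar\eta=\psi_0^\circ\bar\iota:B_0\to\mathcal M(C_0)$, let $R\subseteq M_2(\mathcal M(C_0))$ be the C*-algebra generated by the matrices $$\begin{pmatrix} r_{11}&r_{12}\\ r_{21}&r_{22}\end{pmatrix},\qquad r_{11}\in\eta(B_0),\ r_{12}\in\eta(B_0)\bar\eta(B_0),\ r_{21}\in\bar\eta(B_0)\eta(B_0),\ r_{22}\in\bar\eta(B_0),$$ and let $J_0=R\cap M_2(C_0)$. Let $h_1=\mathrm{diag}(\eta\varepsilon,\bar\eta\bar\varepsilon)$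 and $h_2=\mathrm{diag}(\eta\bar\varepsilon,\bar\eta\varepsilon):A\to\mathcal M(R)$, that is, for $x\in A$ and $b,b'\in B_0$, $$h_1(x)\,\mathrm{diag}(\eta(b),\bar\eta(b'))=\mathrm{diag}(\eta(\varepsilon(x)b),\bar\eta(\bar\varepsilon(x)b')),\qquad h_2(x)\,\mathrm{diag}(\eta(b),\bar\eta(b'))=\mathrm{diag}(\eta(\bar\varepsilon(x)b),\bar\eta(\varepsilon(x)b')).$$ (i) If $\rho$ is $q$-nuclear or $\psi$ is $q$-nuclear, then for $i=1,2$ and every $z\in J_0$ the map $x\mapsto h_i(x)z$ takes values in $M_2(C_0)$ and is nuclear as a map $A\to M_2(C_0)$. (ii) If $\rho$ is $q$-nuclear, then for $i=1,2$ and every $z\in J_0$ the map $x\mapsto h_i(x)z$ takes values in $J_0$ and is nuclear even as a map $A\to J_0$. -/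

import Mathlib

universe u v w
open Filter
open scoped TensorProduct MultiplierAlgebra ENNReal NNReal Topology CStarAlgebra
noncomputable section
namespace KKNuc

section Tensor
variable {A : Type u} {B : Type u} [NonUnitalCStarAlgebra A] [NonUnitalCStarAlgebra B]

/-- For representations `π` of `A` on `H` and `σ` of `D` on `L`, the linear map
`∑ aᵢ ⊗ dᵢ ↦ ∑ π(aᵢ) ⊗ σ(dᵢ)`, an operator on the (uncompleted) Hilbert space tensor product. -/
def spatialRep {D : Type u} [NonUnitalCStarAlgebra D]
    {H L : Type u} [NormedAddCommGroup H] [InnerProductSpace ℂ H] [CompleteSpace H]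
    [NormedAddCommGroup L] [InnerProductSpace ℂ L] [CompleteSpace L]
    (π : A →⋆ₙₐ[ℂ] (H →L[ℂ] H)) (σ : D →⋆ₙₐ[ℂ] (L →L[ℂ] L)) :
    A ⊗[ℂ] D →ₗ[ℂ] ((H ⊗[ℂ] L) →L[ℂ] (H ⊗[ℂ] L)) :=
  TensorProduct.lift <| LinearMap.mk₂ ℂ (fun a d => TensorProduct.mapL (π a) (σ d))
    (fun a a' d => by rw [map_add, TensorProduct.mapL_add_left])
    (fun c a d => by rw [map_smul, TensorProduct.mapL_smul_left])
    (fun a d d' => by rw [map_add, TensorProduct.mapL_add_right])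
    (fun c a d => by rw [map_smul, TensorProduct.mapL_smul_right])

/-- The minimal (spatial) C*-norm on the algebraic tensor product `A ⊗ D`. -/
def minNorm {D : Type u} [NonUnitalCStarAlgebra D] (t : A ⊗[ℂ] D) : ℝ≥0∞ :=
  ⨆ (H : Type u) (_ : NormedAddCommGroup H) (_ : InnerProductSpace ℂ H) (_ : CompleteSpace H)
    (L : Type u) (_ : NormedAddCommGroup L) (_ : InnerProductSpace ℂ L) (_ : CompleteSpace L)
    (π : A →⋆ₙₐ[ℂ] (H →L[ℂ] H)) (σ : D →⋆ₙₐ[ℂ] (L →L[ℂ] L)), ‖spatialRep π σ t‖ₑ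

/-- For homomorphisms `f : B → E` and `g : D → E`, the linear map `∑ bᵢ ⊗ dᵢ ↦ ∑ f(bᵢ) g(dᵢ)`. -/
def productMap {D E : Type u} [NonUnitalCStarAlgebra D] [NonUnitalCStarAlgebra E]
    (f : B →⋆ₙₐ[ℂ] E) (g : D →⋆ₙₐ[ℂ] E) : B ⊗[ℂ] D →ₗ[ℂ] E :=
  TensorProduct.lift <| (LinearMap.mul ℂ E).compl₁₂ (f : B →ₗ[ℂ] E) (g : D →ₗ[ℂ] E)

/-- The maximal C*-norm on `B ⊗ D`: the supremum over all pairs of homomorphisms of `B` and `D`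
with commuting ranges into a C*-algebra. -/
def maxNorm {D : Type u} [NonUnitalCStarAlgebra D] (t : B ⊗[ℂ] D) : ℝ≥0∞ :=
  ⨆ (E : Type u) (_ : NonUnitalCStarAlgebra E) (f : B →⋆ₙₐ[ℂ] E) (g : D →⋆ₙₐ[ℂ] E)
    (_ : ∀ b d, Commute (f b) (g d)), ‖productMap f g t‖ₑ

/-- A linear map `θ : A → B` is nuclear if, for some constant `K`, the map
`θ ⊗ id : A ⊗ D → B ⊗_max D` is bounded by `K` for every C*-algebra `D`, where the algebraic tensor
product `A ⊗ D` carries the minimal norm. -/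
def IsNuclear (θ : A →ₗ[ℂ] B) : Prop :=
  ∃ K : ℝ≥0, ∀ (D : Type u) [NonUnitalCStarAlgebra D] (t : A ⊗[ℂ] D),
    maxNorm (TensorProduct.map θ (LinearMap.id : D →ₗ[ℂ] D) t) ≤ K * minNorm t
end Tensor

section Subalgebras

/-- A C*-subalgebra: a closed *-subalgebra. -/
structure CStarSub (Y : Type v) [NonUnitalCStarAlgebra Y] where
  toSub : NonUnitalStarSubalgebra ℂ Y
  closed : IsClosed (toSub : Set Y)

namespace CStarSub
variable {Y : Type v} [NonUnitalCStarAlgebra Y]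

/-- The underlying type of a C*-subalgebra. -/
def Carrier (S : CStarSub Y) : Type v := S.toSub

instance : CoeSort (CStarSub Y) (Type v) := ⟨Carrier⟩

instance (S : CStarSub Y) : NonUnitalCStarAlgebra S :=
  letI := S.closed
  inferInstanceAs (NonUnitalCStarAlgebra S.toSub)

/-- The inclusion of a C*-subalgebra. -/
def incl (S : CStarSub Y) : S →⋆ₙₐ[ℂ] Y where
  toFun x := x.1
  map_smul' _ _ := rfl
  map_zero' := rfl
  map_add' _ _ := rfl
  map_mul' _ _ := rfl
  map_star' _ := rfl

theorem incl_injective (S : CStarSub Y) : Function.Injective S.incl := Subtype.val_injective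

theorem incl_mem (S : CStarSub Y) (x : S) : S.incl x ∈ S.toSub := x.2

/-- An element of `Y` lying in the subalgebra, as an element of the subalgebra. -/
def elem (S : CStarSub Y) (y : Y) (h : y ∈ S.toSub) : S := ⟨y, h⟩

@[simp] theorem incl_elem (S : CStarSub Y) (y : Y) (h : y ∈ S.toSub) : S.incl (S.elem y h) = y :=
  rfl

/-- Corestriction of a homomorphism to a C*-subalgebra containing its range. -/
def corestrict (S : CStarSub Y) {X : Type w} [NonUnitalCStarAlgebra X] (f : X →⋆ₙₐ[ℂ] Y)
    (h : ∀ x, f x ∈ S.toSub) : X →⋆ₙₐ[ℂ] S where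
  toFun x := S.elem (f x) (h x)
  map_smul' c x := S.incl_injective (map_smul f c x)
  map_zero' := S.incl_injective (map_zero f)
  map_add' x y := S.incl_injective (map_add f x y)
  map_mul' x y := S.incl_injective (map_mul f x y)
  map_star' x := S.incl_injective (map_star f x)

theorem isometry_incl (S : CStarSub Y) : Isometry S.incl :=
  NonUnitalStarAlgHom.isometry S.incl S.incl_injective

/-- The C*-subalgebra generated by a set. -/
def gen (s : Set Y) : CStarSub Y where
  toSub := (NonUnitalStarAlgebra.adjoin ℂ s).topologicalClosure
  closed := NonUnitalStarSubalgebra.isClosed_topologicalClosure _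

theorem subset_gen {s : Set Y} {y : Y} (h : y ∈ s) : y ∈ (gen s).toSub :=
  NonUnitalStarSubalgebra.le_topologicalClosure _ (NonUnitalStarAlgebra.subset_adjoin ℂ _ h)

theorem gen_le {s : Set Y} {S : CStarSub Y} (h : s ⊆ S.toSub) : (gen s).toSub ≤ S.toSub :=
  NonUnitalStarSubalgebra.topologicalClosure_minimal _ (NonUnitalStarAlgebra.adjoin_le h) S.closed

/-- The preimage of a C*-subalgebra under a homomorphism. -/
def comap {X : Type w} [NonUnitalCStarAlgebra X] (f : X →⋆ₙₐ[ℂ] Y) (S : CStarSub Y) :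
    CStarSub X where
  toSub := S.toSub.comap f
  closed := S.closed.preimage (map_continuous f)

/-- Induction principle for the C*-algebra generated by a set: a C*-subalgebra of `gen s`
containing `s` is everything. -/
theorem gen_induction {s : Set Y} (T : CStarSub (gen s))
    (h : ∀ y (hy : y ∈ s), (gen s).elem y (subset_gen hy) ∈ T.toSub) (x : gen s) :
    x ∈ T.toSub := by
  have hcl : IsClosed ((gen s).incl '' (T.toSub : Set (gen s))) := by
    refine ((gen s).isometry_incl.isClosedEmbedding).isClosedMap _ T.closed
  let T' : CStarSub Y := ⟨T.toSub.map (gen s).incl, hcl⟩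
  have : (gen s).toSub ≤ T'.toSub :=
    gen_le fun y hy => ⟨_, h y hy, rfl⟩
  obtain ⟨x', hx', hxx'⟩ := this ((gen s).incl_mem x)
  rwa [← (gen s).incl_injective hxx']

/-- The kernel of a homomorphism. -/
def ker {X : Type w} [NonUnitalCStarAlgebra X] (f : X →⋆ₙₐ[ℂ] Y) : CStarSub X where
  toSub := (⊥ : NonUnitalStarSubalgebra ℂ Y).comap f
  closed := by
    have : ((⊥ : NonUnitalStarSubalgebra ℂ Y).comap f : Set X) = {x | f x = 0} := by
      ext x; simp
    rw [this]
    exact isClosed_eq (map_continuous f) continuous_const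

theorem mem_ker {X : Type w} [NonUnitalCStarAlgebra X] {f : X →⋆ₙₐ[ℂ] Y} {x : X} :
    x ∈ (ker f).toSub ↔ f x = 0 := by
  change f x ∈ (⊥ : NonUnitalStarSubalgebra ℂ Y) ↔ _
  exact NonUnitalStarAlgebra.mem_bot

end CStarSub
end Subalgebras

section FreeProduct
/-- A pair of homomorphisms from `A` to a common C*-algebra. -/
structure HomPair (A : Type u) [NonUnitalCStarAlgebra A] where
  E : Type u
  [inst : NonUnitalCStarAlgebra E]
  f : A →⋆ₙₐ[ℂ] E
  g : A →⋆ₙₐ[ℂ] E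
attribute [instance] HomPair.inst

variable (A : Type u) [NonUnitalCStarAlgebra A]

/-- The `ℓ^∞`-product of the targets of all pairs of homomorphisms on `A`. -/
abbrev PairProd : Type (u + 1) := lp (fun p : HomPair A => p.E) ∞

variable {A}

/-- The homomorphism into an `ℓ^∞`-product with given coordinates. -/
def toLp {X : Type v} [NonUnitalCStarAlgebra X] {I : Type w} {E : I → Type u}
    [∀ i, NonUnitalCStarAlgebra (E i)] (f : ∀ i, X →⋆ₙₐ[ℂ] E i) : X →⋆ₙₐ[ℂ] lp E ∞ where
  toFun x := ⟨fun i => f i x, memℓp_infty ⟨‖x‖, by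
    rintro _ ⟨i, rfl⟩; exact NonUnitalStarAlgHom.norm_apply_le (f i) x⟩⟩
  map_smul' c x := by ext i; simp
  map_zero' := by ext i; simp
  map_add' x y := by ext i; exact map_add (f i) x y
  map_mul' x y := by ext i; exact map_mul (f i) x y
  map_star' x := by ext i; exact map_star (f i) x

/-- The coordinate projection of an `ℓ^∞`-product. -/
def evalLp {I : Type w} {E : I → Type u} [∀ i, NonUnitalCStarAlgebra (E i)] (i : I) :
    lp E ∞ →⋆ₙₐ[ℂ] E i where
  toFun F := F i
  map_smul' c x := by simp
  map_zero' := by simp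
  map_add' x y := by simp
  map_mul' x y := by simp
  map_star' x := by simp

variable (A) in
/-- The two canonical copies of `A` in the product. -/
def pairι : A →⋆ₙₐ[ℂ] PairProd A := toLp fun p : HomPair A => p.f

variable (A) in
def pairιbar : A →⋆ₙₐ[ℂ] PairProd A := toLp fun p : HomPair A => p.g

variable (A) in
/-- The free product `QA = A ⋆ A`: the C*-algebra generated by the two canonical copies of `A` in
the product over all pairs of homomorphisms on `A`. A C*-algebra generated by two images of `A` has
a copy in the universe of `A`, so no pair of homomorphisms is missed; see `Q.lift`, `Q.hom_ext` for
the universal property. -/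
def Q : CStarSub (PairProd A) := .gen (Set.range (pairι A) ∪ Set.range (pairιbar A))

variable (A) in
/-- `ι : A → QA`. -/
def ι : A →⋆ₙₐ[ℂ] Q A := (Q A).corestrict (pairι A) fun x => CStarSub.subset_gen (Or.inl ⟨x, rfl⟩)

variable (A) in
/-- `ῑ : A → QA`. -/
def ιbar : A →⋆ₙₐ[ℂ] Q A :=
  (Q A).corestrict (pairιbar A) fun x => CStarSub.subset_gen (Or.inr ⟨x, rfl⟩)

/-- The homomorphism `QA → E` determined by two homomorphisms `A → E`. -/
def Q.lift {E : Type u} [NonUnitalCStarAlgebra E] (f g : A →⋆ₙₐ[ℂ] E) : Q A →⋆ₙₐ[ℂ] E :=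
  (evalLp (⟨E, f, g⟩ : HomPair A)).comp (Q A).incl

@[simp] theorem Q.lift_ι {E : Type u} [NonUnitalCStarAlgebra E] (f g : A →⋆ₙₐ[ℂ] E) (x : A) :
    Q.lift f g (ι A x) = f x := rfl

@[simp] theorem Q.lift_ιbar {E : Type u} [NonUnitalCStarAlgebra E] (f g : A →⋆ₙₐ[ℂ] E) (x : A) :
    Q.lift f g (ιbar A x) = g x := rfl

/-- A homomorphism on `QA` is determined by its restrictions to the two copies of `A`. -/
theorem Q.hom_ext {E : Type v} [NonUnitalCStarAlgebra E] {f g : Q A →⋆ₙₐ[ℂ] E}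
    (h : ∀ x, f (ι A x) = g (ι A x)) (h' : ∀ x, f (ιbar A x) = g (ιbar A x)) : f = g := by
  ext z
  let T : CStarSub (Q A) :=
    ⟨NonUnitalStarAlgHom.equalizer f g, isClosed_eq (map_continuous f) (map_continuous g)⟩
  refine CStarSub.gen_induction T ?_ z
  rintro _ (⟨x, rfl⟩ | ⟨x, rfl⟩)
  · exact h x
  · exact h' x

variable (A) in
/-- The homomorphism `QA → A` identifying the two copies of `A`. -/
def Q.fold : Q A →⋆ₙₐ[ℂ] A :=
  Q.lift (NonUnitalStarAlgHom.id ℂ A) (NonUnitalStarAlgHom.id ℂ A)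

variable (A) in
/-- `qA`, the kernel of `QA → A`. -/
def q : CStarSub (Q A) := .ker (Q.fold A)

variable (A) in
theorem q.gen_mem (x : A) : ι A x - ιbar A x ∈ (q A).toSub := by
  refine CStarSub.mem_ker.2 ?_
  rw [map_sub]
  exact sub_self x

variable (A) in
/-- The linear map `x ↦ qx = ι(x) - ῑ(x)`, `A → qA`. -/
def q.gen : A →ₗ[ℂ] q A where
  toFun x := (q A).elem (ι A x - ιbar A x) (q.gen_mem A x)
  map_add' x y := (q A).incl_injective (by
    change ι A (x + y) - ιbar A (x + y) = (ι A x - ιbar A x) + (ι A y - ιbar A y)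
    rw [map_add, map_add]; abel)
  map_smul' c x := (q A).incl_injective (by
    change ι A (c • x) - ιbar A (c • x) = c • (ι A x - ιbar A x)
    rw [map_smul, map_smul, smul_sub])

variable {B : Type u} [NonUnitalCStarAlgebra B]

/-- Functoriality of the product: precomposition of pairs with `j : A → B`. -/
def pairMap (j : A →⋆ₙₐ[ℂ] B) : PairProd A →⋆ₙₐ[ℂ] PairProd B :=
  toLp fun p : HomPair B => evalLp (⟨p.E, p.f.comp j, p.g.comp j⟩ : HomPair A)

/-- The homomorphism `QA → QB` induced by `j : A → B`; it maps `ι(x)`, `ῑ(x)` to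
`ι(j x)`, `ῑ(j x)`. -/
def Q.map (j : A →⋆ₙₐ[ℂ] B) : Q A →⋆ₙₐ[ℂ] Q B :=
  (Q B).corestrict ((pairMap j).comp (Q A).incl) fun z => by
    have h : (Q A).toSub ≤ ((Q B).comap (pairMap j)).toSub := by
      refine CStarSub.gen_le ?_
      rintro _ (⟨x, rfl⟩ | ⟨x, rfl⟩)
      · exact CStarSub.subset_gen (Or.inl ⟨j x, rfl⟩)
      · exact CStarSub.subset_gen (Or.inr ⟨j x, rfl⟩)
    exact h ((Q A).incl_mem z)

@[simp] theorem Q.map_ι (j : A →⋆ₙₐ[ℂ] B) (x : A) : Q.map j (ι A x) = ι B (j x) := rfl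

@[simp] theorem Q.map_ιbar (j : A →⋆ₙₐ[ℂ] B) (x : A) : Q.map j (ιbar A x) = ιbar B (j x) := rfl

theorem Q.fold_map (j : A →⋆ₙₐ[ℂ] B) (z : Q A) : Q.fold B (Q.map j z) = j (Q.fold A z) := by
  have : (Q.fold B).comp (Q.map j) = j.comp (Q.fold A) := Q.hom_ext (fun _ => rfl) (fun _ => rfl)
  exact DFunLike.congr_fun this z

/-- The homomorphism `qA → qB` induced by `j : A → B`. -/
def q.map (j : A →⋆ₙₐ[ℂ] B) : q A →⋆ₙₐ[ℂ] q B :=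
  (q B).corestrict ((Q.map j).comp (q A).incl) fun z => CStarSub.mem_ker.2 (by
    have : Q.fold A ((q A).incl z) = 0 := CStarSub.mem_ker.1 ((q A).incl_mem z)
    change Q.fold B (Q.map j ((q A).incl z)) = 0
    rw [Q.fold_map, this, map_zero])

/-- A homomorphism `ψ` on `qA` is `q`-nuclear if `x ↦ ψ(qx)` is nuclear. -/
def IsQNuclear (ψ : q A →⋆ₙₐ[ℂ] B) : Prop := IsNuclear ((ψ : q A →ₗ[ℂ] B) ∘ₗ q.gen A)

end FreeProduct

section Extension

/-- Every C*-algebra has a contractive approximate unit. -/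
theorem exists_approx_unit (I : Type v) [NonUnitalCStarAlgebra I] :
    ∃ l : Filter I, l.NeBot ∧ (∀ᶠ x in l, ‖x‖ ≤ 1) ∧
      (∀ x, Tendsto (fun y => y * x) l (𝓝 x)) ∧ (∀ x, Tendsto (fun y => x * y) l (𝓝 x)) := by
  let _ := CStarAlgebra.spectralOrder I
  let _ := CStarAlgebra.spectralOrderedRing I
  have h := CStarAlgebra.increasingApproximateUnit I
  exact ⟨_, h.neBot, h.eventually_norm, h.tendsto_mul_right, h.tendsto_mul_left⟩

/-- A multiplier is left `D`-linear on products. -/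
theorem multiplier_fst_mul {D : Type v} [NonUnitalCStarAlgebra D] (m : 𝓜(ℂ, D)) (x y : D) :
    m.fst (x * y) = m.fst x * y := by
  have h : ∀ z : D, z * (m.fst (x * y) - m.fst x * y) = 0 := by
    intro z
    rw [mul_sub, ← mul_assoc, ← m.central, ← m.central, mul_assoc, sub_self]
  have := h (star (m.fst (x * y) - m.fst x * y))
  exact sub_eq_zero.1 (CStarRing.star_mul_self_eq_zero_iff _ |>.1 this)

/-- Multipliers are determined by their left action. -/
theorem multiplier_ext {D : Type v} [NonUnitalCStarAlgebra D] {m m' : 𝓜(ℂ, D)}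
    (h : ∀ x, m.fst x = m'.fst x) : m = m' := by
  refine DoubleCentralizer.ext ℂ D m m' (Prod.ext (ContinuousLinearMap.ext h)
    (ContinuousLinearMap.ext fun x => ?_))
  have h' : ∀ z : D, (m.snd x - m'.snd x) * z = 0 := by
    intro z
    rw [sub_mul, m.central, m'.central, h, sub_self]
  exact sub_eq_zero.1 (CStarRing.mul_star_self_eq_zero_iff _ |>.1
    (h' (star (m.snd x - m'.snd x))))

variable {I : Type v} {E : Type w} {D : Type u} [NonUnitalCStarAlgebra I] [NonUnitalCStarAlgebra E]
  [NonUnitalCStarAlgebra D]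

/-- `φ : I → D` is nondegenerate: the span of `φ(I)D` is dense in `D`. -/
def Nondegenerate (φ : I →⋆ₙₐ[ℂ] D) : Prop :=
  ∀ d : D, d ∈ closure (Submodule.span ℂ {x : D | ∃ i d', x = φ i * d'} : Set D)

/-- `j : I → E` identifies `I` with a two-sided ideal of `E`. -/
structure IsIdealEmbedding (j : I →⋆ₙₐ[ℂ] E) : Prop where
  inj : Function.Injective j
  mul_left : ∀ e i, ∃ i', j i' = e * j i
  mul_right : ∀ e i, ∃ i', j i' = j i * e

theorem Nondegenerate.ext {φ : I →⋆ₙₐ[ℂ] D} (hφ : Nondegenerate φ) {m m' : 𝓜(ℂ, D)}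
    (h : ∀ i, m.fst (φ i) = m'.fst (φ i)) : m = m' := by
  refine multiplier_ext fun d => ?_
  have hcl : IsClosed {d : D | m.fst d = m'.fst d} :=
    isClosed_eq m.fst.continuous m'.fst.continuous
  refine hcl.closure_subset_iff.2 ?_ (hφ d)
  intro x hx
  induction hx using Submodule.span_induction with
  | mem x hx =>
    obtain ⟨i, d', rfl⟩ := hx
    change m.fst _ = m'.fst _
    rw [multiplier_fst_mul, multiplier_fst_mul, h]
  | zero => change m.fst _ = m'.fst _; rw [map_zero, map_zero]
  | add x y _ _ hx hy =>
    change m.fst _ = m'.fst _; rw [map_add, map_add]; exact congrArg₂ _ hx hy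
  | smul c x _ hx =>
    change m.fst _ = m'.fst _; rw [map_smul, map_smul]; exact congrArg _ hx

/-- The left action of `e ∈ E` on `D` induced by a nondegenerate homomorphism on an ideal. -/
theorem exists_left_action {j : I →⋆ₙₐ[ℂ] E} (hj : IsIdealEmbedding j) {φ : I →⋆ₙₐ[ℂ] D}
    (hφ : Nondegenerate φ) (e : E) :
    ∃ L : D →L[ℂ] D, ∀ i i' d, j i' = e * j i → L (φ i * d) = φ i' * d := by
  obtain ⟨l, hl, hn, hr, -⟩ := exists_approx_unit I
  choose a ha using fun i => hj.mul_left e i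
  have hanorm : ∀ u, ‖u‖ ≤ 1 → ∀ d, ‖φ (a u) * d‖ ≤ ‖e‖ * ‖d‖ := by
    intro u hu d
    refine (norm_mul_le _ _).trans ?_
    gcongr
    refine (NonUnitalStarAlgHom.norm_apply_le φ _).trans ?_
    rw [← NonUnitalStarAlgHom.norm_map j hj.inj, ha]
    refine (norm_mul_le _ _).trans ?_
    refine (mul_le_mul_of_nonneg_left ((NonUnitalStarAlgHom.norm_apply_le j u).trans hu)
      (norm_nonneg e)).trans (by rw [mul_one])
  have hamul : ∀ u i i', j i' = e * j i → a u * i = a (u * i) := by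
    intro u i i' _
    apply hj.inj
    rw [map_mul, ha, ha, map_mul, mul_assoc]
  -- convergence on the algebraic span
  have hgen : ∀ i i' d, j i' = e * j i →
      Tendsto (fun u => φ (a u) * (φ i * d)) l (𝓝 (φ i' * d)) := by
    intro i i' d h
    have h1 : Tendsto (fun u => a (u * i)) l (𝓝 i') := by
      rw [(NonUnitalStarAlgHom.isometry j hj.inj).isEmbedding.tendsto_nhds_iff]
      have h2 : (⇑j ∘ fun u => a (u * i)) = fun u => e * j (u * i) := by
        funext u; exact ha _
      rw [h2, h]
      exact ((map_continuous j).continuousAt.tendsto.comp (hr i)).const_mul e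
    have h3 : (fun u => φ (a u) * (φ i * d)) = fun u => φ (a (u * i)) * d := by
      funext u
      rw [← mul_assoc, ← map_mul, hamul u i i' h]
    rw [h3]
    exact (((map_continuous φ).tendsto i').comp h1).mul_const d
  have hspan : ∀ d ∈ Submodule.span ℂ {x : D | ∃ i d', x = φ i * d'},
      ∃ d', Tendsto (fun u => φ (a u) * d) l (𝓝 d') := by
    intro d hd
    induction hd using Submodule.span_induction with
    | mem x hx =>
      obtain ⟨i, d', rfl⟩ := hx
      exact ⟨_, hgen i (a i) d' (ha i)⟩
    | zero => exact ⟨0, by simp⟩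
    | add x y _ _ hx hy =>
      obtain ⟨x', hx'⟩ := hx
      obtain ⟨y', hy'⟩ := hy
      exact ⟨x' + y', by simpa [mul_add] using hx'.add hy'⟩
    | smul c x _ hx =>
      obtain ⟨x', hx'⟩ := hx
      exact ⟨c • x', by simpa [mul_smul_comm] using hx'.const_smul c⟩
  have hall : ∀ d, ∃ d', Tendsto (fun u => φ (a u) * d) l (𝓝 d') := by
    intro d
    rw [← cauchy_map_iff_exists_tendsto, Metric.cauchy_iff]
    refine ⟨inferInstance, fun ε hε => ?_⟩
    obtain ⟨δ, hδ, hδ'⟩ : ∃ δ > 0, ‖e‖ * δ ≤ ε / 4 := by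
      refine ⟨ε / 4 / (‖e‖ + 1), by positivity, ?_⟩
      rw [mul_div_assoc', div_le_iff₀ (by positivity)]
      nlinarith [norm_nonneg e]
    obtain ⟨s, hs, hsd⟩ := Metric.mem_closure_iff.1 (hφ d) δ hδ
    obtain ⟨s', hs'⟩ := hspan s hs
    have hev : ∀ᶠ u in l, ‖φ (a u) * d - s'‖ < ε / 2 := by
      filter_upwards [hn, hs'.eventually (Metric.ball_mem_nhds s' (by positivity : 0 < ε / 4))]
        with u hu hus
      have h1 : ‖φ (a u) * (d - s)‖ ≤ ε / 4 := by
        refine (hanorm u hu _).trans (le_trans ?_ hδ')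
        rw [dist_eq_norm] at hsd
        gcongr
      have h2 : ‖φ (a u) * s - s'‖ < ε / 4 := by rwa [← dist_eq_norm]
      calc ‖φ (a u) * d - s'‖ = ‖φ (a u) * (d - s) + (φ (a u) * s - s')‖ := by
            rw [mul_sub]; congr 1; abel
        _ ≤ _ := norm_add_le _ _
        _ < ε / 2 := by linarith
    refine ⟨_, image_mem_map hev, ?_⟩
    rintro _ ⟨u, hu, rfl⟩ _ ⟨u', hu', rfl⟩
    calc dist (φ (a u) * d) (φ (a u') * d)
        ≤ dist (φ (a u) * d) s' + dist (φ (a u') * d) s' := dist_triangle_right _ _ _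
      _ < ε := by
        rw [dist_eq_norm, dist_eq_norm]
        have h1 : ‖φ (a u) * d - s'‖ < ε / 2 := hu
        have h2 : ‖φ (a u') * d - s'‖ < ε / 2 := hu'
        linarith
  choose F hF using hall
  let L₀ : D →ₗ[ℂ] D :=
    { toFun := F
      map_add' := fun x y => tendsto_nhds_unique (hF (x + y))
        (by simpa [mul_add] using (hF x).add (hF y))
      map_smul' := fun c x => tendsto_nhds_unique (hF (c • x))
        (by simpa [mul_smul_comm] using (hF x).const_smul c) }
  refine ⟨L₀.mkContinuous ‖e‖ fun d => ?_, fun i i' d h => ?_⟩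
  · refine le_of_tendsto (hF d).norm ?_
    filter_upwards [hn] with u hu using hanorm u hu d
  · exact tendsto_nhds_unique (hF _) (hgen i i' d h)

theorem exists_multiplier {j : I →⋆ₙₐ[ℂ] E} (hj : IsIdealEmbedding j) {φ : I →⋆ₙₐ[ℂ] D}
    (hφ : Nondegenerate φ) (e : E) :
    ∃ m : 𝓜(ℂ, D), ∀ i i', j i' = e * j i → m.fst (φ i) = φ i' := by
  obtain ⟨L, hL⟩ := exists_left_action hj hφ e
  obtain ⟨L', hL'⟩ := exists_left_action hj hφ (star e)
  -- `star (L' x) * y = star x * L y`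
  have hcentral : ∀ x y : D, star (L' x) * y = star x * L y := by
    have h1 : ∀ i d k c, star (L' (φ i * d)) * (φ k * c) = star (φ i * d) * L (φ k * c) := by
      intro i d k c
      obtain ⟨i', hi'⟩ := hj.mul_left (star e) i
      obtain ⟨k', hk'⟩ := hj.mul_left e k
      rw [hL' i i' d hi', hL k k' c hk', star_mul, star_mul, ← map_star, ← map_star, mul_assoc,
        mul_assoc, ← mul_assoc (φ (star i')), ← mul_assoc (φ (star i)), ← map_mul, ← map_mul]
      have : star i' * k = star i * k' := by
        apply hj.inj
        rw [map_mul, map_mul, map_star, map_star, hi', hk', star_mul, star_star, mul_assoc]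
      rw [this]
    have h2 : ∀ i d y, star (L' (φ i * d)) * y = star (φ i * d) * L y := by
      intro i d y
      have hcl : IsClosed {y : D | star (L' (φ i * d)) * y = star (φ i * d) * L y} :=
        isClosed_eq (by fun_prop) (by fun_prop)
      refine hcl.closure_subset_iff.2 ?_ (hφ y)
      intro y hy
      induction hy using Submodule.span_induction with
      | mem y hy => obtain ⟨k, c, rfl⟩ := hy; exact h1 i d k c
      | zero => simp
      | add x y _ _ hx hy =>
        change _ = _ at hx hy ⊢
        rw [mul_add, map_add, mul_add, hx, hy]
      | smul c x _ hx =>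
        change _ = _ at hx ⊢
        rw [mul_smul_comm, map_smul, mul_smul_comm, hx]
    intro x y
    have hcl : IsClosed {x : D | star (L' x) * y = star x * L y} :=
      isClosed_eq (by fun_prop) (by fun_prop)
    refine hcl.closure_subset_iff.2 ?_ (hφ x)
    intro x hx
    induction hx using Submodule.span_induction with
    | mem y hy => obtain ⟨k, c, rfl⟩ := hy; exact h2 k c _
    | zero => simp
    | add x y _ _ hx hy =>
      change _ = _ at hx hy ⊢
      rw [map_add, star_add, add_mul, hx, hy, star_add, add_mul]
    | smul c x _ hx =>
      change _ = _ at hx ⊢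
      rw [map_smul, star_smul, smul_mul_assoc, hx, star_smul, smul_mul_assoc]
  let R : D →L[ℂ] D :=
    LinearMap.mkContinuous
      { toFun := fun x => star (L' (star x))
        map_add' := fun x y => by simp
        map_smul' := fun c x => by simp [star_smul] } ‖L'‖ fun x => by
      change ‖star (L' (star x))‖ ≤ _
      rw [norm_star, ← norm_star x]
      exact L'.le_opNorm _
  refine ⟨⟨(L, R), fun x y => ?_⟩, fun i i' h => ?_⟩
  · change star (L' (star x)) * y = x * L y
    rw [hcentral, star_star]
  · change L (φ i) = φ i'
    obtain ⟨l, hl, hn, hr, hlft⟩ := exists_approx_unit D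
    refine tendsto_nhds_unique (f := fun u => L (φ i * u)) (l := l)
      ((L.continuous.tendsto _).comp (hlft (φ i))) ?_
    simp only [hL i i' _ h]
    exact hlft _

/-- The extension of a nondegenerate homomorphism `φ : I → D`, defined on an ideal `I` of `E`,
to a homomorphism `E → 𝓜(D)`; it is determined by `multExt e * φ i = φ (e * i)`. -/
def multExt {j : I →⋆ₙₐ[ℂ] E} (hj : IsIdealEmbedding j) {φ : I →⋆ₙₐ[ℂ] D}
    (hφ : Nondegenerate φ) : E →⋆ₙₐ[ℂ] 𝓜(ℂ, D) where
  toFun e := (exists_multiplier hj hφ e).choose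
  map_smul' c e := by
    refine hφ.ext fun i => ?_
    obtain ⟨i', hi'⟩ := hj.mul_left e i
    rw [(exists_multiplier hj hφ (c • e)).choose_spec i (c • i')
      (by rw [map_smul, hi', smul_mul_assoc]), map_smul]
    change _ = c • (exists_multiplier hj hφ e).choose.fst (φ i)
    rw [(exists_multiplier hj hφ e).choose_spec i i' hi']
  map_zero' := by
    refine hφ.ext fun i => ?_
    rw [(exists_multiplier hj hφ 0).choose_spec i 0 (by rw [map_zero, zero_mul]), map_zero]
    rfl
  map_add' e f := by
    refine hφ.ext fun i => ?_
    obtain ⟨i', hi'⟩ := hj.mul_left e i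
    obtain ⟨i'', hi''⟩ := hj.mul_left f i
    rw [(exists_multiplier hj hφ (e + f)).choose_spec i (i' + i'')
      (by rw [map_add, hi', hi'', add_mul]), map_add]
    change _ = (exists_multiplier hj hφ e).choose.fst (φ i)
      + (exists_multiplier hj hφ f).choose.fst (φ i)
    rw [(exists_multiplier hj hφ e).choose_spec i i' hi',
      (exists_multiplier hj hφ f).choose_spec i i'' hi'']
  map_mul' e f := by
    refine hφ.ext fun i => ?_
    obtain ⟨i'', hi''⟩ := hj.mul_left f i
    obtain ⟨i', hi'⟩ := hj.mul_left e i''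
    rw [(exists_multiplier hj hφ (e * f)).choose_spec i i' (by rw [hi', hi'', mul_assoc])]
    change _ = (exists_multiplier hj hφ e).choose.fst
      ((exists_multiplier hj hφ f).choose.fst (φ i))
    rw [(exists_multiplier hj hφ f).choose_spec i i'' hi'',
      (exists_multiplier hj hφ e).choose_spec i'' i' hi']
  map_star' e := by
    refine hφ.ext fun i => ?_
    obtain ⟨i', hi'⟩ := hj.mul_left (star e) i
    rw [(exists_multiplier hj hφ (star e)).choose_spec i i' hi', DoubleCentralizer.star_fst,
      ← map_star φ i]
    refine star_injective ?_
    rw [star_star, ← map_star φ]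
    -- compare after multiplication with `φ k * d` on the right
    have h1 : ∀ y : D, ((exists_multiplier hj hφ e).choose.snd (φ (star i)) - φ (star i')) * y
        = 0 := by
      intro y
      have hcl : IsClosed {y : D | ((exists_multiplier hj hφ e).choose.snd (φ (star i))
          - φ (star i')) * y = 0} := isClosed_eq (by fun_prop) (by fun_prop)
      refine hcl.closure_subset_iff.2 ?_ (hφ y)
      intro y hy
      induction hy using Submodule.span_induction with
      | mem y hy =>
        obtain ⟨k, d, rfl⟩ := hy
        obtain ⟨k', hk'⟩ := hj.mul_left e k
        change _ = _
        rw [sub_mul, DoubleCentralizer.central, multiplier_fst_mul,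
          (exists_multiplier hj hφ e).choose_spec k k' hk', ← mul_assoc, ← mul_assoc, ← map_mul,
          ← map_mul]
        have : star i * k' = star i' * k := by
          apply hj.inj
          rw [map_mul, map_mul, map_star, map_star, hi', hk', star_mul, star_star, mul_assoc]
        rw [this, sub_self]
      | zero => simp
      | add x y _ _ hx hy =>
        change _ = _ at hx hy ⊢
        rw [mul_add, hx, hy, add_zero]
      | smul c x _ hx =>
        change _ = _ at hx ⊢
        rw [mul_smul_comm, hx, smul_zero]
    exact (sub_eq_zero.1 (CStarRing.mul_star_self_eq_zero_iff _ |>.1 (h1 (star _)))).symm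

/-- The characteristic property of `multExt`. -/
theorem multExt_fst {j : I →⋆ₙₐ[ℂ] E} (hj : IsIdealEmbedding j) {φ : I →⋆ₙₐ[ℂ] D}
    (hφ : Nondegenerate φ) (e : E) (i i' : I) (h : j i' = e * j i) :
    (multExt hj hφ e).fst (φ i) = φ i' :=
  (exists_multiplier hj hφ e).choose_spec i i' h

/-- `multExt` extends `φ`. -/
theorem multExt_apply {j : I →⋆ₙₐ[ℂ] E} (hj : IsIdealEmbedding j) {φ : I →⋆ₙₐ[ℂ] D}
    (hφ : Nondegenerate φ) (i : I) : multExt hj hφ (j i) = (φ i : 𝓜(ℂ, D)) := by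
  refine hφ.ext fun k => ?_
  rw [multExt_fst hj hφ (j i) k (i * k) (map_mul j i k), map_mul]
  rfl

end Extension
section Hereditary
variable {X : Type v} {Y : Type w} [NonUnitalCStarAlgebra X] [NonUnitalCStarAlgebra Y]

/-- The hereditary C*-subalgebra of `Y` generated by the image of `φ : X → Y`: the C*-subalgebra
generated by `φ(X) Y φ(X)`. -/
def her (φ : X →⋆ₙₐ[ℂ] Y) : CStarSub Y := .gen {y : Y | ∃ z b w, y = φ z * b * φ w}

theorem map_mem_her (φ : X →⋆ₙₐ[ℂ] Y) (z : X) : φ z ∈ (her φ).toSub := by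
  obtain ⟨l, hl, hn, hr, -⟩ := exists_approx_unit X
  have hcl := (her φ).closed
  have h1 : ∀ u v : X, φ (u * (v * z)) ∈ (her φ).toSub := fun u v => by
    rw [map_mul, map_mul, ← mul_assoc]
    exact CStarSub.subset_gen ⟨u, φ v, z, rfl⟩
  have h2 : ∀ v : X, φ (v * z) ∈ (her φ).toSub := fun v =>
    hcl.mem_of_tendsto (((map_continuous φ).tendsto _).comp (hr (v * z)))
      (Eventually.of_forall fun u => h1 u v)
  exact hcl.mem_of_tendsto (((map_continuous φ).tendsto _).comp (hr z))
    (Eventually.of_forall h2)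

/-- The corestriction of `φ` to the hereditary subalgebra generated by its image. -/
def completed (φ : X →⋆ₙₐ[ℂ] Y) : X →⋆ₙₐ[ℂ] her φ := (her φ).corestrict φ (map_mem_her φ)

/-- A criterion for nondegeneracy: for a homomorphism into the C*-algebra generated by `s`, it
suffices to approximate the elements of `s` and their adjoints. -/
theorem nondegenerate_of_generators {s : Set Y} (φ : X →⋆ₙₐ[ℂ] CStarSub.gen s)
    (hs : ∀ d : CStarSub.gen s, ((CStarSub.gen s).incl d ∈ s ∨ (CStarSub.gen s).incl (star d) ∈ s) →
      d ∈ closure (Submodule.span ℂ {x | ∃ i d', x = φ i * d'} : Set (CStarSub.gen s))) :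
    Nondegenerate φ := by
  let N : Submodule ℂ (CStarSub.gen s) :=
    (Submodule.span ℂ {x | ∃ i d', x = φ i * d'}).topologicalClosure
  have hNcl : IsClosed (N : Set (CStarSub.gen s)) := Submodule.isClosed_topologicalClosure _
  have hmul : ∀ x ∈ N, ∀ y : CStarSub.gen s, x * y ∈ N := by
    intro x hx y
    have hcl : IsClosed {x : CStarSub.gen s | x * y ∈ N} := hNcl.preimage (by fun_prop)
    refine hcl.closure_subset_iff.2 ?_ hx
    intro x hx
    induction hx using Submodule.span_induction with
    | mem x hx =>
      obtain ⟨i, d, rfl⟩ := hx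
      exact subset_closure (Submodule.subset_span ⟨i, d * y, mul_assoc _ _ _⟩)
    | zero => change _ ∈ N; rw [zero_mul]; exact N.zero_mem
    | add x x' _ _ hx hx' => change _ ∈ N; rw [add_mul]; exact N.add_mem hx hx'
    | smul c x _ hx => change _ ∈ N; rw [smul_mul_assoc]; exact N.smul_mem c hx
  let T : CStarSub (CStarSub.gen s) :=
    { toSub :=
        { carrier := {d | d ∈ N ∧ star d ∈ N}
          add_mem' := fun {x y} hx hy =>
            ⟨N.add_mem hx.1 hy.1, by rw [star_add]; exact N.add_mem hx.2 hy.2⟩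
          zero_mem' := ⟨N.zero_mem, by rw [star_zero]; exact N.zero_mem⟩
          mul_mem' := fun {x y} hx hy =>
            ⟨hmul _ hx.1 _, by rw [star_mul]; exact hmul _ hy.2 _⟩
          smul_mem' := fun c x hx =>
            ⟨N.smul_mem _ hx.1, by rw [star_smul]; exact N.smul_mem _ hx.2⟩
          star_mem' := fun {x} hx => ⟨hx.2, by rw [star_star]; exact hx.1⟩ }
      closed := hNcl.inter (hNcl.preimage continuous_star) }
  intro d
  have hd : d ∈ T.toSub := CStarSub.gen_induction T
    (fun y hy => ⟨hs _ (Or.inl hy), hs _ (Or.inr (by rw [star_star]; exact hy))⟩) d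
  exact hd.1

theorem nondegenerate_completed (φ : X →⋆ₙₐ[ℂ] Y) : Nondegenerate (completed φ) := by
  obtain ⟨l, hl, hn, hr, -⟩ := exists_approx_unit X
  have h1 : ∀ (z : X) (b : Y) (w : X) (d : her φ), (her φ).incl d = φ z * b * φ w →
      d ∈ closure (Submodule.span ℂ {x | ∃ i d', x = completed φ i * d'} : Set (her φ)) := by
    intro z b w d hd
    refine mem_closure_of_tendsto (f := fun u => completed φ u * d) (b := l) ?_
      (Eventually.of_forall fun u => Submodule.subset_span ⟨u, _, rfl⟩)
    rw [(her φ).isometry_incl.isEmbedding.tendsto_nhds_iff]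
    have h2 : ((her φ).incl ∘ fun u => completed φ u * d) = fun u => φ (u * z) * b * φ w := by
      funext u
      change (her φ).incl (completed φ u * d) = _
      rw [map_mul, hd, map_mul]
      change φ u * _ = _
      simp only [mul_assoc]
    rw [h2, hd]
    exact ((((map_continuous φ).tendsto _).comp (hr z)).mul_const b).mul_const (φ w)
  have h2 : ∀ (z : X) (b : Y) (w : X) (d : her φ), (her φ).incl (star d) = φ z * b * φ w →
      d ∈ closure (Submodule.span ℂ {x | ∃ i d', x = completed φ i * d'} : Set (her φ)) := by
    intro z b w d hd
    refine h1 (star w) (star b) (star z) d ?_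
    rw [← star_star d, map_star, hd, star_mul, star_mul, map_star, map_star, mul_assoc]
  refine nondegenerate_of_generators (completed φ) ?_
  rintro d (⟨z, b, w, hd⟩ | ⟨z, b, w, hd⟩)
  · exact h1 z b w d hd
  · exact h2 z b w d hd

end Hereditary

section Completed
variable {A : Type u} [NonUnitalCStarAlgebra A] {Y : Type v} [NonUnitalCStarAlgebra Y]

variable (A) in
theorem isIdealEmbedding_q : IsIdealEmbedding (q A).incl where
  inj := (q A).incl_injective
  mul_left e i := ⟨(q A).elem (e * (q A).incl i) (CStarSub.mem_ker.2 (by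
    rw [map_mul, CStarSub.mem_ker.1 ((q A).incl_mem i), mul_zero])), rfl⟩
  mul_right e i := ⟨(q A).elem ((q A).incl i * e) (CStarSub.mem_ker.2 (by
    rw [map_mul, CStarSub.mem_ker.1 ((q A).incl_mem i), zero_mul])), rfl⟩

/-- For `φ : qA → Y` with corestriction `φ₀ : qA → Y₀` to the hereditary subalgebra `Y₀` generated
by the image, the canonical extension `φ₀° : QA → 𝓜(Y₀)`. -/
def canonicalExt (φ : q A →⋆ₙₐ[ℂ] Y) : Q A →⋆ₙₐ[ℂ] 𝓜(ℂ, her φ) :=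
  multExt (isIdealEmbedding_q A) (nondegenerate_completed φ)

theorem canonicalExt_apply (φ : q A →⋆ₙₐ[ℂ] Y) (z : q A) :
    canonicalExt φ ((q A).incl z) = (completed φ z : 𝓜(ℂ, her φ)) :=
  multExt_apply _ _ z

/-- `φ₀° ∘ ι : A → 𝓜(Y₀)`. -/
def leg (φ : q A →⋆ₙₐ[ℂ] Y) : A →⋆ₙₐ[ℂ] 𝓜(ℂ, her φ) := (canonicalExt φ).comp (ι A)

/-- `φ₀° ∘ ῑ : A → 𝓜(Y₀)`. -/
def legBar (φ : q A →⋆ₙₐ[ℂ] Y) : A →⋆ₙₐ[ℂ] 𝓜(ℂ, her φ) := (canonicalExt φ).comp (ιbar A)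

end Completed

section RAlgebra

/-- The C*-order on a multiplier algebra (positive elements are those of the form `m* m`); Mathlib's
C*-algebra structure on matrices over `𝓜(D)` asks for it. -/
instance {D : Type v} [NonUnitalCStarAlgebra D] : PartialOrder 𝓜(ℂ, D) :=
  CStarAlgebra.spectralOrder _

instance {D : Type v} [NonUnitalCStarAlgebra D] : StarOrderedRing 𝓜(ℂ, D) :=
  CStarAlgebra.spectralOrderedRing _

theorem coe_injective (D : Type v) [NonUnitalCStarAlgebra D] :
    Function.Injective (DoubleCentralizer.coeHom : D →⋆ₙₐ[ℂ] 𝓜(ℂ, D)) := by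
  rw [injective_iff_map_eq_zero]
  intro d hd
  have h : (DoubleCentralizer.coeHom d : 𝓜(ℂ, D)).fst (star d) = 0 := by rw [hd]; rfl
  exact (CStarRing.mul_star_self_eq_zero_iff d).1 h

theorem multiplier_mul_coe {D : Type v} [NonUnitalCStarAlgebra D] (m : 𝓜(ℂ, D)) (d : D) :
    m * (d : 𝓜(ℂ, D)) = (m.fst d : D) :=
  multiplier_ext fun x => multiplier_fst_mul m d x

theorem coe_mul_multiplier {D : Type v} [NonUnitalCStarAlgebra D] (m : 𝓜(ℂ, D)) (d : D) :
    (d : 𝓜(ℂ, D)) * m = (m.snd d : D) :=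
  multiplier_ext fun x => (m.central d x).symm

variable {X C : Type u} [NonUnitalCStarAlgebra X] [NonUnitalCStarAlgebra C] (φ : q X →⋆ₙₐ[ℂ] C)

/-- For `φ : qX → C` with completed form `φ₀ : qX → C₀`: the C*-algebra `R ⊆ M₂(𝓜(C₀))` generated
by the matrices with entries in `(R₁, R₁R₂; R₂R₁, R₂)`, where `R₁ = φ₀°ι(X)`, `R₂ = φ₀°ῑ(X)`. -/
def RAlg : CStarSub (CStarMatrix (Fin 2) (Fin 2) 𝓜(ℂ, her φ)) :=
  .gen {M | M 0 0 ∈ Set.range (leg φ) ∧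
    (∃ b b', M 0 1 = leg φ b * legBar φ b') ∧
    (∃ b b', M 1 0 = legBar φ b * leg φ b') ∧
    M 1 1 ∈ Set.range (legBar φ)}

/-- `M₂(C₀)` as a C*-subalgebra of `M₂(𝓜(C₀))`. -/
def M2C : CStarSub (CStarMatrix (Fin 2) (Fin 2) 𝓜(ℂ, her φ)) where
  toSub :=
    { carrier := {M | ∀ i k, ∃ c : her φ, M i k = (c : 𝓜(ℂ, her φ))}
      add_mem' := fun {M N} hM hN i k => by
        obtain ⟨c, hc⟩ := hM i k
        obtain ⟨d, hd⟩ := hN i k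
        exact ⟨c + d, by
          rw [CStarMatrix.add_apply, hc, hd]
          exact (map_add (DoubleCentralizer.coeHom : her φ →⋆ₙₐ[ℂ] 𝓜(ℂ, her φ)) c d).symm⟩
      zero_mem' := fun i k =>
        ⟨0, (map_zero (DoubleCentralizer.coeHom : her φ →⋆ₙₐ[ℂ] 𝓜(ℂ, her φ))).symm⟩
      mul_mem' := fun {M N} hM hN i k => by
        choose c hc using hM
        choose d hd using hN
        refine ⟨∑ l, c i l * d l k, ?_⟩
        rw [CStarMatrix.mul_apply]
        refine Eq.trans ?_
          (map_sum (DoubleCentralizer.coeHom : her φ →⋆ₙₐ[ℂ] 𝓜(ℂ, her φ)) _ _).symm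
        refine Finset.sum_congr rfl fun l _ => ?_
        rw [hc, hd]
        exact (map_mul (DoubleCentralizer.coeHom : her φ →⋆ₙₐ[ℂ] 𝓜(ℂ, her φ)) _ _).symm
      smul_mem' := fun a M hM i k => by
        obtain ⟨c, hc⟩ := hM i k
        exact ⟨a • c, by
          rw [CStarMatrix.smul_apply, hc]
          exact (map_smul (DoubleCentralizer.coeHom : her φ →⋆ₙₐ[ℂ] 𝓜(ℂ, her φ)) a c).symm⟩
      star_mem' := fun {M} hM i k => by
        obtain ⟨c, hc⟩ := hM k i
        exact ⟨star c, by
          rw [CStarMatrix.star_apply, hc]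
          exact (map_star (DoubleCentralizer.coeHom : her φ →⋆ₙₐ[ℂ] 𝓜(ℂ, her φ)) c).symm⟩ }
  closed := by
    have hcl : IsClosed (Set.range (DoubleCentralizer.coeHom : her φ →⋆ₙₐ[ℂ] 𝓜(ℂ, her φ))) :=
      (NonUnitalStarAlgHom.isometry _ (coe_injective (her φ))).isClosedEmbedding.isClosed_range
    have hc : ∀ i k, Continuous
        fun M : CStarMatrix (Fin 2) (Fin 2) 𝓜(ℂ, her φ) => M i k := fun i k =>
      (continuous_apply k).comp (continuous_apply i)
    have h : IsClosed (⋂ (i : Fin 2) (k : Fin 2),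
        (fun M : CStarMatrix (Fin 2) (Fin 2) 𝓜(ℂ, her φ) => M i k) ⁻¹'
          Set.range (DoubleCentralizer.coeHom : her φ →⋆ₙₐ[ℂ] 𝓜(ℂ, her φ))) :=
      isClosed_iInter fun i => isClosed_iInter fun k => hcl.preimage (hc i k)
    have he : {M : CStarMatrix (Fin 2) (Fin 2) 𝓜(ℂ, her φ) |
        ∀ i k, ∃ c : her φ, M i k = (c : 𝓜(ℂ, her φ))} = ⋂ (i : Fin 2) (k : Fin 2),
        (fun M : CStarMatrix (Fin 2) (Fin 2) 𝓜(ℂ, her φ) => M i k) ⁻¹'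
          Set.range (DoubleCentralizer.coeHom : her φ →⋆ₙₐ[ℂ] 𝓜(ℂ, her φ)) := by
      refine Set.ext fun M => ?_
      simp only [Set.mem_iInter, Set.mem_preimage, Set.mem_range]
      exact ⟨fun hM i k => (hM i k).imp fun _ hc => hc.symm,
        fun hM i k => (hM i k).imp fun _ hc => hc.symm⟩
    rw [← he] at h
    exact h

/-- `J₀ = R ∩ M₂(C₀)`. -/
def J0 : CStarSub (CStarMatrix (Fin 2) (Fin 2) 𝓜(ℂ, her φ)) where
  toSub := (RAlg φ).toSub ⊓ (M2C φ).toSub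
  closed := (RAlg φ).closed.inter (M2C φ).closed

/-- `(a, b) ↦ diag(a, b)`. -/
def diag (M : Type v) [CStarAlgebra M] : M × M →⋆ₙₐ[ℂ] CStarMatrix (Fin 2) (Fin 2) M where
  toFun p := CStarMatrix.ofMatrix !![p.1, 0; 0, p.2]
  map_smul' c p := by
    ext i k; fin_cases i <;> fin_cases k <;> simp
  map_zero' := by ext i k; fin_cases i <;> fin_cases k <;> simp
  map_add' p p' := by ext i k; fin_cases i <;> fin_cases k <;> simp
  map_mul' p p' := by ext i k; fin_cases i <;> fin_cases k <;> simp [CStarMatrix.mul_apply]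
  map_star' p := by ext i k; fin_cases i <;> fin_cases k <;> simp [CStarMatrix.star_apply]

/-- The homomorphism `X × X → R`, `(b, b') ↦ diag(φ₀°ι(b), φ₀°ῑ(b'))`. -/
def diagR : X × X →⋆ₙₐ[ℂ] RAlg φ :=
  (RAlg φ).corestrict ((diag 𝓜(ℂ, her φ)).comp
    (((leg φ).comp (NonUnitalStarAlgHom.fst ℂ X X)).prod
      ((legBar φ).comp (NonUnitalStarAlgHom.snd ℂ X X)))) fun p => by
    refine CStarSub.subset_gen ⟨⟨p.1, rfl⟩, ⟨0, 0, ?_⟩, ⟨0, 0, ?_⟩, ⟨p.2, rfl⟩⟩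
    · rw [map_zero, zero_mul]; rfl
    · rw [map_zero, zero_mul]; rfl

theorem nondegenerate_diagR : Nondegenerate (diagR φ) := by
  obtain ⟨l, hl, hn, hr, -⟩ := exists_approx_unit (X × X)
  have hr1 : ∀ b : X, Tendsto (fun u : X × X => leg φ (u.1 * b)) l (𝓝 (leg φ b)) := fun b =>
    ((map_continuous (leg φ)).tendsto b).comp
      ((continuous_fst.tendsto _).comp (hr (b, 0)))
  have hr2 : ∀ b : X, Tendsto (fun u : X × X => legBar φ (u.2 * b)) l (𝓝 (legBar φ b)) :=
    fun b => ((map_continuous (legBar φ)).tendsto b).comp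
      ((continuous_snd.tendsto _).comp (hr (0, b)))
  have h1 : ∀ d : RAlg φ, (∃ b, (RAlg φ).incl d 0 0 = leg φ b) →
      (∃ b b', (RAlg φ).incl d 0 1 = leg φ b * legBar φ b') →
      (∃ b b', (RAlg φ).incl d 1 0 = legBar φ b * leg φ b') →
      (∃ b, (RAlg φ).incl d 1 1 = legBar φ b) →
      d ∈ closure (Submodule.span ℂ {x | ∃ i d', x = diagR φ i * d'} : Set (RAlg φ)) := by
    rintro d ⟨b, hb⟩ ⟨c, c', hc⟩ ⟨e, e', he⟩ ⟨f, hf⟩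
    refine mem_closure_of_tendsto (f := fun u => diagR φ u * d) (b := l) ?_
      (Eventually.of_forall fun u => Submodule.subset_span ⟨u, _, rfl⟩)
    rw [(RAlg φ).isometry_incl.isEmbedding.tendsto_nhds_iff]
    have h0 : ∀ (u : X × X) k, (RAlg φ).incl (diagR φ u * d) 0 k
        = leg φ u.1 * (RAlg φ).incl d 0 k := by
      intro u k
      rw [map_mul, CStarMatrix.mul_apply, Fin.sum_univ_two]
      change leg φ u.1 * _ + 0 * _ = _
      rw [zero_mul, add_zero]
    have h1 : ∀ (u : X × X) k, (RAlg φ).incl (diagR φ u * d) 1 k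
        = legBar φ u.2 * (RAlg φ).incl d 1 k := by
      intro u k
      rw [map_mul, CStarMatrix.mul_apply, Fin.sum_univ_two]
      change 0 * _ + legBar φ u.2 * _ = _
      rw [zero_mul, zero_add]
    refine tendsto_pi_nhds.2 fun i => tendsto_pi_nhds.2 fun k => ?_
    simp only [Function.comp_apply]
    fin_cases i <;> fin_cases k
    · refine Tendsto.congr (fun u => (h0 u 0).symm) ?_
      change Tendsto _ l (𝓝 ((RAlg φ).incl d 0 0))
      simp only [hb, ← map_mul]
      exact hr1 b
    · refine Tendsto.congr (fun u => (h0 u 1).symm) ?_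
      change Tendsto _ l (𝓝 ((RAlg φ).incl d 0 1))
      simp only [hc, ← mul_assoc]
      simp only [← map_mul]
      exact (hr1 c).mul_const _
    · refine Tendsto.congr (fun u => (h1 u 0).symm) ?_
      change Tendsto _ l (𝓝 ((RAlg φ).incl d 1 0))
      simp only [he, ← mul_assoc]
      simp only [← map_mul]
      exact (hr2 e).mul_const _
    · refine Tendsto.congr (fun u => (h1 u 1).symm) ?_
      change Tendsto _ l (𝓝 ((RAlg φ).incl d 1 1))
      simp only [hf, ← map_mul]
      exact hr2 f
  have h2 : ∀ d : RAlg φ, (∃ b, (RAlg φ).incl (star d) 0 0 = leg φ b) →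
      (∃ b b', (RAlg φ).incl (star d) 0 1 = leg φ b * legBar φ b') →
      (∃ b b', (RAlg φ).incl (star d) 1 0 = legBar φ b * leg φ b') →
      (∃ b, (RAlg φ).incl (star d) 1 1 = legBar φ b) →
      d ∈ closure (Submodule.span ℂ {x | ∃ i d', x = diagR φ i * d'} : Set (RAlg φ)) := by
    rintro d ⟨b, hb⟩ ⟨c, c', hc⟩ ⟨e, e', he⟩ ⟨f, hf⟩
    have hs : ∀ i k, (RAlg φ).incl d i k = star ((RAlg φ).incl (star d) k i) := by
      intro i k
      rw [map_star, CStarMatrix.star_apply, star_star]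
    refine h1 d ⟨star b, ?_⟩ ⟨star e', star e, ?_⟩ ⟨star c', star c, ?_⟩ ⟨star f, ?_⟩
    · rw [hs, hb, map_star]
    · rw [hs, he, star_mul, map_star, map_star]
    · rw [hs, hc, star_mul, map_star, map_star]
    · rw [hs, hf, map_star]
  refine nondegenerate_of_generators (diagR φ) ?_
  rintro d (⟨⟨b, hb⟩, hc, he, ⟨f, hf⟩⟩ | ⟨⟨b, hb⟩, hc, he, ⟨f, hf⟩⟩)
  · exact h1 d ⟨b, hb.symm⟩ hc he ⟨f, hf.symm⟩
  · exact h2 d ⟨b, hb.symm⟩ hc he ⟨f, hf.symm⟩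

/-- `X × X` is an ideal of `𝓜(X) × 𝓜(X)`. -/
def coeProd (X : Type u) [NonUnitalCStarAlgebra X] : X × X →⋆ₙₐ[ℂ] 𝓜(ℂ, X) × 𝓜(ℂ, X) :=
  ((DoubleCentralizer.coeHom).comp (NonUnitalStarAlgHom.fst ℂ X X)).prod
    ((DoubleCentralizer.coeHom).comp (NonUnitalStarAlgHom.snd ℂ X X))

theorem isIdealEmbedding_coeProd (X : Type u) [NonUnitalCStarAlgebra X] :
    IsIdealEmbedding (coeProd X) where
  inj _ _ h := Prod.ext (coe_injective X (congrArg Prod.fst h))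
    (coe_injective X (congrArg Prod.snd h))
  mul_left m p := ⟨(m.1.fst p.1, m.2.fst p.2),
    (Prod.ext (multiplier_mul_coe m.1 p.1) (multiplier_mul_coe m.2 p.2)).symm⟩
  mul_right m p := ⟨(m.1.snd p.1, m.2.snd p.2),
    (Prod.ext (coe_mul_multiplier m.1 p.1) (coe_mul_multiplier m.2 p.2)).symm⟩

/-- The extension `𝓜(X) × 𝓜(X) → 𝓜(R)`, `(m, m') ↦ diag(φ₀°ι(m), φ₀°ῑ(m'))`, where `φ₀°ι` and
`φ₀°ῑ` are extended to multipliers. -/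
def diagExt : 𝓜(ℂ, X) × 𝓜(ℂ, X) →⋆ₙₐ[ℂ] 𝓜(ℂ, RAlg φ) :=
  multExt (isIdealEmbedding_coeProd X) (nondegenerate_diagR φ)

end RAlgebra

section Product
variable {A B C X : Type u} [NonUnitalCStarAlgebra A] [NonUnitalCStarAlgebra B]
  [NonUnitalCStarAlgebra C] [NonUnitalCStarAlgebra X] (ρ : q A →⋆ₙₐ[ℂ] B) (ψ : q B →⋆ₙₐ[ℂ] C)

/-- With `B₀ = her ρ`, the restriction of `ψ : qB → C` to `qB₀`; its completed form is
`ψ₀ : qB₀ → C₀`. -/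
def restrictHer : q (her ρ) →⋆ₙₐ[ℂ] C := ψ.comp (q.map (her ρ).incl)

/-- `h₁ = diag(η^ψ ε^ρ, η̄^ψ ε̄^ρ) : A → 𝓜(R^ψ)`. -/
def h₁ : A →⋆ₙₐ[ℂ] 𝓜(ℂ, RAlg (restrictHer ρ ψ)) :=
  (diagExt (restrictHer ρ ψ)).comp ((leg ρ).prod (legBar ρ))

/-- `h₂ = diag(η^ψ ε̄^ρ, η̄^ψ ε^ρ) : A → 𝓜(R^ψ)`. -/
def h₂ : A →⋆ₙₐ[ℂ] 𝓜(ℂ, RAlg (restrictHer ρ ψ)) :=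
  (diagExt (restrictHer ρ ψ)).comp ((legBar ρ).prod (leg ρ))

/-- `h₁(x) diag(η^ψ(b), η̄^ψ(b')) = diag(η^ψ(ε^ρ(x) b), η̄^ψ(ε̄^ρ(x) b'))`. -/
theorem h₁_fst (x : A) (b b' : her ρ) :
    (h₁ ρ ψ x).fst (diagR (restrictHer ρ ψ) (b, b'))
      = diagR (restrictHer ρ ψ) ((leg ρ x).fst b, (legBar ρ x).fst b') :=
  multExt_fst (isIdealEmbedding_coeProd (her ρ)) (nondegenerate_diagR (restrictHer ρ ψ)) _ _ _
    (Prod.ext (multiplier_mul_coe (leg ρ x) b) (multiplier_mul_coe (legBar ρ x) b')).symm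

/-- `h₂(x) diag(η^ψ(b), η̄^ψ(b')) = diag(η^ψ(ε̄^ρ(x) b), η̄^ψ(ε^ρ(x) b'))`. -/
theorem h₂_fst (x : A) (b b' : her ρ) :
    (h₂ ρ ψ x).fst (diagR (restrictHer ρ ψ) (b, b'))
      = diagR (restrictHer ρ ψ) ((legBar ρ x).fst b, (leg ρ x).fst b') :=
  multExt_fst (isIdealEmbedding_coeProd (her ρ)) (nondegenerate_diagR (restrictHer ρ ψ)) _ _ _
    (Prod.ext (multiplier_mul_coe (legBar ρ x) b) (multiplier_mul_coe (leg ρ x) b')).symm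

/-- `h : A → 𝓜(R^ψ)` is weakly nuclear relative to `J₀`, with nuclearity understood in the
C*-algebra `T ⊆ M₂(𝓜(C₀))`: for each `z ∈ J₀` the map `x ↦ h(x) z` takes values in `T` and is
nuclear as a map `A → T`. -/
def IsWeaklyNuclearIn {φ : q X →⋆ₙₐ[ℂ] C} (h : A →⋆ₙₐ[ℂ] 𝓜(ℂ, RAlg φ))
    (T : CStarSub (CStarMatrix (Fin 2) (Fin 2) 𝓜(ℂ, her φ))) : Prop :=
  ∀ z : RAlg φ, (RAlg φ).incl z ∈ (J0 φ).toSub →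
    ∃ θ : A →ₗ[ℂ] T, (∀ x, T.incl (θ x) = (RAlg φ).incl ((h x).fst z)) ∧ IsNuclear θ

end Product
end KKNuc

end

noncomputable section
namespace KKNuc

section TensorNorms
variable {A B D : Type u} [NonUnitalCStarAlgebra A] [NonUnitalCStarAlgebra B]
  [NonUnitalCStarAlgebra D]

@[simp] theorem productMap_tmul {E : Type u} [NonUnitalCStarAlgebra E]
    (f : B →⋆ₙₐ[ℂ] E) (g : D →⋆ₙₐ[ℂ] E) (b : B) (d : D) :
    productMap f g (b ⊗ₜ d) = f b * g d := rfl

@[simp] theorem spatialRep_tmul {H L : Type u} [NormedAddCommGroup H] [InnerProductSpace ℂ H]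
    [CompleteSpace H] [NormedAddCommGroup L] [InnerProductSpace ℂ L] [CompleteSpace L]
    (π : A →⋆ₙₐ[ℂ] (H →L[ℂ] H)) (σ : D →⋆ₙₐ[ℂ] (L →L[ℂ] L)) (a : A) (d : D) :
    spatialRep π σ (a ⊗ₜ d) = TensorProduct.mapL (π a) (σ d) := rfl

theorem tensor_star_mul (s t : A ⊗[ℂ] D) : star (s * t) = star t * star s := by
  induction s with
  | zero => simp
  | add s s' hs hs' => rw [add_mul, star_add, star_add, mul_add, hs, hs']
  | tmul a d =>
    induction t with
    | zero => simp
    | add t t' ht ht' => rw [mul_add, star_add, star_add, add_mul, ht, ht']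
    | tmul a' d' => simp

theorem productMap_mul {E : Type u} [NonUnitalCStarAlgebra E]
    {f : B →⋆ₙₐ[ℂ] E} {g : D →⋆ₙₐ[ℂ] E} (h : ∀ b d, Commute (f b) (g d)) (s t : B ⊗[ℂ] D) :
    productMap f g (s * t) = productMap f g s * productMap f g t := by
  induction s with
  | zero => simp
  | add s s' hs hs' => rw [add_mul, map_add, map_add, add_mul, hs, hs']
  | tmul b d =>
    induction t with
    | zero => simp
    | add t t' ht ht' => rw [mul_add, map_add, map_add, mul_add, ht, ht']
    | tmul b' d' =>
      rw [Algebra.TensorProduct.tmul_mul_tmul, productMap_tmul, productMap_tmul, productMap_tmul,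
        map_mul, map_mul, mul_assoc, mul_assoc, ← mul_assoc (f b'), (h b' d).eq, mul_assoc]

theorem productMap_star {E : Type u} [NonUnitalCStarAlgebra E]
    {f : B →⋆ₙₐ[ℂ] E} {g : D →⋆ₙₐ[ℂ] E} (h : ∀ b d, Commute (f b) (g d)) (s : B ⊗[ℂ] D) :
    productMap f g (star s) = star (productMap f g s) := by
  induction s with
  | zero => simp
  | add s s' hs hs' => rw [star_add, map_add, map_add, star_add, hs, hs']
  | tmul b d =>
    rw [TensorProduct.star_tmul, productMap_tmul, productMap_tmul, star_mul, map_star, map_star,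
      ← map_star f, ← map_star g]
    exact h _ _

theorem enorm_productMap_le_maxNorm {E : Type u} [NonUnitalCStarAlgebra E]
    {f : B →⋆ₙₐ[ℂ] E} {g : D →⋆ₙₐ[ℂ] E} (h : ∀ b d, Commute (f b) (g d)) (t : B ⊗[ℂ] D) :
    ‖productMap f g t‖ₑ ≤ maxNorm t :=
  le_iSup_of_le E <| le_iSup_of_le _ <| le_iSup_of_le f <| le_iSup_of_le g <|
    le_iSup_of_le h le_rfl

theorem maxNorm_le {t : B ⊗[ℂ] D} {c : ℝ≥0∞}
    (H : ∀ (E : Type u) [NonUnitalCStarAlgebra E] (f : B →⋆ₙₐ[ℂ] E) (g : D →⋆ₙₐ[ℂ] E),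
      (∀ b d, Commute (f b) (g d)) → ‖productMap f g t‖ₑ ≤ c) : maxNorm t ≤ c :=
  iSup_le fun E => iSup_le fun _ => iSup_le fun f => iSup_le fun g => iSup_le fun h => H E f g h

theorem enorm_spatialRep_le_minNorm {H L : Type u} [NormedAddCommGroup H]
    [InnerProductSpace ℂ H] [CompleteSpace H] [NormedAddCommGroup L] [InnerProductSpace ℂ L]
    [CompleteSpace L] (π : A →⋆ₙₐ[ℂ] (H →L[ℂ] H)) (σ : D →⋆ₙₐ[ℂ] (L →L[ℂ] L))
    (t : A ⊗[ℂ] D) : ‖spatialRep π σ t‖ₑ ≤ minNorm t :=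
  le_iSup_of_le H <| le_iSup_of_le _ <| le_iSup_of_le _ <| le_iSup_of_le _ <|
    le_iSup_of_le L <| le_iSup_of_le _ <| le_iSup_of_le _ <| le_iSup_of_le _ <|
    le_iSup_of_le π <| le_iSup_of_le σ le_rfl

theorem minNorm_le {t : A ⊗[ℂ] D} {c : ℝ≥0∞}
    (h : ∀ (H : Type u) [NormedAddCommGroup H] [InnerProductSpace ℂ H] [CompleteSpace H]
      (L : Type u) [NormedAddCommGroup L] [InnerProductSpace ℂ L] [CompleteSpace L]
      (π : A →⋆ₙₐ[ℂ] (H →L[ℂ] H)) (σ : D →⋆ₙₐ[ℂ] (L →L[ℂ] L)), ‖spatialRep π σ t‖ₑ ≤ c) :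
    minNorm t ≤ c :=
  iSup_le fun H => iSup_le fun _ => iSup_le fun _ => iSup_le fun _ =>
    iSup_le fun L => iSup_le fun _ => iSup_le fun _ => iSup_le fun _ =>
    iSup_le fun π => iSup_le fun σ => h H L π σ

theorem maxNorm_add_le (s t : B ⊗[ℂ] D) : maxNorm (s + t) ≤ maxNorm s + maxNorm t :=
  maxNorm_le fun _ _ f g h => by
    rw [map_add]
    exact (enorm_add_le _ _).trans
      (add_le_add (enorm_productMap_le_maxNorm h s) (enorm_productMap_le_maxNorm h t))

theorem maxNorm_neg (s : B ⊗[ℂ] D) : maxNorm (-s) ≤ maxNorm s :=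
  maxNorm_le fun _ _ f g h => by
    rw [map_neg, enorm_neg]
    exact enorm_productMap_le_maxNorm h s

theorem maxNorm_star_mul_self_le (s : B ⊗[ℂ] D) : maxNorm (star s * s) ≤ maxNorm s ^ 2 :=
  maxNorm_le fun _ _ f g h => by
    rw [productMap_mul h, productMap_star h, sq]
    have : ‖star (productMap f g s) * productMap f g s‖ₑ
        = ‖productMap f g s‖ₑ * ‖productMap f g s‖ₑ := by
      simp only [enorm_eq_nnnorm]
      rw [CStarRing.nnnorm_star_mul_self, ENNReal.coe_mul]
    rw [this]
    exact mul_le_mul' (enorm_productMap_le_maxNorm h s) (enorm_productMap_le_maxNorm h s)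

section SpatialRep
variable {H L : Type u} [NormedAddCommGroup H] [InnerProductSpace ℂ H] [CompleteSpace H]
  [NormedAddCommGroup L] [InnerProductSpace ℂ L] [CompleteSpace L]
  (π : A →⋆ₙₐ[ℂ] (H →L[ℂ] H)) (σ : D →⋆ₙₐ[ℂ] (L →L[ℂ] L))

theorem spatialRep_mul (s t : A ⊗[ℂ] D) :
    spatialRep π σ (s * t) = spatialRep π σ s * spatialRep π σ t := by
  induction s with
  | zero => simp
  | add s s' hs hs' => rw [add_mul, map_add, map_add, add_mul, hs, hs']
  | tmul b d =>
    induction t with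
    | zero => simp
    | add t t' ht ht' => rw [mul_add, map_add, map_add, mul_add, ht, ht']
    | tmul b' d' =>
      rw [Algebra.TensorProduct.tmul_mul_tmul, spatialRep_tmul, spatialRep_tmul, spatialRep_tmul,
        map_mul, map_mul, TensorProduct.mapL_mul]

theorem inner_spatialRep_star (s : A ⊗[ℂ] D) (x y : H ⊗[ℂ] L) :
    inner ℂ (spatialRep π σ (star s) x) y = inner ℂ x (spatialRep π σ s y) := by
  induction s with
  | zero => simp
  | add s s' hs hs' =>
    rw [star_add, map_add, map_add, add_apply, add_apply,
      inner_add_left, inner_add_right, hs, hs']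
  | tmul a d =>
    induction x with
    | zero => simp
    | add x x' hx hx' => rw [map_add, inner_add_left, inner_add_left, hx, hx']
    | tmul ξ η =>
      induction y with
      | zero => simp
      | add y y' hy hy' => rw [map_add, inner_add_right, inner_add_right, hy, hy']
      | tmul ξ' η' =>
        rw [TensorProduct.star_tmul, spatialRep_tmul, spatialRep_tmul, TensorProduct.mapL_tmul,
          TensorProduct.mapL_tmul, TensorProduct.inner_tmul, TensorProduct.inner_tmul, map_star,
          map_star, ContinuousLinearMap.star_eq_adjoint, ContinuousLinearMap.star_eq_adjoint,
          ContinuousLinearMap.adjoint_inner_left, ContinuousLinearMap.adjoint_inner_left]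

theorem norm_spatialRep_star_le {s : A ⊗[ℂ] D} {c : ℝ} (hc : 0 ≤ c)
    (h : ∀ x, ‖spatialRep π σ s x‖ ≤ c * ‖x‖) (x : H ⊗[ℂ] L) :
    ‖spatialRep π σ (star s) x‖ ≤ c * ‖x‖ := by
  have h1 : ‖spatialRep π σ (star s) x‖ ^ 2 ≤ c * ‖x‖ * ‖spatialRep π σ (star s) x‖ := by
    have h2 : ‖spatialRep π σ (star s) x‖ ^ 2
        = (inner ℂ x (spatialRep π σ s (spatialRep π σ (star s) x))).re := by
      rw [← inner_spatialRep_star]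
      exact (inner_self_eq_norm_sq (𝕜 := ℂ) (spatialRep π σ (star s) x)).symm
    rw [h2]
    refine (Complex.re_le_norm _).trans ((norm_inner_le_norm (𝕜 := ℂ) x
      (spatialRep π σ s (spatialRep π σ (star s) x))).trans ?_)
    have := mul_le_mul_of_nonneg_left (h (spatialRep π σ (star s) x)) (norm_nonneg x)
    linarith
  rcases (norm_nonneg (spatialRep π σ (star s) x)).eq_or_lt with h | h
  · rw [← h]; positivity
  · refine le_of_mul_le_mul_right ?_ h
    rw [← sq]
    exact h1

end SpatialRep

theorem minNorm_le_ofReal {t : A ⊗[ℂ] D} {c : ℝ} (hc : 0 ≤ c)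
    (h : ∀ (H : Type u) [NormedAddCommGroup H] [InnerProductSpace ℂ H] [CompleteSpace H]
      (L : Type u) [NormedAddCommGroup L] [InnerProductSpace ℂ L] [CompleteSpace L]
      (π : A →⋆ₙₐ[ℂ] (H →L[ℂ] H)) (σ : D →⋆ₙₐ[ℂ] (L →L[ℂ] L)) (x : H ⊗[ℂ] L),
      ‖spatialRep π σ t x‖ ≤ c * ‖x‖) :
    minNorm t ≤ ENNReal.ofReal c :=
  minNorm_le fun H _ _ _ L _ _ _ π σ => by
    rw [enorm_eq_nnnorm, ENNReal.ofReal, ENNReal.coe_le_coe]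
    refine NNReal.coe_le_coe.1 ?_
    rw [Real.coe_toNNReal c hc]
    exact ContinuousLinearMap.opNorm_le_bound _ hc (h H L π σ)

theorem minNorm_lt_top (t : A ⊗[ℂ] D) : minNorm t < ⊤ := by
  obtain ⟨c, hc, h⟩ : ∃ c : ℝ, 0 ≤ c ∧
      ∀ (H : Type u) [NormedAddCommGroup H] [InnerProductSpace ℂ H] [CompleteSpace H]
      (L : Type u) [NormedAddCommGroup L] [InnerProductSpace ℂ L] [CompleteSpace L]
      (π : A →⋆ₙₐ[ℂ] (H →L[ℂ] H)) (σ : D →⋆ₙₐ[ℂ] (L →L[ℂ] L)) (x : H ⊗[ℂ] L),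
      ‖spatialRep π σ t x‖ ≤ c * ‖x‖ := by
    induction t with
    | zero =>
      refine ⟨0, le_rfl, fun H _ _ _ L _ _ _ π σ x => ?_⟩
      rw [map_zero, zero_mul]
      exact norm_zero.le
    | add s t hs ht =>
      obtain ⟨c, hc, h⟩ := hs
      obtain ⟨c', hc', h'⟩ := ht
      refine ⟨c + c', add_nonneg hc hc', fun H _ _ _ L _ _ _ π σ x => ?_⟩
      rw [map_add, add_mul]
      exact (norm_add_le (spatialRep π σ s x) _).trans
        (add_le_add (h H L π σ x) (h' H L π σ x))
    | tmul a d =>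
      refine ⟨‖a‖ * ‖d‖, by positivity, fun H _ _ _ L _ _ _ π σ x => ?_⟩
      rw [spatialRep_tmul]
      refine (ContinuousLinearMap.le_opNorm _ x).trans ?_
      gcongr
      exact (TensorProduct.norm_mapL_le _ _).trans
        (mul_le_mul (NonUnitalStarAlgHom.norm_apply_le π a)
          (NonUnitalStarAlgHom.norm_apply_le σ d) (norm_nonneg _) (norm_nonneg _))
  exact (minNorm_le_ofReal hc h).trans_lt ENNReal.ofReal_lt_top

theorem norm_spatialRep_apply_le {H L : Type u} [NormedAddCommGroup H]
    [InnerProductSpace ℂ H] [CompleteSpace H] [NormedAddCommGroup L] [InnerProductSpace ℂ L]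
    [CompleteSpace L] (π : A →⋆ₙₐ[ℂ] (H →L[ℂ] H)) (σ : D →⋆ₙₐ[ℂ] (L →L[ℂ] L))
    (t : A ⊗[ℂ] D) (x : H ⊗[ℂ] L) :
    ‖spatialRep π σ t x‖ ≤ (minNorm t).toReal * ‖x‖ := by
  refine (ContinuousLinearMap.le_opNorm _ x).trans ?_
  gcongr
  have h := ENNReal.toReal_mono (minNorm_lt_top t).ne (enorm_spatialRep_le_minNorm π σ t)
  rwa [toReal_enorm] at h

theorem minNorm_star_mul_self_le (t : A ⊗[ℂ] D) :
    (minNorm (star t * t)).toReal ≤ (minNorm t).toReal ^ 2 := by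
  refine ENNReal.toReal_le_of_le_ofReal (by positivity)
    (minNorm_le_ofReal (by positivity) fun H _ _ _ L _ _ _ π σ x => ?_)
  rw [spatialRep_mul, sq, mul_assoc]
  refine (norm_spatialRep_star_le π σ ENNReal.toReal_nonneg
    (norm_spatialRep_apply_le π σ t) (spatialRep π σ t x)).trans ?_
  gcongr
  exact norm_spatialRep_apply_le π σ t x

theorem maxNorm_map_le {B' : Type u} [NonUnitalCStarAlgebra B'] (k : B →⋆ₙₐ[ℂ] B')
    (t : B ⊗[ℂ] D) :
    maxNorm (TensorProduct.map (k : B →ₗ[ℂ] B') (LinearMap.id : D →ₗ[ℂ] D) t) ≤ maxNorm t :=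
  maxNorm_le fun _ _ f g h => by
    have : productMap f g (TensorProduct.map (k : B →ₗ[ℂ] B') (LinearMap.id : D →ₗ[ℂ] D) t)
        = productMap (f.comp k) g t := by
      induction t with
      | zero => simp
      | add s t hs ht => rw [map_add, map_add, map_add, hs, ht]
      | tmul b d => rfl
    rw [this]
    exact enorm_productMap_le_maxNorm (fun b d => h (k b) d) t

theorem minNorm_map_le {A' : Type u} [NonUnitalCStarAlgebra A'] (k : A →⋆ₙₐ[ℂ] A')
    (t : A ⊗[ℂ] D) :
    minNorm (TensorProduct.map (k : A →ₗ[ℂ] A') (LinearMap.id : D →ₗ[ℂ] D) t) ≤ minNorm t :=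
  minNorm_le fun _ _ _ _ _ _ _ _ π σ => by
    have : spatialRep π σ (TensorProduct.map (k : A →ₗ[ℂ] A') (LinearMap.id : D →ₗ[ℂ] D) t)
        = spatialRep (π.comp k) σ t := by
      induction t with
      | zero => simp
      | add s t hs ht => rw [map_add, map_add, map_add, hs, ht]
      | tmul b d => rfl
    rw [this]
    exact enorm_spatialRep_le_minNorm _ σ t

namespace IsNuclear

theorem add {θ θ' : A →ₗ[ℂ] B} (h : IsNuclear θ) (h' : IsNuclear θ') : IsNuclear (θ + θ') := by
  obtain ⟨K, hK⟩ := h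
  obtain ⟨K', hK'⟩ := h'
  refine ⟨K + K', fun D _ t => ?_⟩
  rw [TensorProduct.map_add_left, LinearMap.add_apply, ENNReal.coe_add, add_mul]
  exact (maxNorm_add_le _ _).trans (add_le_add (hK D t) (hK' D t))

theorem neg {θ : A →ₗ[ℂ] B} (h : IsNuclear θ) : IsNuclear (-θ) := by
  obtain ⟨K, hK⟩ := h
  refine ⟨K, fun D _ t => ?_⟩
  have : TensorProduct.map (-θ) (LinearMap.id : D →ₗ[ℂ] D) t
      = - TensorProduct.map θ (LinearMap.id : D →ₗ[ℂ] D) t := by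
    induction t with
    | zero => simp
    | add s t hs ht => rw [map_add, map_add, hs, ht, neg_add]
    | tmul b d => simp [TensorProduct.neg_tmul]
  rw [this]
  exact (maxNorm_neg _).trans (hK D t)

theorem sub {θ θ' : A →ₗ[ℂ] B} (h : IsNuclear θ) (h' : IsNuclear θ') : IsNuclear (θ - θ') := by
  rw [sub_eq_add_neg]
  exact h.add h'.neg

theorem zero : IsNuclear (0 : A →ₗ[ℂ] B) := by
  refine ⟨0, fun D _ t => ?_⟩
  rw [TensorProduct.map_zero_left, LinearMap.zero_apply]
  refine maxNorm_le fun _ _ f g _ => ?_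
  rw [map_zero, enorm_zero]
  exact zero_le

theorem hom_comp {B' : Type u} [NonUnitalCStarAlgebra B'] {θ : A →ₗ[ℂ] B} (h : IsNuclear θ)
    (k : B →⋆ₙₐ[ℂ] B') : IsNuclear ((k : B →ₗ[ℂ] B') ∘ₗ θ) := by
  obtain ⟨K, hK⟩ := h
  refine ⟨K, fun D _ t => ?_⟩
  have : TensorProduct.map ((k : B →ₗ[ℂ] B') ∘ₗ θ) (LinearMap.id : D →ₗ[ℂ] D)
      = TensorProduct.map (k : B →ₗ[ℂ] B') LinearMap.id ∘ₗ TensorProduct.map θ LinearMap.id := by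
    rw [← TensorProduct.map_comp, LinearMap.comp_id]
  rw [this, LinearMap.comp_apply]
  exact (maxNorm_map_le k _).trans (hK D t)

/-- Precomposition with a map that is bounded for the minimal norms. -/
theorem comp_of_minNorm_le {A' : Type u} [NonUnitalCStarAlgebra A'] {θ : A →ₗ[ℂ] B}
    (h : IsNuclear θ) (k : A' →ₗ[ℂ] A) (c : ℝ≥0)
    (hk : ∀ (D : Type u) [NonUnitalCStarAlgebra D] (t : A' ⊗[ℂ] D),
      minNorm (TensorProduct.map k (LinearMap.id : D →ₗ[ℂ] D) t) ≤ c * minNorm t) :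
    IsNuclear (θ ∘ₗ k) := by
  obtain ⟨K, hK⟩ := h
  refine ⟨K * c, fun D _ t => ?_⟩
  have : TensorProduct.map (θ ∘ₗ k) (LinearMap.id : D →ₗ[ℂ] D)
      = TensorProduct.map θ LinearMap.id ∘ₗ TensorProduct.map k LinearMap.id := by
    rw [← TensorProduct.map_comp, LinearMap.comp_id]
  rw [this, LinearMap.comp_apply, ENNReal.coe_mul, mul_assoc]
  exact (hK D _).trans (mul_le_mul_right (hk D t) _)

theorem comp_hom {A' : Type u} [NonUnitalCStarAlgebra A'] {θ : A →ₗ[ℂ] B} (h : IsNuclear θ)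
    (k : A' →⋆ₙₐ[ℂ] A) : IsNuclear (θ ∘ₗ (k : A' →ₗ[ℂ] A)) :=
  h.comp_of_minNorm_le _ 1 fun D _ t => by
    rw [ENNReal.coe_one, one_mul]
    exact minNorm_map_le k t

end IsNuclear

end TensorNorms

section Representations
open UniformSpace (Completion)

variable {C : Type v} [NonUnitalCStarAlgebra C] {V : Type w} [SeminormedAddCommGroup V]
  [InnerProductSpace ℂ V]

/-- A C*-algebra acting by adjointable operators on a semi-inner product space acts by
contractions. -/
theorem norm_action_le (α : C →ₗ[ℂ] V →ₗ[ℂ] V) (hmul : ∀ a b x, α (a * b) x = α a (α b x))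
    (hstar : ∀ a x y, inner ℂ (α a x) y = inner ℂ x (α (star a) y)) (c : C) (x : V) :
    ‖α c x‖ ≤ ‖c‖ * ‖x‖ := by
  let _ := CStarAlgebra.spectralOrder (Unitization ℂ C)
  let _ := CStarAlgebra.spectralOrderedRing (Unitization ℂ C)
  have h0 : 0 ≤ algebraMap ℝ (Unitization ℂ C) (‖c‖ ^ 2) - star (c : Unitization ℂ C) * c := by
    rw [sub_nonneg, ← Unitization.norm_inr (𝕜 := ℂ) c]
    exact CStarAlgebra.star_mul_le_algebraMap_norm_sq
  obtain ⟨d, hd⟩ := CStarAlgebra.nonneg_iff_eq_star_mul_self.1 h0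
  rw [sub_eq_iff_eq_add] at hd
  have hfst : star d.fst * d.fst = ((‖c‖ ^ 2 : ℝ) : ℂ) := by
    have h1 := congrArg (fun z : Unitization ℂ C => z.fst) hd
    simp only [Unitization.fst_add, Unitization.fst_mul, Unitization.fst_star,
      Unitization.fst_inr, mul_zero, add_zero] at h1
    exact h1.symm
  have hsnd : star d.fst • d.snd + d.fst • star d.snd + star d.snd * d.snd
      = - (star c * c) := by
    have h1 := congrArg (fun z : Unitization ℂ C => z.snd) hd
    simp only [Unitization.snd_add, Unitization.snd_mul, Unitization.snd_star,
      Unitization.snd_inr, Unitization.fst_star, Unitization.fst_inr, star_zero, zero_smul,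
      zero_add] at h1
    exact eq_neg_of_add_eq_zero_left h1.symm
  have key : inner ℂ (d.fst • x + α d.snd x) (d.fst • x + α d.snd x)
      = ((‖c‖ ^ 2 : ℝ) : ℂ) * inner ℂ x x - inner ℂ (α c x) (α c x) := by
    rw [hstar c, ← hmul, ← hfst]
    have h2 : inner ℂ x (α (star c * c) x) = - inner ℂ x (α (star d.fst • d.snd
        + d.fst • star d.snd + star d.snd * d.snd) x) := by
      rw [hsnd, map_neg, LinearMap.neg_apply, inner_neg_right, neg_neg]
    rw [h2]
    simp only [inner_add_left, inner_add_right, inner_smul_left, inner_smul_right, map_add,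
      map_smul, LinearMap.add_apply, LinearMap.smul_apply, hstar, hmul, Complex.star_def]
    ring
  have hre := congrArg Complex.re key
  have e1 : ∀ y : V, inner ℂ y y = ((‖y‖ ^ 2 : ℝ) : ℂ) := fun y => by
    rw [inner_self_eq_norm_sq_to_K]; simp
  rw [e1, e1, e1, ← Complex.ofReal_mul, ← Complex.ofReal_sub, Complex.ofReal_re,
    Complex.ofReal_re] at hre
  refine abs_le_of_sq_le_sq' ?_ (by positivity) |>.2
  nlinarith [sq_nonneg ‖d.fst • x + α d.snd x‖]

/-- The bounded operator through which an element of a C*-algebra acts. -/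
def actionCLM (α : C →ₗ[ℂ] V →ₗ[ℂ] V) (hmul : ∀ a b x, α (a * b) x = α a (α b x))
    (hstar : ∀ a x y, inner ℂ (α a x) y = inner ℂ x (α (star a) y)) (c : C) : V →L[ℂ] V :=
  (α c).mkContinuous ‖c‖ (norm_action_le α hmul hstar c)

theorem actionCLM_apply (α : C →ₗ[ℂ] V →ₗ[ℂ] V) (hmul : ∀ a b x, α (a * b) x = α a (α b x))
    (hstar : ∀ a x y, inner ℂ (α a x) y = inner ℂ x (α (star a) y)) (c : C) (x : V) :
    actionCLM α hmul hstar c x = α c x := rfl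

theorem completion_clm_ext {S T : Completion V →L[ℂ] Completion V}
    (h : ∀ x : V, S x = T x) : S = T :=
  ContinuousLinearMap.ext fun x => Completion.induction_on x
    (isClosed_eq S.continuous T.continuous) h

/-- The representation on the completion of a semi-inner product space induced by an action by
adjointable operators. -/
def completionRep (α : C →ₗ[ℂ] V →ₗ[ℂ] V) (hmul : ∀ a b x, α (a * b) x = α a (α b x))
    (hstar : ∀ a x y, inner ℂ (α a x) y = inner ℂ x (α (star a) y)) :
    C →⋆ₙₐ[ℂ] (Completion V →L[ℂ] Completion V) where
  toFun c := (actionCLM α hmul hstar c).completion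
  map_smul' r c := completion_clm_ext fun x => by
    rw [ContinuousLinearMap.completion_apply_coe, actionCLM_apply, map_smul]
    change _ = r • (actionCLM α hmul hstar c).completion x
    rw [ContinuousLinearMap.completion_apply_coe, actionCLM_apply, LinearMap.smul_apply,
      Completion.coe_smul]
  map_zero' := completion_clm_ext fun x => by
    rw [ContinuousLinearMap.completion_apply_coe, actionCLM_apply, map_zero]
    rfl
  map_add' a b := completion_clm_ext fun x => by
    rw [ContinuousLinearMap.completion_apply_coe, actionCLM_apply, map_add]
    change _ = (actionCLM α hmul hstar a).completion x + (actionCLM α hmul hstar b).completion x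
    rw [ContinuousLinearMap.completion_apply_coe, ContinuousLinearMap.completion_apply_coe,
      actionCLM_apply, actionCLM_apply, LinearMap.add_apply, Completion.coe_add]
  map_mul' a b := completion_clm_ext fun x => by
    change _ = (actionCLM α hmul hstar a).completion ((actionCLM α hmul hstar b).completion x)
    simp only [ContinuousLinearMap.completion_apply_coe, actionCLM_apply, hmul]
  map_star' c := by
    refine (ContinuousLinearMap.eq_adjoint_iff _ _).mpr fun x y => ?_
    induction x, y using Completion.induction_on₂ with
    | hp =>
      exact isClosed_eq
        (((ContinuousLinearMap.continuous _).comp continuous_fst).inner continuous_snd)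
        (continuous_fst.inner ((ContinuousLinearMap.continuous _).comp continuous_snd))
    | ih x y =>
      rw [ContinuousLinearMap.completion_apply_coe, ContinuousLinearMap.completion_apply_coe,
        Completion.inner_coe, Completion.inner_coe, actionCLM_apply, actionCLM_apply, hstar,
        star_star]

theorem completionRep_coe (α : C →ₗ[ℂ] V →ₗ[ℂ] V) (hmul : ∀ a b x, α (a * b) x = α a (α b x))
    (hstar : ∀ a x y, inner ℂ (α a x) y = inner ℂ x (α (star a) y)) (c : C) (x : V) :
    completionRep α hmul hstar c (x : Completion V) = (α c x : V) :=
  ContinuousLinearMap.completion_apply_coe (actionCLM α hmul hstar c) x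

end Representations

section MultiplierOrbit
open UniformSpace (Completion)

variable {A T : Type u} [NonUnitalCStarAlgebra A] [NonUnitalCStarAlgebra T]

/-- The linear map `x ↦ h(x) b` for a homomorphism `h` into the multipliers of the algebra
containing `b`. -/
def orbit (h : A →⋆ₙₐ[ℂ] 𝓜(ℂ, T)) (b : T) : A →ₗ[ℂ] T where
  toFun x := (h x).fst b
  map_add' x y := by rw [map_add, DoubleCentralizer.add_fst]; rfl
  map_smul' c x := by rw [map_smul, DoubleCentralizer.smul_fst]; rfl

theorem star_orbit_mul (h : A →⋆ₙₐ[ℂ] 𝓜(ℂ, T)) (a : A) (s s' : T) :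
    star ((h a).fst s) * s' = star s * (h (star a)).fst s' := by
  rw [← (h (star a)).central, map_star h, DoubleCentralizer.star_snd, star_star]

/-- A representation of `T` extends to the multipliers of `T`, up to a dilation. -/
theorem exists_rep_dilation (h : A →⋆ₙₐ[ℂ] 𝓜(ℂ, T)) (b : T) {H : Type u} [NormedAddCommGroup H]
    [InnerProductSpace ℂ H] [CompleteSpace H] (π : T →⋆ₙₐ[ℂ] (H →L[ℂ] H)) :
    ∃ (K : Type u) (_ : NormedAddCommGroup K) (_ : InnerProductSpace ℂ K) (_ : CompleteSpace K)
      (π' : A →⋆ₙₐ[ℂ] (K →L[ℂ] K)) (W : K →L[ℂ] H) (R : H →L[ℂ] K), ‖W‖ ≤ 1 ∧ ‖R‖ ≤ ‖b‖ ∧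
      ∀ a, W ∘L π' a ∘L R = π (orbit h b a) := by
  let m : T ⊗[ℂ] H →ₗ[ℂ] H := TensorProduct.lift
    { toFun := fun s => (π s : H →ₗ[ℂ] H)
      map_add' := fun s s' => by rw [map_add]; rfl
      map_smul' := fun c s => by rw [map_smul]; rfl }
  let core : PreInnerProductSpace.Core ℂ (T ⊗[ℂ] H) :=
    { inner := fun x y => inner ℂ (m x) (m y)
      conj_inner_symm := fun x y => inner_conj_symm _ _
      re_inner_nonneg := fun x => inner_self_nonneg
      add_left := fun x y z => by
        change inner ℂ (m (x + y)) (m z) = _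
        rw [map_add, inner_add_left]
      smul_left := fun x y c => by
        change inner ℂ (m (c • x)) (m y) = _
        rw [map_smul, inner_smul_left] }
  let _ : SeminormedAddCommGroup (T ⊗[ℂ] H) :=
    InnerProductSpace.Core.toSeminormedAddCommGroup (c := core)
  let _ : InnerProductSpace ℂ (T ⊗[ℂ] H) := InnerProductSpace.ofCore core
  have hinner : ∀ x y : T ⊗[ℂ] H, inner ℂ x y = inner ℂ (m x) (m y) := fun _ _ => rfl
  have hnorm : ∀ x : T ⊗[ℂ] H, ‖x‖ = ‖m x‖ := fun x => by
    rw [@norm_eq_sqrt_re_inner ℂ, @norm_eq_sqrt_re_inner ℂ H, hinner]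
  let α : A →ₗ[ℂ] (T ⊗[ℂ] H) →ₗ[ℂ] (T ⊗[ℂ] H) :=
    { toFun := fun a => LinearMap.rTensor H ((h a).fst : T →ₗ[ℂ] T)
      map_add' := fun a a' => by
        rw [← LinearMap.rTensor_add, map_add]; rfl
      map_smul' := fun c a => by
        rw [RingHom.id_apply, ← LinearMap.rTensor_smul, map_smul]; rfl }
  have hα : ∀ a s ξ, α a (s ⊗ₜ ξ) = (h a).fst s ⊗ₜ[ℂ] ξ := fun _ _ _ => rfl
  have hmul : ∀ a a' x, α (a * a') x = α a (α a' x) := by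
    intro a a' x
    induction x with
    | zero => simp
    | add x y hx hy => rw [map_add, map_add, map_add, hx, hy]
    | tmul s ξ => rw [hα, hα, hα, map_mul]; rfl
  have hstar : ∀ a x y, inner ℂ (α a x) y = inner ℂ x (α (star a) y) := by
    intro a x y
    induction x with
    | zero => rw [map_zero, inner_zero_left, inner_zero_left]
    | add x x' hx hx' => rw [map_add, inner_add_left, inner_add_left, hx, hx']
    | tmul s ξ =>
      induction y with
      | zero => rw [map_zero, inner_zero_right, inner_zero_right]
      | add y y' hy hy' => rw [map_add, inner_add_right, inner_add_right, hy, hy']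
      | tmul s' ξ' =>
        rw [hα, hα, hinner, hinner]
        change inner ℂ (π ((h a).fst s) ξ) (π s' ξ') = inner ℂ (π s ξ) (π ((h (star a)).fst s') ξ')
        rw [← ContinuousLinearMap.adjoint_inner_right, ← ContinuousLinearMap.adjoint_inner_right,
          ← ContinuousLinearMap.star_eq_adjoint, ← ContinuousLinearMap.star_eq_adjoint,
          ← map_star π, ← map_star π, ← mul_apply_eq_comp, ← mul_apply_eq_comp,
          ← map_mul, ← map_mul, star_orbit_mul]
  let mL : (T ⊗[ℂ] H) →L[ℂ] H := m.mkContinuous 1 fun x => by rw [hnorm, one_mul]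
  let W : Completion (T ⊗[ℂ] H) →L[ℂ] H := mL.fromCompletion
  have hW : ∀ x : T ⊗[ℂ] H, W x = m x := fun x => ContinuousLinearMap.fromCompletion_apply_coe mL x
  have hbnorm : ∀ ξ, ‖((b ⊗ₜ[ℂ] ξ : T ⊗[ℂ] H) : Completion (T ⊗[ℂ] H))‖ ≤ ‖b‖ * ‖ξ‖ := by
    intro ξ
    rw [Completion.norm_coe, hnorm]
    change ‖π b ξ‖ ≤ _
    refine ((π b).le_opNorm ξ).trans ?_
    gcongr
    exact NonUnitalStarAlgHom.norm_apply_le π b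
  let R : H →L[ℂ] Completion (T ⊗[ℂ] H) := LinearMap.mkContinuous
    { toFun := fun ξ => ((b ⊗ₜ[ℂ] ξ : T ⊗[ℂ] H) : Completion (T ⊗[ℂ] H))
      map_add' := fun ξ ξ' => by rw [TensorProduct.tmul_add, Completion.coe_add]
      map_smul' := fun c ξ => by
        rw [TensorProduct.tmul_smul, Completion.coe_smul, RingHom.id_apply] } ‖b‖ hbnorm
  refine ⟨Completion (T ⊗[ℂ] H), inferInstance, inferInstance, inferInstance,
    completionRep α hmul hstar, W, R, ?_, ?_, ?_⟩
  · refine ContinuousLinearMap.opNorm_le_bound _ zero_le_one fun x => ?_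
    rw [one_mul]
    refine Completion.induction_on x (isClosed_le (W.continuous.norm) continuous_norm) fun x => ?_
    rw [hW, Completion.norm_coe, hnorm]
  · exact LinearMap.mkContinuous_norm_le _ (norm_nonneg b) _
  · intro a
    ext ξ
    change W (completionRep α hmul hstar a ((b ⊗ₜ[ℂ] ξ : T ⊗[ℂ] H) : Completion (T ⊗[ℂ] H))) = _
    rw [completionRep_coe, hW]
    rfl

theorem minNorm_map_orbit_le (h : A →⋆ₙₐ[ℂ] 𝓜(ℂ, T)) (b : T) {D : Type u}
    [NonUnitalCStarAlgebra D] (t : A ⊗[ℂ] D) :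
    minNorm (TensorProduct.map (orbit h b) (LinearMap.id : D →ₗ[ℂ] D) t) ≤ ‖b‖₊ * minNorm t := by
  have h0 : (‖b‖₊ : ℝ≥0∞) * minNorm t = ENNReal.ofReal (‖b‖ * (minNorm t).toReal) := by
    rw [ENNReal.ofReal_mul (norm_nonneg b), ENNReal.ofReal_toReal (minNorm_lt_top t).ne,
      ofReal_norm, enorm_eq_nnnorm]
  rw [h0]
  refine minNorm_le_ofReal (by positivity) fun H _ _ _ L _ _ _ π σ x => ?_
  obtain ⟨K, _, _, _, π', W, R, hW, hR, hπ⟩ := exists_rep_dilation h b π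
  have key : ∀ (t : A ⊗[ℂ] D) (x : H ⊗[ℂ] L),
      spatialRep π σ (TensorProduct.map (orbit h b) (LinearMap.id : D →ₗ[ℂ] D) t) x
      = TensorProduct.mapL W (.id ℂ L)
        (spatialRep π' σ t (TensorProduct.mapL R (.id ℂ L) x)) := by
    intro t x
    induction t with
    | zero => simp
    | add s t hs ht => rw [map_add, map_add, map_add, add_apply, add_apply, hs, ht, map_add]
    | tmul a d =>
      rw [TensorProduct.map_tmul, spatialRep_tmul, spatialRep_tmul, ← hπ a]
      induction x with
      | zero => simp
      | add x y hx hy => rw [map_add, hx, hy, ← map_add, ← map_add, ← map_add]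
      | tmul ξ η => simp
  rw [key]
  have hW' : ‖TensorProduct.mapL W (.id ℂ L)‖ ≤ 1 := by
    refine (TensorProduct.norm_mapL_le _ _).trans ?_
    exact mul_le_one₀ hW (norm_nonneg _) ContinuousLinearMap.norm_id_le
  have hR' : ‖TensorProduct.mapL R (.id ℂ L)‖ ≤ ‖b‖ := by
    refine (TensorProduct.norm_mapL_le _ _).trans ?_
    exact (mul_le_mul hR ContinuousLinearMap.norm_id_le (norm_nonneg _) (norm_nonneg _)).trans
      (mul_one _).le
  calc _ ≤ 1 * ‖spatialRep π' σ t (TensorProduct.mapL R (.id ℂ L) x)‖ :=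
        ContinuousLinearMap.le_of_opNorm_le _ hW' _
    _ ≤ (minNorm t).toReal * ‖TensorProduct.mapL R (.id ℂ L) x‖ := by
        rw [one_mul]; exact norm_spatialRep_apply_le π' σ t _
    _ ≤ (minNorm t).toReal * (‖b‖ * ‖x‖) := by
        gcongr
        exact ContinuousLinearMap.le_of_opNorm_le _ hR' _
    _ = _ := by ring

theorem IsNuclear.comp_orbit {B : Type u} [NonUnitalCStarAlgebra B] {θ : T →ₗ[ℂ] B}
    (hθ : IsNuclear θ) (h : A →⋆ₙₐ[ℂ] 𝓜(ℂ, T)) (b : T) : IsNuclear (θ ∘ₗ orbit h b) :=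
  hθ.comp_of_minNorm_le _ ‖b‖₊ fun _ _ t => minNorm_map_orbit_le h b t

end MultiplierOrbit

section MultiplierExtension

variable {A J D E : Type u} [NonUnitalCStarAlgebra A] [NonUnitalCStarAlgebra J]
  [NonUnitalCStarAlgebra D] [NonUnitalCStarAlgebra E]

theorem nondegenerate_id (J : Type v) [NonUnitalCStarAlgebra J] :
    Nondegenerate (NonUnitalStarAlgHom.id ℂ J) := by
  intro d
  obtain ⟨l, hl, -, hr, -⟩ := exists_approx_unit J
  exact mem_closure_of_tendsto (hr d)
    (Eventually.of_forall fun u => Submodule.subset_span ⟨u, d, rfl⟩)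

theorem isIdealEmbedding_coe (J : Type v) [NonUnitalCStarAlgebra J] :
    IsIdealEmbedding (DoubleCentralizer.coeHom : J →⋆ₙₐ[ℂ] 𝓜(ℂ, J)) where
  inj := coe_injective J
  mul_left m i := ⟨m.fst i, (multiplier_mul_coe m i).symm⟩
  mul_right m i := ⟨m.snd i, (coe_mul_multiplier m i).symm⟩

/-- The action of a C*-algebra on an ideal by multipliers. -/
def idealAction {I : Type v} {M : Type w} [NonUnitalCStarAlgebra I] [NonUnitalCStarAlgebra M]
    {j : I →⋆ₙₐ[ℂ] M} (hj : IsIdealEmbedding j) : M →⋆ₙₐ[ℂ] 𝓜(ℂ, I) :=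
  multExt hj (nondegenerate_id I)

theorem idealAction_apply {I : Type v} {M : Type w} [NonUnitalCStarAlgebra I]
    [NonUnitalCStarAlgebra M] {j : I →⋆ₙₐ[ℂ] M} (hj : IsIdealEmbedding j) (i : I) :
    idealAction hj (j i) = (DoubleCentralizer.coeHom i : 𝓜(ℂ, I)) :=
  multExt_apply hj (nondegenerate_id I) i

theorem idealAction_fst {I : Type v} {M : Type w} [NonUnitalCStarAlgebra I]
    [NonUnitalCStarAlgebra M] {j : I →⋆ₙₐ[ℂ] M} (hj : IsIdealEmbedding j) (m : M) (i : I) :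
    j ((idealAction hj m).fst i) = m * j i := by
  obtain ⟨i', hi'⟩ := hj.mul_left m i
  rw [← hi']
  exact congrArg j (multExt_fst hj (nondegenerate_id I) m i i' hi')

/-- The largest C*-subalgebra in which a given C*-subalgebra is an ideal. -/
def idealizer {E : Type v} [NonUnitalCStarAlgebra E] (S : CStarSub E) : CStarSub E where
  toSub :=
    { carrier := {e | (∀ s ∈ S.toSub, e * s ∈ S.toSub) ∧ ∀ s ∈ S.toSub, s * e ∈ S.toSub}
      add_mem' := fun {x y} hx hy =>
        ⟨fun s hs => by rw [add_mul]; exact add_mem (hx.1 s hs) (hy.1 s hs),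
          fun s hs => by rw [mul_add]; exact add_mem (hx.2 s hs) (hy.2 s hs)⟩
      zero_mem' := ⟨fun s _ => by rw [zero_mul]; exact zero_mem _,
        fun s _ => by rw [mul_zero]; exact zero_mem _⟩
      mul_mem' := fun {x y} hx hy =>
        ⟨fun s hs => by rw [mul_assoc]; exact hx.1 _ (hy.1 s hs),
          fun s hs => by rw [← mul_assoc]; exact hy.2 _ (hx.2 s hs)⟩
      smul_mem' := fun c x hx =>
        ⟨fun s hs => by rw [smul_mul_assoc]; exact SMulMemClass.smul_mem c (hx.1 s hs),
          fun s hs => by rw [mul_smul_comm]; exact SMulMemClass.smul_mem c (hx.2 s hs)⟩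
      star_mem' := fun {x} hx =>
        ⟨fun s hs => by
          rw [← star_star s, ← star_mul]
          exact star_mem (hx.2 _ (star_mem hs)),
        fun s hs => by
          rw [← star_star s, ← star_mul]
          exact star_mem (hx.1 _ (star_mem hs))⟩ }
  closed := by
    have h : IsClosed ((⋂ s ∈ S.toSub, (fun e => e * s) ⁻¹' (S.toSub : Set E)) ∩
        ⋂ s ∈ S.toSub, (fun e => s * e) ⁻¹' (S.toSub : Set E)) :=
      (isClosed_biInter fun s _ => S.closed.preimage (by fun_prop)).inter
        (isClosed_biInter fun s _ => S.closed.preimage (by fun_prop))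
    convert h using 1
    ext e
    simp only [Set.mem_inter_iff, Set.mem_iInter]
    rfl

theorem le_idealizer {E : Type v} [NonUnitalCStarAlgebra E] (S : CStarSub E) (s : S) :
    S.incl s ∈ (idealizer S).toSub :=
  ⟨fun _ ht => mul_mem (S.incl_mem s) ht, fun _ ht => mul_mem ht (S.incl_mem s)⟩

theorem isIdealEmbedding_idealizer {E : Type v} [NonUnitalCStarAlgebra E] (S : CStarSub E) :
    IsIdealEmbedding ((idealizer S).corestrict S.incl (le_idealizer S)) where
  inj _ _ h := S.incl_injective (congrArg (idealizer S).incl h)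
  mul_left e s := ⟨S.elem ((idealizer S).incl e * S.incl s)
    (((idealizer S).incl_mem e).1 _ (S.incl_mem s)), (idealizer S).incl_injective rfl⟩
  mul_right e s := ⟨S.elem (S.incl s * (idealizer S).incl e)
    (((idealizer S).incl_mem e).2 _ (S.incl_mem s)), (idealizer S).incl_injective rfl⟩

theorem mem_idealizer_her {X : Type v} [NonUnitalCStarAlgebra X] {E : Type w}
    [NonUnitalCStarAlgebra E] (f : X →⋆ₙₐ[ℂ] E)
    (e : E) (he : ∀ x, Commute (f x) e) : e ∈ (idealizer (her f)).toSub := by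
  have he' : ∀ x, Commute (f x) (star e) := fun x => by
    have := (he (star x)).star_star
    rwa [map_star, star_star] at this
  have hl : ∀ e, (∀ x, Commute (f x) e) → ∀ z b w, e * (f z * b * f w) ∈ (her f).toSub := by
    intro e he z b w
    rw [← mul_assoc, ← mul_assoc, ← (he z).eq, mul_assoc (f z)]
    exact CStarSub.subset_gen ⟨z, e * b, w, rfl⟩
  have hr : ∀ e, (∀ x, Commute (f x) e) → ∀ z b w, (f z * b * f w) * e ∈ (her f).toSub := by
    intro e he z b w
    rw [mul_assoc, (he w).eq, ← mul_assoc, mul_assoc (f z)]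
    exact CStarSub.subset_gen ⟨z, b * e, w, rfl⟩
  let P : CStarSub E :=
    { toSub :=
        { carrier := {s | s ∈ (her f).toSub ∧ (e * s ∈ (her f).toSub ∧ s * e ∈ (her f).toSub) ∧
            star e * s ∈ (her f).toSub ∧ s * star e ∈ (her f).toSub}
          add_mem' := fun {x y} hx hy => by
            refine ⟨add_mem hx.1 hy.1, ⟨?_, ?_⟩, ?_, ?_⟩
            · rw [mul_add]; exact add_mem hx.2.1.1 hy.2.1.1
            · rw [add_mul]; exact add_mem hx.2.1.2 hy.2.1.2
            · rw [mul_add]; exact add_mem hx.2.2.1 hy.2.2.1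
            · rw [add_mul]; exact add_mem hx.2.2.2 hy.2.2.2
          zero_mem' := by
            refine ⟨zero_mem _, ⟨?_, ?_⟩, ?_, ?_⟩ <;> simp only [mul_zero, zero_mul] <;>
              exact zero_mem _
          mul_mem' := fun {x y} hx hy => by
            refine ⟨mul_mem hx.1 hy.1, ⟨?_, ?_⟩, ?_, ?_⟩
            · rw [← mul_assoc]; exact mul_mem hx.2.1.1 hy.1
            · rw [mul_assoc]; exact mul_mem hx.1 hy.2.1.2
            · rw [← mul_assoc]; exact mul_mem hx.2.2.1 hy.1
            · rw [mul_assoc]; exact mul_mem hx.1 hy.2.2.2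
          smul_mem' := fun c x hx => by
            refine ⟨SMulMemClass.smul_mem c hx.1, ⟨?_, ?_⟩, ?_, ?_⟩
            · rw [mul_smul_comm]; exact SMulMemClass.smul_mem c hx.2.1.1
            · rw [smul_mul_assoc]; exact SMulMemClass.smul_mem c hx.2.1.2
            · rw [mul_smul_comm]; exact SMulMemClass.smul_mem c hx.2.2.1
            · rw [smul_mul_assoc]; exact SMulMemClass.smul_mem c hx.2.2.2
          star_mem' := fun {x} hx => by
            refine ⟨star_mem hx.1, ⟨?_, ?_⟩, ?_, ?_⟩
            · rw [← star_star e, ← star_mul]; exact star_mem hx.2.2.2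
            · rw [← star_star e, ← star_mul]; exact star_mem hx.2.2.1
            · rw [← star_mul]; exact star_mem hx.2.1.2
            · rw [← star_mul]; exact star_mem hx.2.1.1 }
      closed := by
        have hcl := (her f).closed
        exact hcl.inter (((hcl.preimage (by fun_prop)).inter (hcl.preimage (by fun_prop))).inter
          ((hcl.preimage (by fun_prop)).inter (hcl.preimage (by fun_prop)))) }
  have hP : (her f).toSub ≤ P.toSub := by
    refine CStarSub.gen_le ?_
    rintro _ ⟨z, b, w, rfl⟩
    exact ⟨CStarSub.subset_gen ⟨z, b, w, rfl⟩, ⟨hl e he z b w, hr e he z b w⟩,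
      hl _ he' z b w, hr _ he' z b w⟩
  exact ⟨fun s hs => (hP hs).2.1.1, fun s hs => (hP hs).2.1.2⟩

theorem productMap_comp {E' : Type u} [NonUnitalCStarAlgebra E'] (k : E →⋆ₙₐ[ℂ] E')
    (f : J →⋆ₙₐ[ℂ] E) (g : D →⋆ₙₐ[ℂ] E) (s : J ⊗[ℂ] D) :
    productMap (k.comp f) (k.comp g) s = k (productMap f g s) := by
  induction s with
  | zero => rw [map_zero, map_zero, map_zero]
  | add s t hs ht => rw [map_add, map_add, map_add, hs, ht]
  | tmul b d => exact (map_mul k (f b) (g d)).symm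

/-- A pair of commuting homomorphisms on `J` and `D` extends to a pair of commuting homomorphisms
on the multiplier algebra of `J` and on `D`, without changing the norm on `J ⊗ D`. -/
theorem exists_multiplier_extension (f : J →⋆ₙₐ[ℂ] E) (g : D →⋆ₙₐ[ℂ] E)
    (hc : ∀ x d, Commute (f x) (g d)) :
    ∃ (E' : Type u) (_ : NonUnitalCStarAlgebra E') (F : 𝓜(ℂ, J) →⋆ₙₐ[ℂ] E')
      (G : D →⋆ₙₐ[ℂ] E'), (∀ m d, Commute (F m) (G d)) ∧
      ∀ s : J ⊗[ℂ] D, ‖productMap (F.comp DoubleCentralizer.coeHom) G s‖ₑ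
        = ‖productMap f g s‖ₑ := by
  have hj := isIdealEmbedding_idealizer (her f)
  let j := (idealizer (her f)).corestrict (her f).incl (le_idealizer (her f))
  let κ : idealizer (her f) →⋆ₙₐ[ℂ] 𝓜(ℂ, her f) := idealAction hj
  let g' : D →⋆ₙₐ[ℂ] idealizer (her f) := (idealizer (her f)).corestrict g
    fun d => mem_idealizer_her f (g d) fun x => hc x d
  let f' : J →⋆ₙₐ[ℂ] idealizer (her f) := j.comp (completed f)
  have hc' : ∀ x d, Commute (f' x) (g' d) := fun x d =>
    (idealizer (her f)).incl_injective (hc x d)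
  let F : 𝓜(ℂ, J) →⋆ₙₐ[ℂ] 𝓜(ℂ, her f) :=
    multExt (isIdealEmbedding_coe J) (nondegenerate_completed f)
  let G : D →⋆ₙₐ[ℂ] 𝓜(ℂ, her f) := κ.comp g'
  have hFcoe : ∀ x : J, F (DoubleCentralizer.coeHom x) = κ (f' x) := fun x =>
    (multExt_apply (isIdealEmbedding_coe J) (nondegenerate_completed f) x).trans
      (idealAction_apply hj (completed f x)).symm
  have hFG : ∀ x d, F (DoubleCentralizer.coeHom x) * G d = G d * F (DoubleCentralizer.coeHom x) := by
    intro x d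
    rw [hFcoe]
    exact ((map_mul κ _ _).symm.trans (congrArg κ (hc' x d).eq)).trans (map_mul κ _ _)
  refine ⟨𝓜(ℂ, her f), inferInstance, F, G, fun m d => ?_, fun s => ?_⟩
  · have h1 : ∀ x : J, (F m * G d) * F (DoubleCentralizer.coeHom x)
        = (G d * F m) * F (DoubleCentralizer.coeHom x) := by
      intro x
      have h2 : m * DoubleCentralizer.coeHom x = DoubleCentralizer.coeHom (m.fst x) :=
        multiplier_mul_coe m x
      rw [mul_assoc, ← hFG, ← mul_assoc, ← map_mul, h2, hFG, mul_assoc, ← map_mul, h2]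
    refine (nondegenerate_completed f).ext fun x => ?_
    have h3 : F (DoubleCentralizer.coeHom x) = (completed f x : 𝓜(ℂ, her f)) :=
      multExt_apply (isIdealEmbedding_coe J) (nondegenerate_completed f) x
    have h4 := h1 x
    rw [h3, multiplier_mul_coe, multiplier_mul_coe] at h4
    exact coe_injective _ h4
  · have h1 : F.comp DoubleCentralizer.coeHom = κ.comp f' :=
      NonUnitalStarAlgHom.ext fun x => hFcoe x
    have h2 : productMap f g s = (idealizer (her f)).incl (productMap f' g' s) :=
      productMap_comp (idealizer (her f)).incl f' g' s
    have h3 : ∃ y : her f, j y = productMap f' g' s := by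
      induction s with
      | zero => exact ⟨0, by rw [map_zero, map_zero]⟩
      | add s t hs ht =>
        obtain ⟨y, hy⟩ := hs (productMap_comp (idealizer (her f)).incl f' g' s)
        obtain ⟨z, hz⟩ := ht (productMap_comp (idealizer (her f)).incl f' g' t)
        exact ⟨y + z, by rw [map_add, map_add, hy, hz]⟩
      | tmul x d => exact hj.mul_right (g' d) (completed f x)
    obtain ⟨y, hy⟩ := h3
    have h4 : productMap (κ.comp f') G s = DoubleCentralizer.coeHom y := by
      rw [← idealAction_apply hj y]
      exact (productMap_comp κ f' g' s).trans (congrArg κ hy.symm)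
    rw [h1, h4, h2, ← hy, enorm_eq_nnnorm, enorm_eq_nnnorm,
      NonUnitalStarAlgHom.nnnorm_map _ (coe_injective (her f))]
    exact congrArg _ (NonUnitalStarAlgHom.nnnorm_map (her f).incl (her f).incl_injective y).symm

/-- Multiplying a nuclear map into an algebra acting on `J` by a multiplier of `J` yields a nuclear
map into `J`, provided that the values are in `J`. -/
theorem IsNuclear.mul_multiplier {P : Type u} [NonUnitalCStarAlgebra P] {θ : A →ₗ[ℂ] P}
    (hθ : IsNuclear θ) (κ : P →⋆ₙₐ[ℂ] 𝓜(ℂ, J)) (m : 𝓜(ℂ, J)) {θ' : A →ₗ[ℂ] J}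
    (h : ∀ x, (DoubleCentralizer.coeHom (θ' x) : 𝓜(ℂ, J)) = κ (θ x) * m) : IsNuclear θ' := by
  obtain ⟨K, hK⟩ := hθ
  refine ⟨K * ‖m‖₊, fun D _ t => maxNorm_le fun E _ f g hc => ?_⟩
  obtain ⟨E', _, F, G, hFG, hn⟩ := exists_multiplier_extension f g hc
  rw [← hn]
  have h1 : productMap (F.comp DoubleCentralizer.coeHom) G
      (TensorProduct.map θ' (LinearMap.id : D →ₗ[ℂ] D) t)
      = productMap (F.comp κ) G (TensorProduct.map θ (LinearMap.id : D →ₗ[ℂ] D) t) * F m := by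
    induction t with
    | zero => rw [map_zero, map_zero, map_zero, map_zero, zero_mul]
    | add s t hs ht => rw [map_add, map_add, map_add, map_add, add_mul, hs, ht]
    | tmul a d =>
      change F (DoubleCentralizer.coeHom (θ' a)) * G d = F (κ (θ a)) * G d * F m
      rw [h, map_mul, mul_assoc, mul_assoc, (hFG m d).eq]
  rw [h1]
  have h2 : ∀ x y : E', ‖x * y‖ₑ ≤ ‖x‖ₑ * ‖y‖ₑ := fun x y => by
    simp only [enorm_eq_nnnorm]
    exact_mod_cast nnnorm_mul_le x y
  have h3 : ‖F m‖ₑ ≤ ‖m‖₊ := by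
    rw [enorm_eq_nnnorm, ENNReal.coe_le_coe]
    exact NonUnitalStarAlgHom.norm_apply_le F m
  calc _ ≤ _ := h2 _ _
    _ ≤ K * minNorm t * ‖m‖₊ := mul_le_mul'
      ((enorm_productMap_le_maxNorm (fun p d => hFG (κ p) d) _).trans (hK D t)) h3
    _ = _ := by rw [ENNReal.coe_mul]; ring

theorem norm_mul_le_of_multiplicative {N : A ⊗[ℂ] D → ℝ} (hN : ∀ t, 0 ≤ N t)
    (hN' : ∀ t, N (star t * t) ≤ N t ^ 2) (P : A ⊗[ℂ] D → E)
    (hmul : ∀ s t, P (s * t) = P s * P t) (hstar : ∀ t, P (star t) = star (P t)) (v : E) {K : ℝ}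
    (hK : ∀ t, ‖P t * v‖ ≤ K * N t) (t : A ⊗[ℂ] D) : ‖P t * v‖ ≤ ‖v‖ * N t := by
  let S : Set ℝ := {K | 0 ≤ K ∧ ∀ t, ‖P t * v‖ ≤ K * N t}
  have hS : S.Nonempty := ⟨max K 0, le_max_right _ _, fun t =>
    (hK t).trans (mul_le_mul_of_nonneg_right (le_max_left _ _) (hN t))⟩
  have hbdd : BddBelow S := ⟨0, fun K hK => hK.1⟩
  have hsqrt : ∀ K ∈ S, √(‖v‖ * K) ∈ S := by
    rintro K ⟨hK0, hK⟩
    refine ⟨Real.sqrt_nonneg _, fun t => ?_⟩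
    refine abs_le_of_sq_le_sq' ?_ (mul_nonneg (Real.sqrt_nonneg _) (hN t)) |>.2
    rw [mul_pow, Real.sq_sqrt (mul_nonneg (norm_nonneg v) hK0), sq, ← CStarRing.norm_star_mul_self,
      star_mul, mul_assoc, ← mul_assoc (star (P t)), ← hstar, ← hmul]
    calc _ ≤ ‖star v‖ * ‖P (star t * t) * v‖ := norm_mul_le _ _
      _ ≤ ‖v‖ * (K * N (star t * t)) := by
        rw [norm_star]; exact mul_le_mul_of_nonneg_left (hK _) (norm_nonneg v)
      _ ≤ ‖v‖ * (K * N t ^ 2) := by gcongr; exact hN' t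
      _ = _ := by ring
  have h0 : 0 ≤ sInf S := le_csInf hS fun K hK => hK.1
  have h1 : ∀ K ∈ S, sInf S ^ 2 ≤ ‖v‖ * K := fun K hK => by
    rw [← Real.sq_sqrt (mul_nonneg (norm_nonneg v) hK.1)]
    exact pow_le_pow_left₀ h0 (csInf_le hbdd (hsqrt K hK)) 2
  have h2 : sInf S ≤ ‖v‖ := by
    rcases (norm_nonneg v).eq_or_lt with hv | hv
    · obtain ⟨K, hK⟩ := hS
      have := h1 K hK
      rw [← hv, zero_mul] at this
      nlinarith
    · have h3 : sInf S ^ 2 / ‖v‖ ≤ sInf S := le_csInf hS fun K hK => by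
        rw [div_le_iff₀ hv, mul_comm]; exact h1 K hK
      rw [div_le_iff₀ hv] at h3
      by_contra! h4
      nlinarith
  refine le_trans ?_ (mul_le_mul_of_nonneg_right h2 (hN t))
  rcases (hN t).eq_or_lt with ht | ht
  · obtain ⟨K, hK⟩ := hS
    have := hK.2 t
    rwa [← ht, mul_zero] at this ⊢
  · rw [← div_le_iff₀ ht]
    exact le_csInf hS fun K hK => by rw [div_le_iff₀ ht]; exact hK.2 t

/-- The elements `w` for which `x ↦ h(x) w` is nuclear form a closed set. -/
theorem isClosed_setOf_isNuclear_orbit {T : Type u} [NonUnitalCStarAlgebra T]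
    (h : A →⋆ₙₐ[ℂ] 𝓜(ℂ, J)) (k : J →⋆ₙₐ[ℂ] T) :
    IsClosed {w : J | IsNuclear ((k : J →ₗ[ℂ] T) ∘ₗ orbit h w)} := by
  refine isClosed_of_closure_subset fun w hw => ⟨‖w‖₊, fun D _ t =>
    maxNorm_le fun E _ f g hc => ?_⟩
  obtain ⟨E', _, F, G, hFG, hn⟩ := exists_multiplier_extension (f.comp k) g fun x d => hc (k x) d
  have hc' : ∀ a d, Commute ((F.comp h) a) (G d) := fun a d => hFG (h a) d
  have key : ∀ (w : J) (t : A ⊗[ℂ] D), ‖productMap f g (TensorProduct.map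
      ((k : J →ₗ[ℂ] T) ∘ₗ orbit h w) (LinearMap.id : D →ₗ[ℂ] D) t)‖ₑ
      = ‖productMap (F.comp h) G t * F (DoubleCentralizer.coeHom w)‖ₑ := by
    intro w t
    have h1 : ∀ t, productMap f g (TensorProduct.map
        ((k : J →ₗ[ℂ] T) ∘ₗ orbit h w) (LinearMap.id : D →ₗ[ℂ] D) t)
        = productMap (f.comp k) g (TensorProduct.map (orbit h w) LinearMap.id t) := by
      intro t
      induction t with
      | zero => rw [map_zero, map_zero, map_zero, map_zero]
      | add s t hs ht => rw [map_add, map_add, map_add, map_add, hs, ht]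
      | tmul a d => rfl
    have h2 : ∀ t, productMap (F.comp DoubleCentralizer.coeHom) G
        (TensorProduct.map (orbit h w) (LinearMap.id : D →ₗ[ℂ] D) t)
        = productMap (F.comp h) G t * F (DoubleCentralizer.coeHom w) := by
      intro t
      induction t with
      | zero => rw [map_zero, map_zero, map_zero, zero_mul]
      | add s t hs ht => rw [map_add, map_add, map_add, add_mul, hs, ht]
      | tmul a d =>
        change F (DoubleCentralizer.coeHom ((h a).fst w)) * G d
          = F (h a) * G d * F (DoubleCentralizer.coeHom w)
        have h3 : (DoubleCentralizer.coeHom ((h a).fst w) : 𝓜(ℂ, J))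
            = h a * DoubleCentralizer.coeHom w := (multiplier_mul_coe (h a) w).symm
        rw [h3, map_mul, mul_assoc, mul_assoc, (hFG _ d).eq]
    rw [h1, ← hn, h2]
  have hbound : ∀ w : J, IsNuclear ((k : J →ₗ[ℂ] T) ∘ₗ orbit h w) →
      ‖productMap (F.comp h) G t * F (DoubleCentralizer.coeHom w)‖
        ≤ ‖w‖ * (minNorm t).toReal := by
    rintro w ⟨K, hK⟩
    have h1 : ∀ t : A ⊗[ℂ] D, ‖productMap (F.comp h) G t * F (DoubleCentralizer.coeHom w)‖
        ≤ K * (minNorm t).toReal := by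
      intro t
      have h2 := (enorm_productMap_le_maxNorm hc _).trans (hK D t)
      rw [key] at h2
      have h3 := ENNReal.toReal_mono (ENNReal.mul_ne_top ENNReal.coe_ne_top
        (minNorm_lt_top t).ne) h2
      rwa [toReal_enorm, ENNReal.toReal_mul, ENNReal.coe_toReal] at h3
    refine (norm_mul_le_of_multiplicative (fun _ => ENNReal.toReal_nonneg)
      minNorm_star_mul_self_le _ (productMap_mul hc') (productMap_star hc') _ h1 t).trans ?_
    gcongr
    exact (NonUnitalStarAlgHom.norm_apply_le F _).trans
      (NonUnitalStarAlgHom.norm_apply_le DoubleCentralizer.coeHom w)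
  have hcl : IsClosed {w : J | ‖productMap (F.comp h) G t * F (DoubleCentralizer.coeHom w)‖
      ≤ ‖w‖ * (minNorm t).toReal} := by
    have hFc : Continuous fun w : J => F (DoubleCentralizer.coeHom w) :=
      map_continuous (F.comp DoubleCentralizer.coeHom)
    exact isClosed_le (by fun_prop) (by fun_prop)
  have h1 := hcl.closure_subset_iff.2 (fun w hw => hbound w hw) hw
  rw [key, ← ofReal_norm, ← ENNReal.ofReal_toReal (minNorm_lt_top t).ne]
  refine (ENNReal.ofReal_le_ofReal h1).trans ?_
  rw [ENNReal.ofReal_mul (norm_nonneg w), ofReal_norm, enorm_eq_nnnorm]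

end MultiplierExtension

section States

/-- Norming positive functionals. -/
theorem exists_state {E : Type v} [NonUnitalCStarAlgebra E] (c : E) :
    ∃ τ : E →ₗ[ℂ] ℂ, (∀ x, ‖τ x‖ ≤ ‖x‖) ∧ (∀ x, τ (star x) = star (τ x)) ∧
      (∀ x, 0 ≤ (τ (star x * x)).re) ∧ (τ (star c * c)).re = ‖c‖ ^ 2 := by
  let U := Unitization ℂ E
  let _ := CStarAlgebra.spectralOrder U
  let _ := CStarAlgebra.spectralOrderedRing U
  let a : U := star (c : U) * c
  have ha : 0 ≤ a := star_mul_self_nonneg _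
  have hna : ‖a‖ = ‖c‖ ^ 2 := by
    rw [CStarRing.norm_star_mul_self, Unitization.norm_inr, sq]
  obtain ⟨φ, hφ1, hφ2⟩ := exists_dual_vector'' ℂ (1 + a)
  have hφ : ∀ x, ‖φ x‖ ≤ ‖x‖ := fun x => by
    simpa using φ.le_of_opNorm_le hφ1 x
  have h1a : 1 + ‖a‖ ≤ ‖1 + a‖ := by
    have h1 : ‖a‖ ∈ spectrum ℝ a := CStarAlgebra.norm_mem_spectrum_of_nonneg ha
    have h2 : 1 + ‖a‖ ∈ spectrum ℝ (algebraMap ℝ U 1 + a) := by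
      rw [add_comm (1 : ℝ)]
      exact (spectrum.add_mem_add_iff (R := ℝ) (a := a) (r := ‖a‖) (s := 1)).2 h1
    rw [map_one] at h2
    have h3 := spectrum.norm_le_norm_of_mem h2
    rwa [Real.norm_of_nonneg (by positivity)] at h3
  have hre1 : (φ 1).re ≤ 1 := by
    refine (Complex.re_le_norm _).trans ((hφ 1).trans ?_)
    rw [norm_one]
  have hrea : (φ a).re ≤ ‖a‖ := (Complex.re_le_norm _).trans (hφ a)
  have hsum : (φ 1).re + (φ a).re = ‖1 + a‖ := by
    rw [← Complex.add_re, ← map_add, hφ2]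
    exact Complex.ofReal_re _
  have e1 : (φ 1).re = 1 := by linarith
  have ea : (φ a).re = ‖a‖ := by linarith
  let τ : U →ₗ[ℂ] ℂ :=
    { toFun := fun x => (φ x + star (φ (star x))) / 2
      map_add' := fun x y => by rw [star_add x y, map_add, map_add, star_add]; ring
      map_smul' := fun r x => by
        simp only [star_smul, map_smul, smul_eq_mul, RingHom.id_apply, star_mul', star_star]
        ring }
  have hτ : ∀ x, τ x = (φ x + star (φ (star x))) / 2 := fun _ => rfl
  have hτre : ∀ x, star x = x → τ x = (φ x).re := fun x hx => by
    rw [hτ, hx, Complex.star_def, Complex.add_conj]; push_cast; ring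
  have hτn : ∀ x, ‖τ x‖ ≤ ‖x‖ := fun x => by
    rw [hτ, norm_div, Complex.norm_two, div_le_iff₀ two_pos]
    refine (norm_add_le _ _).trans ?_
    rw [norm_star]
    have := hφ (star x)
    rw [norm_star] at this
    linarith [hφ x]
  have hτpos : ∀ x, 0 ≤ (τ (star x * x)).re := fun x => by
    have h0 : 0 ≤ star x * x := star_mul_self_nonneg x
    have h1 : star x * x ≤ algebraMap ℝ U (‖x‖ ^ 2) := CStarAlgebra.star_mul_le_algebraMap_norm_sq
    have h2 : ‖algebraMap ℝ U (‖x‖ ^ 2) - star x * x‖ ≤ ‖x‖ ^ 2 := by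
      refine (CStarAlgebra.norm_le_norm_of_nonneg_of_le (sub_nonneg.2 h1)
        (sub_le_self _ h0)).trans ?_
      rw [norm_algebraMap', Real.norm_of_nonneg (by positivity)]
    have h3 := (hτn _).trans h2
    rw [map_sub] at h3
    have h4 : τ (algebraMap ℝ U (‖x‖ ^ 2)) = ((‖x‖ ^ 2 : ℝ) : ℂ) := by
      have h5 : algebraMap ℝ U (‖x‖ ^ 2) = ((‖x‖ ^ 2 : ℝ) : ℂ) • (1 : U) := by
        rw [Algebra.algebraMap_eq_smul_one, Complex.coe_smul]
      rw [h5, map_smul, hτre 1 (star_one _), e1, smul_eq_mul, Complex.ofReal_one, mul_one]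
    have h6 := (Complex.re_le_norm _).trans h3
    rw [h4, Complex.sub_re, Complex.ofReal_re] at h6
    linarith
  refine ⟨τ ∘ₗ (Unitization.inrNonUnitalStarAlgHom ℂ E : E →ₗ[ℂ] U), fun x => ?_, fun x => ?_,
    fun x => ?_, ?_⟩
  · exact (hτn _).trans (Unitization.norm_inr x).le
  · change τ ((star x : E) : U) = star (τ (x : U))
    rw [Unitization.inr_star, hτ, hτ, star_star, star_div₀, star_add, star_star, add_comm]
    simp
  · change 0 ≤ (τ ((star x * x : E) : U)).re
    rw [Unitization.inr_mul, Unitization.inr_star]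
    exact hτpos _
  · change (τ ((star c * c : E) : U)).re = _
    rw [Unitization.inr_mul, Unitization.inr_star, hτre a (by simp [a]), Complex.ofReal_re, ea, hna]

end States

section Gram

/-- The matrices with entries in a C*-subalgebra. -/
def matrixSub {Y : Type v} [NonUnitalCStarAlgebra Y] [PartialOrder Y] [StarOrderedRing Y]
    (H : CStarSub Y) (n : Type w) [Fintype n] : CStarSub (CStarMatrix n n Y) where
  toSub :=
    { carrier := {M | ∀ i k, M i k ∈ H.toSub}
      add_mem' := fun hM hN i k => add_mem (hM i k) (hN i k)
      zero_mem' := fun _ _ => zero_mem _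
      mul_mem' := fun {M N} hM hN i k => by
        rw [CStarMatrix.mul_apply]
        exact sum_mem fun l _ => mul_mem (hM i l) (hN l k)
      smul_mem' := fun a M hM i k => SMulMemClass.smul_mem a (hM i k)
      star_mem' := fun {M} hM i k => by
        rw [CStarMatrix.star_apply]
        exact star_mem (hM k i) }
  closed := by
    have hc : ∀ i k, Continuous fun M : CStarMatrix n n Y => M i k := fun i k =>
      (continuous_apply k).comp (continuous_apply i)
    have h : IsClosed (⋂ (i : n) (k : n),
        (fun M : CStarMatrix n n Y => M i k) ⁻¹' (H.toSub : Set Y)) :=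
      isClosed_iInter fun i => isClosed_iInter fun k => H.closed.preimage (hc i k)
    have he : {M : CStarMatrix n n Y | ∀ i k, M i k ∈ H.toSub} = ⋂ (i : n) (k : n),
        (fun M : CStarMatrix n n Y => M i k) ⁻¹' (H.toSub : Set Y) := by
      refine Set.ext fun M => ?_
      simp only [Set.mem_iInter]
      rfl
    rw [← he] at h
    exact h

/-- A positive element of a C*-subalgebra has a square root in this subalgebra. -/
theorem exists_star_mul_self_eq {Z : Type v} [NonUnitalCStarAlgebra Z] (S : CStarSub Z) (x : Z)
    (hx : star x * x ∈ S.toSub) : ∃ y ∈ S.toSub, star y * y = star x * x := by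
  let _ := CStarAlgebra.spectralOrder Z
  let _ := CStarAlgebra.spectralOrderedRing Z
  have h0 : 0 ≤ star x * x := star_mul_self_nonneg x
  refine ⟨CFC.sqrt (star x * x), ?_, ?_⟩
  · rw [CFC.sqrt_eq_real_sqrt _ h0]
    have : IsClosed (S.toSub : Set Z) := S.closed
    exact cfcₙ_mem (𝕜' := ℂ) _ hx
  · rw [(CFC.sqrt_nonneg (star x * x)).isSelfAdjoint.star_eq, CFC.sqrt_mul_sqrt_self _ h0]

/-- A Gram matrix whose entries are in a C*-subalgebra has a square root with entries in this
subalgebra. -/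
theorem exists_gram_sqrt {Y : Type v} [NonUnitalCStarAlgebra Y] (H : CStarSub Y) {n : Type w}
    [Fintype n] (i₀ : n) (ℓ : n → Y) (hℓ : ∀ i k, star (ℓ i) * ℓ k ∈ H.toSub) :
    ∃ N : n → n → H, ∀ i k, ∑ l, star (N l i) * N l k = H.elem (star (ℓ i) * ℓ k) (hℓ i k) := by
  classical
  let _ := CStarAlgebra.spectralOrder Y
  let _ := CStarAlgebra.spectralOrderedRing Y
  let L : CStarMatrix n n Y := CStarMatrix.ofMatrix fun l k => if l = i₀ then ℓ k else 0
  have hL : ∀ l k, L l k = if l = i₀ then ℓ k else 0 := fun _ _ => rfl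
  have hM : ∀ i k, (star L * L) i k = star (ℓ i) * ℓ k := by
    intro i k
    rw [CStarMatrix.mul_apply, Finset.sum_eq_single i₀]
    · rw [CStarMatrix.star_apply, hL, hL, if_pos rfl, if_pos rfl]
    · intro l _ hl
      rw [CStarMatrix.star_apply, hL l k, if_neg hl, mul_zero]
    · intro h
      exact absurd (Finset.mem_univ _) h
  obtain ⟨N, hN, hNL⟩ := exists_star_mul_self_eq (matrixSub H n) L
    fun i k => by rw [hM]; exact hℓ i k
  refine ⟨fun l k => H.elem (N l k) (hN l k), fun i k => H.incl_injective ?_⟩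
  rw [CStarSub.incl_elem, ← hM, map_sum, ← hNL, CStarMatrix.mul_apply]
  refine Finset.sum_congr rfl fun l _ => ?_
  rw [map_mul, map_star, CStarSub.incl_elem, CStarSub.incl_elem, CStarMatrix.star_apply]

end Gram

section HereditaryNorm
open UniformSpace (Completion)

variable {Y D E : Type u} [NonUnitalCStarAlgebra Y] [NonUnitalCStarAlgebra D]
  [NonUnitalCStarAlgebra E]

/-- A C*-subalgebra `H` is hereditary if `H Y H ⊆ H`. -/
def IsHereditary {Y : Type v} [NonUnitalCStarAlgebra Y] (H : CStarSub Y) : Prop :=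
  ∀ a ∈ H.toSub, ∀ y, ∀ b ∈ H.toSub, a * y * b ∈ H.toSub

/-- The compression `y ↦ u* y u` by an element of a hereditary subalgebra. -/
def compression {H : CStarSub Y} (hH : IsHereditary H) (u : H) : Y →ₗ[ℂ] H where
  toFun y := H.elem (star (H.incl u) * y * H.incl u)
    (hH _ (star_mem (H.incl_mem u)) y _ (H.incl_mem u))
  map_add' y z := H.incl_injective (by
    rw [map_add, CStarSub.incl_elem, CStarSub.incl_elem, CStarSub.incl_elem, mul_add, add_mul])
  map_smul' c y := H.incl_injective (by
    rw [map_smul, CStarSub.incl_elem, CStarSub.incl_elem, mul_smul_comm, smul_mul_assoc,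
      RingHom.id_apply])

theorem compression_incl {H : CStarSub Y} (hH : IsHereditary H) (u h : H) :
    compression hH u (H.incl h) = star u * h * u :=
  H.incl_injective (by
    rw [map_mul, map_mul, map_star]
    rfl)

/-- The map `∑ yᵢ ⊗ dᵢ ↦ ∑ f(u* yᵢ u) g(dᵢ)`. -/
def compressedProduct {H : CStarSub Y} (hH : IsHereditary H) (u : H) (f : H →⋆ₙₐ[ℂ] E)
    (g : D →⋆ₙₐ[ℂ] E) : Y ⊗[ℂ] D →ₗ[ℂ] E :=
  productMap f g ∘ₗ TensorProduct.map (compression hH u) LinearMap.id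

theorem compressedProduct_tmul {H : CStarSub Y} (hH : IsHereditary H) (u : H) (f : H →⋆ₙₐ[ℂ] E)
    (g : D →⋆ₙₐ[ℂ] E) (y : Y) (d : D) :
    compressedProduct hH u f g (y ⊗ₜ d) = f (compression hH u y) * g d := rfl

theorem compressedProduct_star {H : CStarSub Y} (hH : IsHereditary H) (u : H)
    {f : H →⋆ₙₐ[ℂ] E} {g : D →⋆ₙₐ[ℂ] E} (hc : ∀ h d, Commute (f h) (g d)) (x : Y ⊗[ℂ] D) :
    compressedProduct hH u f g (star x) = star (compressedProduct hH u f g x) := by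
  induction x with
  | zero => rw [star_zero, map_zero, star_zero]
  | add x y hx hy => rw [star_add, map_add, map_add, star_add, hx, hy]
  | tmul y d =>
    have h1 : compression hH u (star y) = star (compression hH u y) := H.incl_injective (by
      rw [map_star H.incl]
      change star (H.incl u) * star y * H.incl u = star (star (H.incl u) * y * H.incl u)
      rw [star_mul, star_mul, star_star, mul_assoc])
    rw [TensorProduct.star_tmul, compressedProduct_tmul, compressedProduct_tmul, h1, star_mul,
      ← map_star f, ← map_star g, (hc _ _).eq]

theorem exists_compressedProduct_eq_sum {H : CStarSub Y} (hH : IsHereditary H) (u : H)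
    {f : H →⋆ₙₐ[ℂ] E} {g : D →⋆ₙₐ[ℂ] E} (hc : ∀ h d, Commute (f h) (g d)) (x : Y ⊗[ℂ] D) :
    ∃ (n : ℕ) (e : Fin n → E),
      compressedProduct hH u f g (star x * x) = ∑ l, star (e l) * e l := by
  obtain ⟨n, y, d, rfl⟩ := TensorProduct.exists_sum_tmul_eq x
  rcases Nat.eq_zero_or_pos n with rfl | hn
  · exact ⟨0, fun _ => 0, by simp⟩
  have hℓ : ∀ i k, star (y i * H.incl u) * (y k * H.incl u) ∈ H.toSub := fun i k => by
    rw [star_mul, mul_assoc, ← mul_assoc (star (y i)), ← mul_assoc]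
    exact hH _ (star_mem (H.incl_mem u)) _ _ (H.incl_mem u)
  obtain ⟨N, hN⟩ := exists_gram_sqrt H (⟨0, hn⟩ : Fin n) (fun i => y i * H.incl u) hℓ
  have hN' : ∀ i k, compression hH u (star (y i) * y k) = ∑ l, star (N l i) * N l k :=
    fun i k => (H.incl_injective (by
      rw [hN, CStarSub.incl_elem]
      change star (y i * H.incl u) * (y k * H.incl u)
        = star (H.incl u) * (star (y i) * y k) * H.incl u
      rw [star_mul]
      simp only [mul_assoc])).symm
  refine ⟨n, fun l => ∑ k, f (N l k) * g (d k), ?_⟩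
  have h1 : compressedProduct hH u f g (star (∑ k, y k ⊗ₜ[ℂ] d k) * ∑ k, y k ⊗ₜ[ℂ] d k)
      = ∑ i, ∑ k, ∑ l, star (f (N l i) * g (d i)) * (f (N l k) * g (d k)) := by
    rw [star_sum, Finset.sum_mul_sum, map_sum]
    refine Finset.sum_congr rfl fun i _ => ?_
    rw [map_sum]
    refine Finset.sum_congr rfl fun k _ => ?_
    rw [TensorProduct.star_tmul, Algebra.TensorProduct.tmul_mul_tmul, compressedProduct_tmul, hN',
      map_sum, Finset.sum_mul]
    refine Finset.sum_congr rfl fun l _ => ?_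
    rw [map_mul, map_mul, map_star f, map_star g, star_mul, ← map_star f, ← map_star g]
    rw [mul_assoc, ← mul_assoc (f (N l k)), (hc (N l k) (star (d i))).eq, ← mul_assoc,
      ← mul_assoc, ← mul_assoc, (hc (star (N l i)) (star (d i))).eq]
  rw [h1]
  have h2 : ∀ l, star (∑ k, f (N l k) * g (d k)) * (∑ k, f (N l k) * g (d k))
      = ∑ i, ∑ k, star (f (N l i) * g (d i)) * (f (N l k) * g (d k)) := fun l => by
    rw [star_sum, Finset.sum_mul_sum]
  simp only [h2]
  refine (Finset.sum_congr rfl fun i _ => Finset.sum_comm).trans ?_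
  exact Finset.sum_comm

/-- Positive functionals on the compressed product are dominated by the maximal norm. -/
theorem norm_compressedProduct_le {H : CStarSub Y} (hH : IsHereditary H) (u : H)
    {f : H →⋆ₙₐ[ℂ] E} {g : D →⋆ₙₐ[ℂ] E} (hc : ∀ h d, Commute (f h) (g d)) (τ : E →ₗ[ℂ] ℂ)
    (hτn : ∀ x, ‖τ x‖ ≤ ‖x‖) (hτs : ∀ x, τ (star x) = star (τ x))
    (hτp : ∀ x, 0 ≤ (τ (star x * x)).re) (s x : Y ⊗[ℂ] D) :
    ENNReal.ofReal ‖τ (compressedProduct hH u f g (star x * (s * x)))‖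
      ≤ maxNorm s * ENNReal.ofReal ‖compressedProduct hH u f g (star x * x)‖ := by
  let Ψ := compressedProduct hH u f g
  let core : PreInnerProductSpace.Core ℂ (Y ⊗[ℂ] D) :=
    { inner := fun x y => τ (Ψ (star x * y))
      conj_inner_symm := fun x y => by
        change star (τ (Ψ (star y * x))) = τ (Ψ (star x * y))
        rw [← hτs, ← compressedProduct_star hH u hc, tensor_star_mul, star_star]
      re_inner_nonneg := fun x => by
        obtain ⟨n, e, he⟩ := exists_compressedProduct_eq_sum hH u hc x
        change 0 ≤ (τ (Ψ (star x * x))).re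
        rw [show Ψ (star x * x) = _ from he, map_sum, Complex.re_sum]
        exact Finset.sum_nonneg fun l _ => hτp (e l)
      add_left := fun x y z => by
        change τ (Ψ (star (x + y) * z)) = τ (Ψ (star x * z)) + τ (Ψ (star y * z))
        rw [star_add, add_mul, map_add, map_add]
      smul_left := fun x y r => by
        change τ (Ψ (star (r • x) * y)) = star r * τ (Ψ (star x * y))
        rw [star_smul, smul_mul_assoc, map_smul, map_smul, smul_eq_mul] }
  let _ : SeminormedAddCommGroup (Y ⊗[ℂ] D) :=
    InnerProductSpace.Core.toSeminormedAddCommGroup (c := core)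
  let _ : InnerProductSpace ℂ (Y ⊗[ℂ] D) := InnerProductSpace.ofCore core
  have hinner : ∀ x y : Y ⊗[ℂ] D, inner ℂ x y = τ (Ψ (star x * y)) := fun _ _ => rfl
  let α : Y →ₗ[ℂ] (Y ⊗[ℂ] D) →ₗ[ℂ] (Y ⊗[ℂ] D) :=
    { toFun := fun b => LinearMap.rTensor D (LinearMap.mulLeft ℂ b)
      map_add' := fun b b' => by
        rw [← LinearMap.rTensor_add]; congr 1; ext z; simp [add_mul]
      map_smul' := fun c b => by
        rw [RingHom.id_apply, ← LinearMap.rTensor_smul]; congr 1; ext z; exact smul_mul_assoc c b z }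
  let β : D →ₗ[ℂ] (Y ⊗[ℂ] D) →ₗ[ℂ] (Y ⊗[ℂ] D) :=
    { toFun := fun b => LinearMap.lTensor Y (LinearMap.mulLeft ℂ b)
      map_add' := fun b b' => by
        rw [← LinearMap.lTensor_add]; congr 1; ext z; simp [add_mul]
      map_smul' := fun c b => by
        rw [RingHom.id_apply, ← LinearMap.lTensor_smul]; congr 1; ext z; exact smul_mul_assoc c b z }
  have hα : ∀ b y d, α b (y ⊗ₜ d) = (b * y) ⊗ₜ[ℂ] d := fun _ _ _ => rfl
  have hβ : ∀ b y d, β b (y ⊗ₜ d) = y ⊗ₜ[ℂ] (b * d) := fun _ _ _ => rfl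
  have hαmul : ∀ a b x, α (a * b) x = α a (α b x) := by
    intro a b x
    induction x with
    | zero => simp
    | add x y hx hy => rw [map_add, map_add, map_add, hx, hy]
    | tmul y d => rw [hα, hα, hα, mul_assoc]
  have hβmul : ∀ a b x, β (a * b) x = β a (β b x) := by
    intro a b x
    induction x with
    | zero => simp
    | add x y hx hy => rw [map_add, map_add, map_add, hx, hy]
    | tmul y d => rw [hβ, hβ, hβ, mul_assoc]
  have hαstar : ∀ a x y, inner ℂ (α a x) y = inner ℂ x (α (star a) y) := by
    intro a x y
    induction x with
    | zero => rw [map_zero, inner_zero_left, inner_zero_left]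
    | add x x' hx hx' => rw [map_add, inner_add_left, inner_add_left, hx, hx']
    | tmul s d =>
      induction y with
      | zero => rw [map_zero, inner_zero_right, inner_zero_right]
      | add y y' hy hy' => rw [map_add, inner_add_right, inner_add_right, hy, hy']
      | tmul s' d' =>
        rw [hα, hα, hinner, hinner, TensorProduct.star_tmul, TensorProduct.star_tmul,
          Algebra.TensorProduct.tmul_mul_tmul, Algebra.TensorProduct.tmul_mul_tmul, star_mul,
          mul_assoc]
  have hβstar : ∀ a x y, inner ℂ (β a x) y = inner ℂ x (β (star a) y) := by
    intro a x y
    induction x with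
    | zero => rw [map_zero, inner_zero_left, inner_zero_left]
    | add x x' hx hx' => rw [map_add, inner_add_left, inner_add_left, hx, hx']
    | tmul s d =>
      induction y with
      | zero => rw [map_zero, inner_zero_right, inner_zero_right]
      | add y y' hy hy' => rw [map_add, inner_add_right, inner_add_right, hy, hy']
      | tmul s' d' =>
        rw [hβ, hβ, hinner, hinner, TensorProduct.star_tmul, TensorProduct.star_tmul,
          Algebra.TensorProduct.tmul_mul_tmul, Algebra.TensorProduct.tmul_mul_tmul, star_mul,
          mul_assoc]
  let F := completionRep α hαmul hαstar
  let G := completionRep β hβmul hβstar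
  have hF : ∀ b (x : Y ⊗[ℂ] D), F b (x : Completion (Y ⊗[ℂ] D)) = (α b x : Y ⊗[ℂ] D) :=
    completionRep_coe α hαmul hαstar
  have hG : ∀ b (x : Y ⊗[ℂ] D), G b (x : Completion (Y ⊗[ℂ] D)) = (β b x : Y ⊗[ℂ] D) :=
    completionRep_coe β hβmul hβstar
  have hFG : ∀ b d, Commute (F b) (G d) := by
    intro b d
    refine completion_clm_ext fun x => ?_
    change F b (G d x) = G d (F b x)
    rw [hF, hG, hG, hF]
    congr 1
    induction x with
    | zero => simp
    | add x y hx hy => rw [map_add, map_add, map_add, map_add, hx, hy]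
    | tmul y d => rw [hα, hβ, hβ, hα]
  have hprod : ∀ s x : Y ⊗[ℂ] D, productMap F G s (x : Completion (Y ⊗[ℂ] D))
      = ((s * x : Y ⊗[ℂ] D) : Completion (Y ⊗[ℂ] D)) := by
    intro s x
    induction s with
    | zero => rw [map_zero, zero_mul]; rfl
    | add s t hs ht => rw [map_add, add_mul, Completion.coe_add, ← hs, ← ht]; rfl
    | tmul y d =>
      change F y (G d x) = _
      rw [hG, hF]
      congr 1
      induction x with
      | zero => simp
      | add x y hx hy => rw [map_add, map_add, mul_add, hx, hy]
      | tmul y d => rw [hβ, hα, Algebra.TensorProduct.tmul_mul_tmul]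
  have hx : ‖x‖ ^ 2 ≤ ‖Ψ (star x * x)‖ := by
    rw [← inner_self_eq_norm_sq (𝕜 := ℂ), hinner]
    exact (Complex.re_le_norm _).trans (hτn _)
  have h1 : ‖τ (Ψ (star x * (s * x)))‖ ≤ ‖productMap F G s‖ * ‖Ψ (star x * x)‖ := by
    rw [← hinner, ← Completion.inner_coe, ← hprod]
    calc _ ≤ ‖(x : Completion (Y ⊗[ℂ] D))‖ * ‖productMap F G s (x : Completion (Y ⊗[ℂ] D))‖ :=
          norm_inner_le_norm _ _
      _ ≤ ‖(x : Completion (Y ⊗[ℂ] D))‖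
          * (‖productMap F G s‖ * ‖(x : Completion (Y ⊗[ℂ] D))‖) := by
          gcongr
          exact ContinuousLinearMap.le_opNorm _ _
      _ = ‖productMap F G s‖ * ‖x‖ ^ 2 := by rw [Completion.norm_coe]; ring
      _ ≤ _ := by gcongr
  refine (ENNReal.ofReal_le_ofReal h1).trans ?_
  rw [ENNReal.ofReal_mul (norm_nonneg _), ofReal_norm (productMap F G s)]
  exact mul_le_mul' (enorm_productMap_le_maxNorm hFG s) le_rfl

end HereditaryNorm

section Hereditary

theorem Nondegenerate.mem_of_forall {I : Type v} {D : Type w} [NonUnitalCStarAlgebra I]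
    [NonUnitalCStarAlgebra D] {φ : I →⋆ₙₐ[ℂ] D} (hφ : Nondegenerate φ) {N : Submodule ℂ D}
    (hN : IsClosed (N : Set D)) (h : ∀ i d, φ i * d ∈ N) (d : D) : d ∈ N := by
  refine hN.closure_subset_iff.2 ?_ (hφ d)
  refine Submodule.span_le.2 ?_
  rintro _ ⟨i, d, rfl⟩
  exact h i d

theorem isHereditary_her {X : Type v} {Y : Type w} [NonUnitalCStarAlgebra X]
    [NonUnitalCStarAlgebra Y] (φ : X →⋆ₙₐ[ℂ] Y) : IsHereditary (her φ) := by
  have hcl := (her φ).closed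
  have h1 : ∀ (i : X) (d : her φ) (y : Y) (b : her φ),
      star ((her φ).incl (completed φ i * d)) * y * (her φ).incl b ∈ (her φ).toSub := by
    intro i d y b
    let N : Submodule ℂ (her φ) := (her φ).toSub.toSubmodule.comap
      (LinearMap.mulLeft ℂ (star ((her φ).incl (completed φ i * d)) * y)
        ∘ₗ ((her φ).incl : her φ →ₗ[ℂ] Y))
    refine (nondegenerate_completed φ).mem_of_forall (N := N) ?_ (fun k e => ?_) b
    · exact hcl.preimage (continuous_const.mul (map_continuous (her φ).incl))
    · change star ((her φ).incl (completed φ i * d)) * y * (her φ).incl (completed φ k * e) ∈ (her φ).toSub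
      rw [map_mul, map_mul, star_mul]
      change star ((her φ).incl d) * star (φ i) * y * (φ k * (her φ).incl e) ∈ (her φ).toSub
      rw [← map_star φ]
      have h2 : star ((her φ).incl d) * φ (star i) * y * (φ k * (her φ).incl e)
          = star ((her φ).incl d) * (φ (star i) * y * φ k) * (her φ).incl e := by
        simp only [mul_assoc]
      rw [h2]
      exact mul_mem (mul_mem (star_mem ((her φ).incl_mem d)) (CStarSub.subset_gen ⟨_, _, _, rfl⟩))
        ((her φ).incl_mem e)
  intro a ha y b hb
  let N : Submodule ℂ (her φ) :=
    { carrier := {d | star ((her φ).incl d) * y * b ∈ (her φ).toSub}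
      add_mem' := fun {d e} hd he => by
        change star ((her φ).incl (d + e)) * y * b ∈ (her φ).toSub
        rw [map_add, star_add, add_mul, add_mul]
        exact add_mem hd he
      zero_mem' := by
        change star ((her φ).incl 0) * y * b ∈ (her φ).toSub
        rw [map_zero, star_zero, zero_mul, zero_mul]
        exact zero_mem _
      smul_mem' := fun c d hd => by
        change star ((her φ).incl (c • d)) * y * b ∈ (her φ).toSub
        rw [map_smul, star_smul, smul_mul_assoc, smul_mul_assoc]
        exact SMulMemClass.smul_mem _ hd }
  have h2 := (nondegenerate_completed φ).mem_of_forall (N := N)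
    (hcl.preimage (((map_continuous (her φ).incl).star.mul continuous_const).mul continuous_const))
    (fun i d => h1 i d y ((her φ).elem b hb)) (star ((her φ).elem a ha))
  change star ((her φ).incl (star ((her φ).elem a ha))) * y * b ∈ (her φ).toSub at h2
  rwa [map_star, star_star] at h2

variable {Y D : Type u} [NonUnitalCStarAlgebra Y] [NonUnitalCStarAlgebra D]

theorem tendsto_star_mul_mul_self {H : Type v} [NonUnitalCStarAlgebra H] {α : Type w}
    {l : Filter α} {u k : α → H} {h : H} (hn : ∀ᶠ i in l, ‖u i‖ ≤ 1)
    (hr : Tendsto (fun i => h * u i) l (𝓝 h))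
    (hl : Tendsto (fun i => star h * u i) l (𝓝 (star h))) (hk : Tendsto k l (𝓝 h)) :
    Tendsto (fun i => star (u i) * k i * u i) l (𝓝 h) := by
  have hl' : Tendsto (fun i => star (u i) * h) l (𝓝 h) := by
    simpa using hl.star
  have hleft : Tendsto (fun i => star (u i) * k i) l (𝓝 h) := by
    have h0 : Tendsto (fun i => star (u i) * (k i - h)) l (𝓝 0) := by
      refine squeeze_zero_norm' ?_ (tendsto_iff_norm_sub_tendsto_zero.1 hk)
      filter_upwards [hn] with i hi
      refine (norm_mul_le _ _).trans ?_
      rw [norm_star]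
      exact mul_le_of_le_one_left (norm_nonneg _) hi
    simpa [mul_sub] using h0.add hl'
  have h0 : Tendsto (fun i => (star (u i) * k i - h) * u i) l (𝓝 0) := by
    refine squeeze_zero_norm' ?_ (tendsto_iff_norm_sub_tendsto_zero.1 hleft)
    filter_upwards [hn] with i hi
    exact (norm_mul_le _ _).trans (mul_le_of_le_one_right (norm_nonneg _) hi)
  simpa [sub_mul] using h0.add hr

theorem map_incl_star_mul_self (H : CStarSub Y) (s : H ⊗[ℂ] D) :
    TensorProduct.map (H.incl : H →ₗ[ℂ] Y) (LinearMap.id : D →ₗ[ℂ] D) (star s * s)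
      = star (TensorProduct.map (H.incl : H →ₗ[ℂ] Y) (LinearMap.id : D →ₗ[ℂ] D) s)
        * TensorProduct.map (H.incl : H →ₗ[ℂ] Y) (LinearMap.id : D →ₗ[ℂ] D) s := by
  have h : ∀ s t : H ⊗[ℂ] D,
      TensorProduct.map (H.incl : H →ₗ[ℂ] Y) (LinearMap.id : D →ₗ[ℂ] D) (star s * t)
      = star (TensorProduct.map (H.incl : H →ₗ[ℂ] Y) (LinearMap.id : D →ₗ[ℂ] D) s)
        * TensorProduct.map (H.incl : H →ₗ[ℂ] Y) (LinearMap.id : D →ₗ[ℂ] D) t := by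
    intro s t
    induction s with
    | zero => rw [star_zero, zero_mul, map_zero, star_zero, zero_mul]
    | add s s' hs hs' => rw [star_add, add_mul, map_add, map_add, star_add, add_mul, hs, hs']
    | tmul a d =>
      induction t with
      | zero => rw [mul_zero, map_zero, mul_zero]
      | add t t' ht ht' => rw [mul_add, map_add, map_add, mul_add, ht, ht']
      | tmul b e =>
        rw [TensorProduct.star_tmul, Algebra.TensorProduct.tmul_mul_tmul, TensorProduct.map_tmul,
          TensorProduct.map_tmul, TensorProduct.map_tmul, TensorProduct.star_tmul,
          Algebra.TensorProduct.tmul_mul_tmul]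
        rfl
  exact h s s

/-- The maximal norm on `H ⊗ D` is the restriction of the one on `Y ⊗ D`, if `H` is hereditary. -/
theorem maxNorm_le_of_isHereditary {H : CStarSub Y} (hH : IsHereditary H) (s : H ⊗[ℂ] D) :
    maxNorm s ≤ maxNorm (TensorProduct.map (H.incl : H →ₗ[ℂ] Y) (LinearMap.id : D →ₗ[ℂ] D) s) := by
  refine maxNorm_le fun E _ f g hc => ?_
  obtain ⟨l, hl, hn, hlr, hll⟩ := exists_approx_unit H
  obtain ⟨l', hl', hn', hlr', hll'⟩ := exists_approx_unit D
  let J : H ⊗[ℂ] D →ₗ[ℂ] Y ⊗[ℂ] D :=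
    TensorProduct.map (H.incl : H →ₗ[ℂ] Y) (LinearMap.id : D →ₗ[ℂ] D)
  let x : H × D → Y ⊗[ℂ] D := fun p => H.incl p.1 ⊗ₜ p.2
  have hev : ∀ᶠ p in l ×ˢ l', ‖p.1‖ ≤ 1 ∧ ‖p.2‖ ≤ 1 := hn.prod_mk hn'
  have hval : ∀ (p : H × D) (h : H) (d : D),
      compressedProduct hH p.1 f g (star (x p) * (J (h ⊗ₜ d) * x p))
        = f (star p.1 * (star p.1 * h * p.1) * p.1) * g (star p.2 * d * p.2) := by
    intro p h d
    have h1 : star (x p) * (J (h ⊗ₜ d) * x p)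
        = H.incl (star p.1 * h * p.1) ⊗ₜ[ℂ] (star p.2 * d * p.2) := by
      change star (H.incl p.1 ⊗ₜ[ℂ] p.2) * ((H.incl h ⊗ₜ[ℂ] d) * (H.incl p.1 ⊗ₜ[ℂ] p.2)) = _
      rw [TensorProduct.star_tmul, Algebra.TensorProduct.tmul_mul_tmul,
        Algebra.TensorProduct.tmul_mul_tmul, map_mul, map_mul, map_star, mul_assoc, mul_assoc]
    rw [h1, compressedProduct_tmul, compression_incl]
  have hlim : ∀ t : H ⊗[ℂ] D, Tendsto (fun p : H × D =>
      compressedProduct hH p.1 f g (star (x p) * (J t * x p))) (l ×ˢ l')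
        (𝓝 (productMap f g t)) := by
    intro t
    induction t with
    | zero => simp
    | add t t' ht ht' => simpa [add_mul, mul_add] using ht.add ht'
    | tmul h d =>
      simp only [hval]
      have ha : Tendsto (fun p : H × D => star p.1 * h * p.1) (l ×ˢ l') (𝓝 h) :=
        tendsto_star_mul_mul_self (hev.mono fun _ h => h.1) ((hll h).comp tendsto_fst)
          ((hll (star h)).comp tendsto_fst) tendsto_const_nhds
      have hb : Tendsto (fun p : H × D => star p.1 * (star p.1 * h * p.1) * p.1) (l ×ˢ l') (𝓝 h) :=
        tendsto_star_mul_mul_self (hev.mono fun _ h => h.1) ((hll h).comp tendsto_fst)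
          ((hll (star h)).comp tendsto_fst) ha
      have hd : Tendsto (fun p : H × D => star p.2 * d * p.2) (l ×ˢ l') (𝓝 d) :=
        tendsto_star_mul_mul_self (hev.mono fun _ h => h.2) ((hll' d).comp tendsto_snd)
          ((hll' (star d)).comp tendsto_snd) tendsto_const_nhds
      exact (((map_continuous f).tendsto h).comp hb).mul (((map_continuous g).tendsto d).comp hd)
  have hone : ∀ p : H × D, ‖p.1‖ ≤ 1 ∧ ‖p.2‖ ≤ 1 →
      ‖compressedProduct hH p.1 f g (star (x p) * x p)‖ ≤ 1 := by
    rintro p ⟨h1, h2⟩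
    have h3 : star (x p) * x p = H.incl (star p.1 * p.1) ⊗ₜ[ℂ] (star p.2 * p.2) := by
      change star (H.incl p.1 ⊗ₜ[ℂ] p.2) * (H.incl p.1 ⊗ₜ[ℂ] p.2) = _
      rw [TensorProduct.star_tmul, Algebra.TensorProduct.tmul_mul_tmul, map_mul, map_star]
    rw [h3, compressedProduct_tmul, compression_incl]
    have h4 : ‖star p.1 * (star p.1 * p.1) * p.1‖ ≤ 1 := by
      refine (norm_mul_le _ _).trans (mul_le_one₀ ?_ (norm_nonneg _) h1)
      refine (norm_mul_le _ _).trans (mul_le_one₀ (by rwa [norm_star]) (norm_nonneg _) ?_)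
      exact (norm_mul_le _ _).trans (mul_le_one₀ (by rwa [norm_star]) (norm_nonneg _) h1)
    have h5 : ‖star p.2 * p.2‖ ≤ 1 :=
      (norm_mul_le _ _).trans (mul_le_one₀ (by rwa [norm_star]) (norm_nonneg _) h2)
    exact (norm_mul_le _ _).trans (mul_le_one₀ ((NonUnitalStarAlgHom.norm_apply_le f _).trans h4)
      (norm_nonneg _) ((NonUnitalStarAlgHom.norm_apply_le g _).trans h5))
  obtain ⟨τ, hτn, hτs, hτp, hτ⟩ := exists_state (productMap f g s)
  have hτc : Continuous τ :=
    (τ.mkContinuous 1 fun x => by rw [one_mul]; exact hτn x).continuous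
  have hbound : ENNReal.ofReal ‖τ (productMap f g (star s * s))‖ ≤ maxNorm (J (star s * s)) := by
    have h1 : Tendsto (fun p : H × D => ENNReal.ofReal
        ‖τ (compressedProduct hH p.1 f g (star (x p) * (J (star s * s) * x p)))‖) (l ×ˢ l')
        (𝓝 (ENNReal.ofReal ‖τ (productMap f g (star s * s))‖)) :=
      ENNReal.tendsto_ofReal ((hτc.tendsto _).comp (hlim _)).norm
    refine le_of_tendsto h1 (hev.mono fun p hp => ?_)
    refine (norm_compressedProduct_le hH p.1 hc τ hτn hτs hτp _ _).trans ?_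
    refine (mul_le_mul' le_rfl (ENNReal.ofReal_le_one.2 (hone p hp))).trans (mul_one _).le
  have h1 : ‖productMap f g s‖ₑ ^ 2 ≤ maxNorm (J s) ^ 2 := by
    calc ‖productMap f g s‖ₑ ^ 2 = ENNReal.ofReal (‖productMap f g s‖ ^ 2) := by
          rw [ENNReal.ofReal_pow (norm_nonneg _), ofReal_norm]
      _ ≤ ENNReal.ofReal ‖τ (productMap f g (star s * s))‖ := by
          refine ENNReal.ofReal_le_ofReal ?_
          rw [← hτ, productMap_mul hc, productMap_star hc]
          exact Complex.re_le_norm _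
      _ ≤ maxNorm (J (star s * s)) := hbound
      _ ≤ maxNorm (J s) ^ 2 := by
          rw [show J (star s * s) = _ from map_incl_star_mul_self H s]
          exact maxNorm_star_mul_self_le _
  exact (ENNReal.pow_le_pow_left_iff two_ne_zero).1 h1

theorem IsNuclear.of_incl {A : Type u} [NonUnitalCStarAlgebra A] {H : CStarSub Y}
    (hH : IsHereditary H) {θ : A →ₗ[ℂ] H} (h : IsNuclear ((H.incl : H →ₗ[ℂ] Y) ∘ₗ θ)) :
    IsNuclear θ := by
  obtain ⟨K, hK⟩ := h
  refine ⟨K, fun D _ t => (maxNorm_le_of_isHereditary hH _).trans (le_trans (le_of_eq ?_) (hK D t))⟩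
  congr 1
  induction t with
  | zero => simp
  | add s t hs ht => rw [map_add, map_add, map_add, hs, ht]
  | tmul a d => rfl

end Hereditary

section Legs

variable {A B T : Type u} [NonUnitalCStarAlgebra A] [NonUnitalCStarAlgebra B]
  [NonUnitalCStarAlgebra T]

theorem IsNuclear.mul_right {θ : A →ₗ[ℂ] B} (hθ : IsNuclear θ) (m : 𝓜(ℂ, B)) :
    IsNuclear ((m.snd : B →ₗ[ℂ] B) ∘ₗ θ) :=
  hθ.mul_multiplier DoubleCentralizer.coeHom m fun x => (coe_mul_multiplier m (θ x)).symm

theorem IsNuclear.smul {θ : A →ₗ[ℂ] B} (hθ : IsNuclear θ) (c : ℂ) : IsNuclear (c • θ) :=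
  hθ.mul_multiplier DoubleCentralizer.coeHom (c • 1) fun x => by
    rw [mul_smul_comm, mul_one, LinearMap.smul_apply, map_smul]

theorem orbit_add (h : A →⋆ₙₐ[ℂ] 𝓜(ℂ, T)) (b c : T) : orbit h (b + c) = orbit h b + orbit h c :=
  LinearMap.ext fun x => map_add (h x).fst b c

theorem orbit_zero (h : A →⋆ₙₐ[ℂ] 𝓜(ℂ, T)) : orbit h 0 = 0 :=
  LinearMap.ext fun x => map_zero (h x).fst

theorem orbit_smul (h : A →⋆ₙₐ[ℂ] 𝓜(ℂ, T)) (r : ℂ) (c : T) : orbit h (r • c) = r • orbit h c :=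
  LinearMap.ext fun x => map_smul (h x).fst r c

theorem orbit_fst (h : A →⋆ₙₐ[ℂ] 𝓜(ℂ, T)) (a : A) (c : T) :
    orbit h ((h a).fst c) = orbit h c ∘ₗ orbit DoubleCentralizer.coeHom a :=
  LinearMap.ext fun x => by
    change (h x).fst ((h a).fst c) = (h (x * a)).fst c
    rw [map_mul]
    rfl

/-- The elements whose orbits under `h` are nuclear. -/
def nuclearVectors (h : A →⋆ₙₐ[ℂ] 𝓜(ℂ, T)) : Submodule ℂ T where
  carrier := {c | IsNuclear (orbit h c)}
  add_mem' {b c} hb hc := by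
    change IsNuclear _
    rw [orbit_add]
    exact IsNuclear.add hb hc
  zero_mem' := by
    change IsNuclear _
    rw [orbit_zero]
    exact IsNuclear.zero
  smul_mem' r c hc := by
    change IsNuclear _
    rw [orbit_smul]
    exact IsNuclear.smul hc r

theorem isClosed_nuclearVectors (h : A →⋆ₙₐ[ℂ] 𝓜(ℂ, T)) :
    IsClosed (nuclearVectors h : Set T) :=
  isClosed_setOf_isNuclear_orbit h (NonUnitalStarAlgHom.id ℂ T)

theorem mul_mem_nuclearVectors {h : A →⋆ₙₐ[ℂ] 𝓜(ℂ, T)} {c : T} (hc : c ∈ nuclearVectors h)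
    (d : T) : c * d ∈ nuclearVectors h :=
  IsNuclear.mul_multiplier (θ := orbit h c) hc DoubleCentralizer.coeHom
    (DoubleCentralizer.coeHom d) fun x => by
      rw [← map_mul]
      exact congrArg _ (multiplier_fst_mul (h x) c d)

theorem fst_mem_nuclearVectors {h : A →⋆ₙₐ[ℂ] 𝓜(ℂ, T)} {c : T} (hc : c ∈ nuclearVectors h)
    (a : A) : (h a).fst c ∈ nuclearVectors h := by
  change IsNuclear _
  rw [orbit_fst]
  exact IsNuclear.comp_orbit hc _ a

/-- The elements that map `T` into `N` under `κ`. -/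
def transporter {M : Type v} {T : Type w} [NonUnitalCStarAlgebra M] [NonUnitalCStarAlgebra T]
    (κ : M →⋆ₙₐ[ℂ] 𝓜(ℂ, T)) (N : Submodule ℂ T) : Submodule ℂ M where
  carrier := {m | ∀ d, (κ m).fst d ∈ N}
  add_mem' {v w} hv hw d := by
    rw [map_add]
    exact add_mem (hv d) (hw d)
  zero_mem' d := by
    rw [map_zero]
    exact zero_mem _
  smul_mem' r w hw d := by
    rw [map_smul]
    exact Submodule.smul_mem _ r (hw d)

theorem isClosed_transporter {M : Type v} {T : Type w} [NonUnitalCStarAlgebra M]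
    [NonUnitalCStarAlgebra T] (κ : M →⋆ₙₐ[ℂ] 𝓜(ℂ, T)) {N : Submodule ℂ T}
    (hN : IsClosed (N : Set T)) : IsClosed (transporter κ N : Set M) := by
  have : (transporter κ N : Set M) = ⋂ d, {m | (κ m).fst d ∈ N} := by
    ext w
    simp only [Set.mem_iInter]
    rfl
  rw [this]
  refine isClosed_iInter fun d => hN.preimage ?_
  have h1 : Continuous fun m : 𝓜(ℂ, T) => m.fst d := by
    refine (LinearMap.mkContinuous (⟨⟨fun m : 𝓜(ℂ, T) => m.fst d, fun _ _ => rfl⟩,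
      fun _ _ => rfl⟩ : 𝓜(ℂ, T) →ₗ[ℂ] T) ‖d‖ fun m => ?_).continuous
    change ‖m.fst d‖ ≤ _
    rw [mul_comm, ← DoubleCentralizer.norm_fst]
    exact m.fst.le_opNorm d
  exact h1.comp (map_continuous κ)

variable {φ : q A →⋆ₙₐ[ℂ] B}

theorem IsQNuclear.isNuclear_completed (hφ : IsQNuclear φ) :
    IsNuclear ((completed φ : q A →ₗ[ℂ] her φ) ∘ₗ q.gen A) :=
  IsNuclear.of_incl (isHereditary_her φ) hφ

theorem leg_sub_legBar (φ : q A →⋆ₙₐ[ℂ] B) (x : A) :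
    leg φ x - legBar φ x = (completed φ (q.gen A x) : 𝓜(ℂ, her φ)) := by
  rw [← canonicalExt_apply]
  exact (map_sub (canonicalExt φ) (ι A x) (ιbar A x)).symm

theorem completed_gen_mem_nuclearVectors (hφ : IsQNuclear φ) (y : A) :
    completed φ (q.gen A y) ∈ nuclearVectors (leg φ) := by
  have h0 := hφ.isNuclear_completed
  have h1 := (h0.comp_orbit DoubleCentralizer.coeHom y).sub (h0.mul_right (legBar φ y))
  change IsNuclear _
  convert h1 using 1
  refine LinearMap.ext fun x => coe_injective (her φ) ?_
  change (((leg φ x).fst (completed φ (q.gen A y)) : her φ) : 𝓜(ℂ, her φ))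
    = DoubleCentralizer.coeHom (completed φ (q.gen A (x * y))
      - (legBar φ y).snd (completed φ (q.gen A x)))
  rw [map_sub]
  change _ = (completed φ (q.gen A (x * y)) : 𝓜(ℂ, her φ))
      - (((legBar φ y).snd (completed φ (q.gen A x)) : her φ) : 𝓜(ℂ, her φ))
  rw [← multiplier_mul_coe, ← coe_mul_multiplier, ← leg_sub_legBar, ← leg_sub_legBar,
    ← leg_sub_legBar, map_mul, map_mul, mul_sub, sub_mul]
  abel

/-- If `φ : qA → B` is `q`-nuclear, then `φ₀°ι : A → 𝓜(B₀)` is weakly nuclear relative to `B₀`. -/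
theorem IsQNuclear.isNuclear_orbit_leg (hφ : IsQNuclear φ) (c : her φ) :
    IsNuclear (orbit (leg φ) c) := by
  have hcl := isClosed_nuclearVectors (leg φ)
  let P : Submodule ℂ (Q A) := transporter (canonicalExt φ) (nuclearVectors (leg φ))
  have hPcl : IsClosed (P : Set (Q A)) := isClosed_transporter (canonicalExt φ) hcl
  have hPr : ∀ w ∈ P, ∀ v, w * v ∈ P := fun w hw v d => by
    rw [map_mul]
    exact hw _
  have hPl : ∀ a, ∀ w ∈ P, ι A a * w ∈ P := fun a w hw d => by
    rw [map_mul]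
    exact fst_mem_nuclearVectors (hw d) a
  have hPq : ∀ x, ι A x - ιbar A x ∈ P := fun x d => by
    change (canonicalExt φ ((q A).incl (q.gen A x))).fst d ∈ _
    rw [canonicalExt_apply]
    exact mul_mem_nuclearVectors (completed_gen_mem_nuclearVectors hφ x) d
  let S : CStarSub (Q A) :=
    { toSub :=
        { carrier := {w | w - ι A (Q.fold A w) ∈ P ∧ star w - ι A (Q.fold A (star w)) ∈ P}
          add_mem' := fun {v w} hv hw => by
            refine ⟨?_, ?_⟩
            · rw [map_add, map_add, add_sub_add_comm]
              exact add_mem hv.1 hw.1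
            · rw [star_add, map_add, map_add, add_sub_add_comm]
              exact add_mem hv.2 hw.2
          zero_mem' := by
            refine ⟨?_, ?_⟩
            · rw [map_zero, map_zero, sub_zero]
              exact zero_mem _
            · rw [star_zero, map_zero, map_zero, sub_zero]
              exact zero_mem _
          mul_mem' := by
            have hm : ∀ v w, v - ι A (Q.fold A v) ∈ P → w - ι A (Q.fold A w) ∈ P →
                v * w - ι A (Q.fold A (v * w)) ∈ P := fun v w hv hw => by
              have := add_mem (hPr _ hv w) (hPl (Q.fold A v) _ hw)
              rwa [sub_mul, mul_sub, sub_add_sub_cancel, ← map_mul, ← map_mul] at this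
            exact fun {v w} hv hw => ⟨hm v w hv.1 hw.1, by
              rw [star_mul]
              exact hm _ _ hw.2 hv.2⟩
          smul_mem' := fun r w hw => by
            refine ⟨?_, ?_⟩
            · rw [map_smul, map_smul, ← smul_sub]
              exact Submodule.smul_mem _ _ hw.1
            · rw [star_smul, map_smul, map_smul, ← smul_sub]
              exact Submodule.smul_mem _ _ hw.2
          star_mem' := fun {w} hw => ⟨hw.2, by rw [star_star]; exact hw.1⟩ }
      closed := by
        have h1 : Continuous fun w => w - ι A (Q.fold A w) :=
          continuous_id.sub ((map_continuous (ι A)).comp (map_continuous (Q.fold A)))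
        exact (hPcl.preimage h1).inter (hPcl.preimage (h1.comp continuous_star)) }
  have hι : ∀ x, ι A x - ι A (Q.fold A (ι A x)) ∈ P := fun x => by
    rw [show Q.fold A (ι A x) = x from rfl, sub_self]
    exact zero_mem _
  have hιbar : ∀ x, ιbar A x - ι A (Q.fold A (ιbar A x)) ∈ P := fun x => by
    rw [show Q.fold A (ιbar A x) = x from rfl, ← neg_sub]
    exact neg_mem (hPq x)
  have hS : ∀ w : Q A, w ∈ S.toSub := by
    refine CStarSub.gen_induction S ?_
    rintro _ (⟨x, rfl⟩ | ⟨x, rfl⟩)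
    · refine ⟨hι x, ?_⟩
      change star (ι A x) - ι A (Q.fold A (star (ι A x))) ∈ P
      rw [← map_star]
      exact hι _
    · refine ⟨hιbar x, ?_⟩
      change star (ιbar A x) - ι A (Q.fold A (star (ιbar A x))) ∈ P
      rw [← map_star]
      exact hιbar _
  refine (nondegenerate_completed φ).mem_of_forall hcl (fun w d => ?_) c
  have h1 := (hS ((q A).incl w)).1
  rw [CStarSub.mem_ker.1 ((q A).incl_mem w), map_zero, sub_zero] at h1
  have h2 := h1 d
  rw [canonicalExt_apply] at h2
  exact h2

/-- If `φ : qA → B` is `q`-nuclear, then `φ₀°ῑ : A → 𝓜(B₀)` is weakly nuclear relative to `B₀`. -/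
theorem IsQNuclear.isNuclear_orbit_legBar (hφ : IsQNuclear φ) (c : her φ) :
    IsNuclear (orbit (legBar φ) c) := by
  have h1 := (hφ.isNuclear_orbit_leg c).sub
    (hφ.isNuclear_completed.mul_right (DoubleCentralizer.coeHom c))
  convert h1 using 1
  refine LinearMap.ext fun x => ?_
  change (legBar φ x).fst c = (leg φ x).fst c - (completed φ (q.gen A x) : 𝓜(ℂ, her φ)).fst c
  rw [← leg_sub_legBar, DoubleCentralizer.sub_fst]
  change _ = _ - ((leg φ x).fst c - (legBar φ x).fst c)
  abel

end Legs

section MultiplierIdeal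

variable {I : Type v} {M : Type w} [NonUnitalCStarAlgebra I] [NonUnitalCStarAlgebra M]
  {j : I →⋆ₙₐ[ℂ] M}

theorem idealAction_snd (hj : IsIdealEmbedding j) (m : M) (i : I) :
    j ((idealAction hj m).snd i) = j i * m := by
  obtain ⟨i', hi'⟩ := hj.mul_right m i
  rw [← hi']
  refine congrArg j (coe_injective I ?_)
  change (((idealAction hj m).snd i : I) : 𝓜(ℂ, I)) = _
  rw [← coe_mul_multiplier, ← idealAction_apply hj, hi', map_mul, idealAction_apply]
  rfl

/-- An ideal of `M` is an ideal of `𝓜(M)`. -/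
theorem IsIdealEmbedding.coeHom_comp (hj : IsIdealEmbedding j) :
    IsIdealEmbedding ((DoubleCentralizer.coeHom : M →⋆ₙₐ[ℂ] 𝓜(ℂ, M)).comp j) := by
  have hl : ∀ (m : 𝓜(ℂ, M)) (i : I), ∃ i', j i' = m.fst (j i) := by
    intro m i
    obtain ⟨l, hl, -, hr, -⟩ := exists_approx_unit I
    have hcl : IsClosed (Set.range j) :=
      (NonUnitalStarAlgHom.isometry j hj.inj).isClosedEmbedding.isClosed_range
    have ht : Tendsto (fun u => m.fst (j (u * i))) l (𝓝 (m.fst (j i))) :=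
      (m.fst.continuous.tendsto _).comp (((map_continuous j).tendsto i).comp (hr i))
    refine hcl.mem_of_tendsto ht (Eventually.of_forall fun u => ?_)
    rw [map_mul, multiplier_fst_mul]
    exact hj.mul_left _ i
  have hl' : ∀ (m : 𝓜(ℂ, M)) (i : I), ∃ i',
      (DoubleCentralizer.coeHom (j i') : 𝓜(ℂ, M)) = m * DoubleCentralizer.coeHom (j i) := by
    intro m i
    obtain ⟨i', hi'⟩ := hl m i
    refine ⟨i', ?_⟩
    rw [hi']
    exact (multiplier_mul_coe m (j i)).symm
  refine ⟨(coe_injective M).comp hj.inj, hl', fun m i => ?_⟩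
  obtain ⟨i', hi'⟩ := hl' (star m) (star i)
  refine ⟨star i', ?_⟩
  change (DoubleCentralizer.coeHom (j (star i')) : 𝓜(ℂ, M)) = DoubleCentralizer.coeHom (j i) * m
  rw [map_star, map_star, hi', star_mul, star_star, map_star, map_star, star_star]

end MultiplierIdeal

section WeaklyNuclear

variable {A X C : Type u} [NonUnitalCStarAlgebra A] [NonUnitalCStarAlgebra X]
  [NonUnitalCStarAlgebra C] {φ : q X →⋆ₙₐ[ℂ] C}

theorem isIdealEmbedding_M2C (φ : q X →⋆ₙₐ[ℂ] C) : IsIdealEmbedding (M2C φ).incl := by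
  have hl : ∀ M N, N ∈ (M2C φ).toSub → M * N ∈ (M2C φ).toSub := fun M N hN i k => by
    choose d hd using hN
    refine ⟨∑ l, (M i l).fst (d l k), ?_⟩
    rw [CStarMatrix.mul_apply]
    refine Eq.trans ?_
      (map_sum (DoubleCentralizer.coeHom : her φ →⋆ₙₐ[ℂ] 𝓜(ℂ, her φ)) _ _).symm
    refine Finset.sum_congr rfl fun l _ => ?_
    rw [hd]
    exact multiplier_mul_coe _ _
  refine ⟨(M2C φ).incl_injective, fun M N => ⟨(M2C φ).elem _ (hl M _ ((M2C φ).incl_mem N)), rfl⟩,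
    fun M N => ⟨(M2C φ).elem ((M2C φ).incl N * M) ?_, rfl⟩⟩
  rw [← star_star ((M2C φ).incl N * M), star_mul]
  exact star_mem (hl _ _ (star_mem ((M2C φ).incl_mem N)))

/-- The inclusion `J₀ → R`. -/
def J0.toR (φ : q X →⋆ₙₐ[ℂ] C) : J0 φ →⋆ₙₐ[ℂ] RAlg φ :=
  (RAlg φ).corestrict (J0 φ).incl fun z => ((J0 φ).incl_mem z).1

theorem J0.isIdealEmbedding_toR (φ : q X →⋆ₙₐ[ℂ] C) : IsIdealEmbedding (J0.toR φ) where
  inj _ _ h := (J0 φ).incl_injective (congrArg (RAlg φ).incl h)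
  mul_left r z := by
    obtain ⟨N, hN⟩ := (isIdealEmbedding_M2C φ).mul_left ((RAlg φ).incl r)
      ((M2C φ).elem ((J0 φ).incl z) ((J0 φ).incl_mem z).2)
    exact ⟨(J0 φ).elem ((RAlg φ).incl r * (J0 φ).incl z)
      ⟨mul_mem ((RAlg φ).incl_mem r) ((J0 φ).incl_mem z).1, hN ▸ (M2C φ).incl_mem N⟩, rfl⟩
  mul_right r z := by
    obtain ⟨N, hN⟩ := (isIdealEmbedding_M2C φ).mul_right ((RAlg φ).incl r)
      ((M2C φ).elem ((J0 φ).incl z) ((J0 φ).incl_mem z).2)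
    exact ⟨(J0 φ).elem ((J0 φ).incl z * (RAlg φ).incl r)
      ⟨mul_mem ((J0 φ).incl_mem z).1 ((RAlg φ).incl_mem r), hN ▸ (M2C φ).incl_mem N⟩, rfl⟩

set_option maxHeartbeats 1000000 in
/-- Weak nuclearity relative to `J₀` can be tested on the products `diag(η(b), η̄(b')) z`. -/
theorem isWeaklyNuclearIn_of_diagR {h : A →⋆ₙₐ[ℂ] 𝓜(ℂ, RAlg φ)}
    {T : CStarSub (CStarMatrix (Fin 2) (Fin 2) 𝓜(ℂ, her φ))} (hT : (J0 φ).toSub ≤ T.toSub)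
    (H : ∀ (p : X × X) (z : J0 φ), ∃ θ : A →ₗ[ℂ] T,
      (∀ x, T.incl (θ x) = (RAlg φ).incl ((h x).fst (diagR φ p)) * (J0 φ).incl z) ∧
        IsNuclear θ) :
    IsWeaklyNuclearIn h T := by
  let k : J0 φ →⋆ₙₐ[ℂ] T := T.corestrict (J0 φ).incl fun z => hT ((J0 φ).incl_mem z)
  let κ : RAlg φ →⋆ₙₐ[ℂ] 𝓜(ℂ, J0 φ) := idealAction (J0.isIdealEmbedding_toR φ)
  have hκ : ∀ r z, J0.toR φ ((κ r).fst z) = r * J0.toR φ z :=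
    idealAction_fst (J0.isIdealEmbedding_toR φ)
  let h' : A →⋆ₙₐ[ℂ] 𝓜(ℂ, J0 φ) := (idealAction (J0.isIdealEmbedding_toR φ).coeHom_comp).comp h
  have hh' : ∀ x z, J0.toR φ ((h' x).fst z) = (h x).fst (J0.toR φ z) := fun x z =>
    coe_injective (RAlg φ) ((idealAction_fst (J0.isIdealEmbedding_toR φ).coeHom_comp (h x) z).trans
      (multiplier_mul_coe (h x) (J0.toR φ z)))
  let N : Submodule ℂ (J0 φ) :=
    { carrier := {w | IsNuclear ((k : J0 φ →ₗ[ℂ] T) ∘ₗ orbit h' w)}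
      add_mem' := fun {b c} hb hc => by
        change IsNuclear _
        rw [orbit_add, LinearMap.comp_add]
        exact IsNuclear.add hb hc
      zero_mem' := by
        change IsNuclear _
        rw [orbit_zero, LinearMap.comp_zero]
        exact IsNuclear.zero
      smul_mem' := fun r c hc => by
        change IsNuclear _
        rw [orbit_smul, LinearMap.comp_smul]
        exact IsNuclear.smul hc r }
  have hN : IsClosed (N : Set (J0 φ)) := isClosed_setOf_isNuclear_orbit h' k
  have hdiag : ∀ p z, (κ (diagR φ p)).fst z ∈ N := by
    intro p z
    obtain ⟨θ, hθ, hθn⟩ := H p z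
    have h1 : (k : J0 φ →ₗ[ℂ] T) ∘ₗ orbit h' ((κ (diagR φ p)).fst z) = θ := by
      refine LinearMap.ext fun x => T.incl_injective ?_
      rw [hθ]
      change (RAlg φ).incl (J0.toR φ ((h' x).fst ((κ (diagR φ p)).fst z))) = _
      rw [hh', hκ, multiplier_fst_mul, map_mul]
      rfl
    change IsNuclear _
    rwa [h1]
  have hR : ∀ r z, (κ r).fst z ∈ N :=
    (nondegenerate_diagR φ).mem_of_forall (isClosed_transporter κ hN) fun p d z => by
      rw [map_mul]
      exact hdiag p _
  have htop : ∀ z, z ∈ N := by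
    intro z
    obtain ⟨l, hl, -, hr, -⟩ := exists_approx_unit (J0 φ)
    refine hN.mem_of_tendsto (hr z) (Eventually.of_forall fun u => ?_)
    have h1 := hR (J0.toR φ u) z
    rw [show κ (J0.toR φ u) = _ from idealAction_apply (J0.isIdealEmbedding_toR φ) u] at h1
    exact h1
  intro z hz
  refine ⟨(k : J0 φ →ₗ[ℂ] T) ∘ₗ orbit h' ((J0 φ).elem _ hz), fun x => ?_, htop _⟩
  change (RAlg φ).incl (J0.toR φ ((h' x).fst ((J0 φ).elem _ hz))) = _
  rw [hh']
  rfl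

variable {h : A →⋆ₙₐ[ℂ] 𝓜(ℂ, RAlg φ)} {α β : A →⋆ₙₐ[ℂ] 𝓜(ℂ, X)}

theorem isWeaklyNuclearIn_J0
    (hh : ∀ x b b', (h x).fst (diagR φ (b, b')) = diagR φ ((α x).fst b, (β x).fst b'))
    (hα : ∀ b, IsNuclear (orbit α b)) (hβ : ∀ b, IsNuclear (orbit β b)) :
    IsWeaklyNuclearIn h (J0 φ) := by
  refine isWeaklyNuclearIn_of_diagR le_rfl fun p z => ?_
  have hj := J0.isIdealEmbedding_toR φ
  let θ : A →ₗ[ℂ] RAlg φ :=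
    ((diagR φ).comp (NonUnitalStarAlgHom.inl ℂ X X) : X →ₗ[ℂ] RAlg φ) ∘ₗ orbit α p.1
      + ((diagR φ).comp (NonUnitalStarAlgHom.inr ℂ X X) : X →ₗ[ℂ] RAlg φ) ∘ₗ orbit β p.2
  have hθ : IsNuclear θ := ((hα p.1).hom_comp _).add ((hβ p.2).hom_comp _)
  have hval : ∀ x, θ x = (h x).fst (diagR φ p) := by
    intro x
    change diagR φ ((α x).fst p.1, 0) + diagR φ (0, (β x).fst p.2) = _
    rw [← map_add, Prod.mk_add_mk, add_zero, zero_add, ← hh]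
  refine ⟨orbit (idealAction hj) z ∘ₗ θ, fun x => ?_, ?_⟩
  · change (RAlg φ).incl (J0.toR φ ((idealAction hj (θ x)).fst z)) = _
    rw [idealAction_fst hj, hval, map_mul]
    rfl
  · exact hθ.mul_multiplier (idealAction hj) (DoubleCentralizer.coeHom z) fun x =>
      (multiplier_mul_coe _ z).symm

theorem IsWeaklyNuclearIn.of_le {S T : CStarSub (CStarMatrix (Fin 2) (Fin 2) 𝓜(ℂ, her φ))}
    (hST : S.toSub ≤ T.toSub) (hS : IsWeaklyNuclearIn h S) : IsWeaklyNuclearIn h T := by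
  intro z hz
  obtain ⟨θ, hθ, hθn⟩ := hS z hz
  let k : S →⋆ₙₐ[ℂ] T := T.corestrict S.incl fun z => hST (S.incl_mem z)
  exact ⟨(k : S →ₗ[ℂ] T) ∘ₗ θ, hθ, hθn.hom_comp k⟩

/-- The embedding `(c, c') ↦ diag(c, c')` of `C₀ × C₀` in `M₂(C₀)`. -/
def diagM2C (φ : q X →⋆ₙₐ[ℂ] C) : her φ × her φ →⋆ₙₐ[ℂ] M2C φ :=
  (M2C φ).corestrict ((diag 𝓜(ℂ, her φ)).comp (coeProd (her φ))) fun p i k => by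
    have h0 : (0 : 𝓜(ℂ, her φ)) = ((0 : her φ) : 𝓜(ℂ, her φ)) :=
      (map_zero (DoubleCentralizer.coeHom : her φ →⋆ₙₐ[ℂ] 𝓜(ℂ, her φ))).symm
    fin_cases i <;> fin_cases k
    · exact ⟨p.1, rfl⟩
    · exact ⟨0, h0⟩
    · exact ⟨0, h0⟩
    · exact ⟨p.2, rfl⟩

theorem sum_mul_single_eq_diag_mul {M : Type v} [CStarAlgebra M] (a b : M)
    (z : CStarMatrix (Fin 2) (Fin 2) M) :
    CStarMatrix.ofMatrix !![a * z 0 0, 0; 0, 0] * CStarMatrix.ofMatrix (Matrix.single 0 0 1)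
      + CStarMatrix.ofMatrix !![0, 0; 0, b * z 1 0] * CStarMatrix.ofMatrix (Matrix.single 1 0 1)
      + (CStarMatrix.ofMatrix !![a * z 0 1, 0; 0, 0] * CStarMatrix.ofMatrix (Matrix.single 0 1 1)
      + CStarMatrix.ofMatrix !![0, 0; 0, b * z 1 1] * CStarMatrix.ofMatrix (Matrix.single 1 1 1))
      = (CStarMatrix.ofMatrix !![a, 0; 0, b] : CStarMatrix (Fin 2) (Fin 2) M) * z := by
  ext i k
  fin_cases i <;> fin_cases k <;> simp [CStarMatrix.mul_apply, Matrix.single]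

set_option maxHeartbeats 1000000 in
theorem IsQNuclear.isWeaklyNuclearIn_M2C (hφ : IsQNuclear φ)
    (hh : ∀ x b b', (h x).fst (diagR φ (b, b')) = diagR φ ((α x).fst b, (β x).fst b')) :
    IsWeaklyNuclearIn h (M2C φ) := by
  refine isWeaklyNuclearIn_of_diagR (fun _ hz => hz.2) fun p z => ?_
  have hM := isIdealEmbedding_M2C φ
  let e : Fin 2 → Fin 2 → CStarMatrix (Fin 2) (Fin 2) 𝓜(ℂ, her φ) :=
    fun i k => CStarMatrix.ofMatrix (Matrix.single i k 1)
  choose c hc using ((J0 φ).incl_mem z).2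
  let θ₀ : Fin 2 → A →ₗ[ℂ] her φ := fun k => orbit (leg φ) (c 0 k) ∘ₗ orbit α p.1
  let θ₁ : Fin 2 → A →ₗ[ℂ] her φ := fun k => orbit (legBar φ) (c 1 k) ∘ₗ orbit β p.2
  have hθ₀ : ∀ k, IsNuclear (θ₀ k) := fun k => (hφ.isNuclear_orbit_leg _).comp_orbit α p.1
  have hθ₁ : ∀ k, IsNuclear (θ₁ k) := fun k => (hφ.isNuclear_orbit_legBar _).comp_orbit β p.2
  let inl := (diagM2C φ).comp (NonUnitalStarAlgHom.inl ℂ (her φ) (her φ))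
  let inr := (diagM2C φ).comp (NonUnitalStarAlgHom.inr ℂ (her φ) (her φ))
  have hnuc := fun k => (((hθ₀ k).hom_comp inl).mul_right (idealAction hM (e 0 k))).add
    (((hθ₁ k).hom_comp inr).mul_right (idealAction hM (e 1 k)))
  refine ⟨_, fun x => ?_, (hnuc 0).add (hnuc 1)⟩
  change (M2C φ).incl
    (((idealAction hM (e 0 0)).snd (inl (θ₀ 0 x)) + (idealAction hM (e 1 0)).snd (inr (θ₁ 0 x)))
    + ((idealAction hM (e 0 1)).snd (inl (θ₀ 1 x)) + (idealAction hM (e 1 1)).snd (inr (θ₁ 1 x))))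
    = _
  rw [map_add, map_add, map_add, idealAction_snd, idealAction_snd, idealAction_snd,
    idealAction_snd, show p = (p.1, p.2) from rfl, hh]
  have hl : ∀ t, (M2C φ).incl (inl t)
      = CStarMatrix.ofMatrix !![(t : 𝓜(ℂ, her φ)), 0; 0, 0] := fun t => by
    change CStarMatrix.ofMatrix !![(t : 𝓜(ℂ, her φ)), 0; 0, DoubleCentralizer.coeHom 0] = _
    rw [map_zero]
  have hr : ∀ t, (M2C φ).incl (inr t)
      = CStarMatrix.ofMatrix !![0, 0; 0, (t : 𝓜(ℂ, her φ))] := fun t => by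
    change CStarMatrix.ofMatrix !![DoubleCentralizer.coeHom 0, 0; 0, (t : 𝓜(ℂ, her φ))] = _
    rw [map_zero]
  have h0 : ∀ k, (θ₀ k x : 𝓜(ℂ, her φ)) = leg φ ((α x).fst p.1) * (J0 φ).incl z 0 k := fun k => by
    rw [hc, multiplier_mul_coe]
    rfl
  have h1 : ∀ k, (θ₁ k x : 𝓜(ℂ, her φ)) = legBar φ ((β x).fst p.2) * (J0 φ).incl z 1 k :=
    fun k => by
      rw [hc, multiplier_mul_coe]
      rfl
  have hd : ∀ b b', (RAlg φ).incl (diagR φ (b, b'))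
      = CStarMatrix.ofMatrix !![leg φ b, 0; 0, legBar φ b'] := fun b b' => rfl
  rw [hl, hl, hr, hr, h0, h0, h1, h1, hd]
  exact sum_mul_single_eq_diag_mul _ _ _

end WeaklyNuclear

section Product

variable {A B C : Type u} [NonUnitalCStarAlgebra A] [NonUnitalCStarAlgebra B]
  [NonUnitalCStarAlgebra C] {ρ : q A →⋆ₙₐ[ℂ] B} {ψ : q B →⋆ₙₐ[ℂ] C}

theorem q.map_gen (j : A →⋆ₙₐ[ℂ] B) (x : A) : q.map j (q.gen A x) = q.gen B (j x) :=
  (q B).incl_injective (map_sub (Q.map j) (ι A x) (ιbar A x))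

theorem IsQNuclear.restrictHer (hψ : IsQNuclear ψ) (ρ : q A →⋆ₙₐ[ℂ] B) :
    IsQNuclear (restrictHer ρ ψ) := by
  have h1 := hψ.comp_hom (her ρ).incl
  have h2 : ((KKNuc.restrictHer ρ ψ : q (her ρ) →ₗ[ℂ] C) ∘ₗ q.gen (her ρ))
      = ((ψ : q B →ₗ[ℂ] C) ∘ₗ q.gen B) ∘ₗ ((her ρ).incl : her ρ →ₗ[ℂ] B) :=
    LinearMap.ext fun x => congrArg ψ (q.map_gen (her ρ).incl x)
  unfold IsQNuclear
  rwa [h2]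

end Product
end KKNuc

end

theorem statement16 {A B C : Type u} [NonUnitalCStarAlgebra A] [NonUnitalCStarAlgebra B]
    [NonUnitalCStarAlgebra C] (ρ : KKNuc.q A →⋆ₙₐ[ℂ] B) (ψ : KKNuc.q B →⋆ₙₐ[ℂ] C) :
    (KKNuc.IsQNuclear ρ ∨ KKNuc.IsQNuclear ψ →
      KKNuc.IsWeaklyNuclearIn (KKNuc.h₁ ρ ψ) (KKNuc.M2C (KKNuc.restrictHer ρ ψ)) ∧
      KKNuc.IsWeaklyNuclearIn (KKNuc.h₂ ρ ψ) (KKNuc.M2C (KKNuc.restrictHer ρ ψ))) ∧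
    (KKNuc.IsQNuclear ρ →
      KKNuc.IsWeaklyNuclearIn (KKNuc.h₁ ρ ψ) (KKNuc.J0 (KKNuc.restrictHer ρ ψ)) ∧
      KKNuc.IsWeaklyNuclearIn (KKNuc.h₂ ρ ψ) (KKNuc.J0 (KKNuc.restrictHer ρ ψ))) := by
  have hJ : KKNuc.IsQNuclear ρ →
      KKNuc.IsWeaklyNuclearIn (KKNuc.h₁ ρ ψ) (KKNuc.J0 (KKNuc.restrictHer ρ ψ)) ∧
      KKNuc.IsWeaklyNuclearIn (KKNuc.h₂ ρ ψ) (KKNuc.J0 (KKNuc.restrictHer ρ ψ)) := fun hρ =>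
    ⟨KKNuc.isWeaklyNuclearIn_J0 (KKNuc.h₁_fst ρ ψ) hρ.isNuclear_orbit_leg
      hρ.isNuclear_orbit_legBar,
    KKNuc.isWeaklyNuclearIn_J0 (KKNuc.h₂_fst ρ ψ) hρ.isNuclear_orbit_legBar
      hρ.isNuclear_orbit_leg⟩
  refine ⟨?_, hJ⟩
  rintro (hρ | hψ)
  · exact ⟨(hJ hρ).1.of_le inf_le_right, (hJ hρ).2.of_le inf_le_right⟩
  · exact ⟨(hψ.restrictHer ρ).isWeaklyNuclearIn_M2C (KKNuc.h₁_fst ρ ψ),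
      (hψ.restrictHer ρ).isWeaklyNuclearIn_M2C (KKNuc.h₂_fst ρ ψ)⟩
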